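/- Let d ≥ 5 and let P be a prime centrally symmetric simplicial d-polytope with g_2(P) = C(d,2) − d. Then for every integer k with 4 ≤ k ≤ d and every face τ of ∂P of cardinality d−k (including the empty face when k = d), the link lk(τ) contains at least k pairs of antipodal vertices: there exist k vertices v_1, …, v_k of P such that all 2k vertices v_1, −v_1, …, v_k, −v_k are vertices of lk(τ). -/

import Mathlib

open Finset
open scoped Classical

noncomputable section

/-- A finite graph: a finite vertex set together with a finite set of edges,
where each edge is (intended to be) a 2-element subset of the vertex set. -/
structure FinGraph (ι : Type) where
  verts : Finset ι
  edges : Finset (Finset ι)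

/-- Every edge is a 2-element subset of the vertex set. -/
def FinGraph.Good {ι : Type} (G : FinGraph ι) : Prop :=
  ∀ e ∈ G.edges, e ⊆ G.verts ∧ e.card = 2

/-- The standard inner (dot) product on `ℝ^d`. -/
def dotR {d : ℕ} (x y : Fin d → ℝ) : ℝ := ∑ i, x i * y i

/-- An infinitesimal motion of the framework `(G, p)`. -/
def IsMotion {ι : Type} {d : ℕ} (G : FinGraph ι) (p m : ι → Fin d → ℝ) : Prop :=
  ∀ e ∈ G.edges, ∀ u ∈ e, ∀ v ∈ e, dotR (p u - p v) (m u - m v) = 0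

/-- The framework `(G, p)` is infinitesimally rigid in `ℝ^d`: every infinitesimal
motion is the restriction of a motion `x ↦ A x + b` of `ℝ^d` with `A` skew-symmetric. -/
def IsInfRigid {ι : Type} (d : ℕ) (G : FinGraph ι) (p : ι → Fin d → ℝ) : Prop :=
  ∀ m : ι → Fin d → ℝ, IsMotion G p m →
    ∃ (A : Matrix (Fin d) (Fin d) ℝ) (b : Fin d → ℝ),
      A.transpose = -A ∧ ∀ v ∈ G.verts, m v = A.mulVec (p v) + b

/-- A stress on the framework `(G, p)`. -/
def IsStress {ι : Type} {d : ℕ} (G : FinGraph ι) (p : ι → Fin d → ℝ)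
    (ω : Finset ι → ℝ) : Prop :=
  ∀ v ∈ G.verts,
    (∑ e ∈ G.edges.filter (fun e => v ∈ e), ∑ u ∈ e.erase v, ω e • (p v - p u)) = 0

/-- A centrally symmetric framework with free involution `ν` satisfying `p (ν v) = -(p v)`. -/
def IsCSFramework {ι : Type} {d : ℕ} (G : FinGraph ι) (p : ι → Fin d → ℝ) (ν : ι → ι) : Prop :=
  (∀ v ∈ G.verts, ν (ν v) = v) ∧
  (∀ v ∈ G.verts, ν v ∈ G.verts) ∧
  (∀ v ∈ G.verts, ν v ≠ v) ∧
  (∀ e ∈ G.edges, e.image ν ∈ G.edges) ∧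
  (∀ e ∈ G.edges, e.image ν ≠ e) ∧
  (∀ v ∈ G.verts, p (ν v) = -(p v))

/-- The convex body spanned by a finite point set. -/
def polyBody {d : ℕ} (V : Finset (Fin d → ℝ)) : Set (Fin d → ℝ) :=
  convexHull ℝ (V : Set (Fin d → ℝ))

/-- `(f, c)` is a supporting functional for `conv V` exposing the face `F`. -/
def IsSupport {d : ℕ} (V : Finset (Fin d → ℝ)) (f : (Fin d → ℝ) →ₗ[ℝ] ℝ) (c : ℝ)
    (F : Set (Fin d → ℝ)) : Prop :=
  (∀ y ∈ polyBody V, f y ≤ c) ∧ F = {y ∈ polyBody V | f y = c}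

/-- A proper face of the polytope `conv V`. -/
def IsProperFace {d : ℕ} (V : Finset (Fin d → ℝ)) (F : Set (Fin d → ℝ)) : Prop :=
  (∃ f c, IsSupport V f c F) ∧ F ≠ polyBody V

/-- A simplicial `d`-polytope in `ℝ^d`, recorded by its vertex set `V`: the polytope is
`conv V`, it is `d`-dimensional, every element of `V` is a vertex, and every proper face
is a simplex (the convex hull of its affinely independent vertex set). -/
structure SPolytope (d : ℕ) where
  V : Finset (Fin d → ℝ)
  span_top : affineSpan ℝ (V : Set (Fin d → ℝ)) = ⊤
  extreme : ∀ v ∈ V, v ∉ convexHull ℝ ((V.erase v : Finset (Fin d → ℝ)) : Set (Fin d → ℝ))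
  simplicial : ∀ F : Set (Fin d → ℝ), IsProperFace V F →
    AffineIndependent ℝ
      (fun x : {y : Fin d → ℝ // y ∈ (V : Set (Fin d → ℝ)) ∩ F} => (x : Fin d → ℝ)) ∧
    F = convexHull ℝ ((V : Set (Fin d → ℝ)) ∩ F)

/-- `s` is a face of the boundary complex `∂P`. -/
def BFace {d : ℕ} (P : SPolytope d) (s : Finset (Fin d → ℝ)) : Prop :=
  s ⊆ P.V ∧ ∃ F : Set (Fin d → ℝ), IsProperFace P.V F ∧ (s : Set (Fin d → ℝ)) ⊆ F

/-- The number of vertices of `∂P`. -/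
def f0 {d : ℕ} (P : SPolytope d) : ℕ := P.V.card

/-- The edges of `∂P`. -/
def edgeFinset {d : ℕ} (P : SPolytope d) : Finset (Finset (Fin d → ℝ)) :=
  P.V.powerset.filter fun e => e.card = 2 ∧ BFace P e

/-- The number of edges of `∂P`. -/
def f1 {d : ℕ} (P : SPolytope d) : ℕ := (edgeFinset P).card

/-- `g₂(P) = f₁ - d f₀ + C(d+1, 2)`. -/
def g2 {d : ℕ} (P : SPolytope d) : ℤ :=
  (f1 P : ℤ) - (d : ℤ) * (f0 P : ℤ) + ((d + 1).choose 2 : ℤ)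

/-- `P` is centrally symmetric. -/
def IsCS {d : ℕ} (P : SPolytope d) : Prop := ∀ v ∈ P.V, -v ∈ P.V

/-- A missing face of `∂P`. -/
def IsMissingFace {d : ℕ} (P : SPolytope d) (σ : Finset (Fin d → ℝ)) : Prop :=
  σ ⊆ P.V ∧ ¬ BFace P σ ∧ ∀ τ ⊂ σ, BFace P τ

/-- `P` is prime: `∂P` has no missing facet, i.e. no missing face of cardinality `d`. -/
def IsPrimePoly {d : ℕ} (P : SPolytope d) : Prop :=
  ¬ ∃ σ : Finset (Fin d → ℝ), IsMissingFace P σ ∧ σ.card = d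

/-- The graph (1-skeleton) of `∂P` as a framework graph. -/
def fullGraph {d : ℕ} (P : SPolytope d) : FinGraph (Fin d → ℝ) :=
  ⟨P.V, edgeFinset P⟩

/-- The graph (1-skeleton) of the star of the face `τ` in `∂P`. -/
def starGraph {d : ℕ} (P : SPolytope d) (τ : Finset (Fin d → ℝ)) : FinGraph (Fin d → ℝ) :=
  ⟨P.V.filter fun v => BFace P (insert v τ),
   P.V.powerset.filter fun e => e.card = 2 ∧ BFace P (e ∪ τ)⟩

/-- Adjacency in the graph of `∂P`. -/
def Adj {d : ℕ} (P : SPolytope d) (u v : Fin d → ℝ) : Prop :=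
  u ≠ v ∧ BFace P {u, v}

/-- `σ` is a face of the link of the face `τ` in `∂P`. -/
def LinkFace {d : ℕ} (P : SPolytope d) (τ σ : Finset (Fin d → ℝ)) : Prop :=
  Disjoint σ τ ∧ BFace P (σ ∪ τ)

/-- `P` is a `d`-dimensional cross-polytope: its vertex set is `{±b₁, …, ±b_d}`
for some basis `b₁, …, b_d` of `ℝ^d`. -/
def IsCrossPolytope {d : ℕ} (P : SPolytope d) : Prop :=
  ∃ b : Fin d → (Fin d → ℝ), LinearIndependent ℝ b ∧
    (P.V : Set (Fin d → ℝ)) = Set.range b ∪ Set.range (fun i => -(b i))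

/-- A facet of `P`: a proper face with `d` vertices. -/
def IsFacet {d : ℕ} (P : SPolytope d) (F : Set (Fin d → ℝ)) : Prop :=
  IsProperFace P.V F ∧ ((P.V : Set (Fin d → ℝ)) ∩ F).ncard = d

/-- `x` lies beyond exactly one facet of `P`: it is strictly separated from `P` by the
affine hull of one facet `F`, and not separated from `P` by the affine hull of any
other facet. -/
def BeyondExactlyOne {d : ℕ} (P : SPolytope d) (x : Fin d → ℝ) : Prop :=
  ∃ F : Set (Fin d → ℝ), IsFacet P F ∧
    (∀ f c, IsSupport P.V f c F → c < f x) ∧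
    (∀ F' : Set (Fin d → ℝ), IsFacet P F' → F' ≠ F →
      ∀ f c, IsSupport P.V f c F' → f x < c)

/-- `P` is obtained from a `d`-dimensional cross-polytope by symmetric stacking: there is
a sequence of cs simplicial `d`-polytopes starting at a cross-polytope and ending at `P`,
each obtained from the previous one as `conv (P_k ∪ {v, -v})` for a point `v` lying
beyond exactly one facet of `P_k`. -/
def SymmetricStackingFrom {d : ℕ} (P : SPolytope d) : Prop :=
  ∃ (m : ℕ) (Q : Fin (m + 1) → SPolytope d),
    (∀ k, IsCS (Q k)) ∧
    IsCrossPolytope (Q 0) ∧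
    Q (Fin.last m) = P ∧
    ∀ k : Fin m, ∃ v : Fin d → ℝ,
      BeyondExactlyOne (Q (Fin.castSucc k)) v ∧
      polyBody (Q (Fin.succ k)).V =
        convexHull ℝ (polyBody (Q (Fin.castSucc k)).V ∪ {v, -v})

/-- `P` is a stacked `d`-polytope: obtained from a `d`-simplex by repeatedly adding a
point beyond exactly one facet. -/
def IsStacked {d : ℕ} (P : SPolytope d) : Prop :=
  ∃ (m : ℕ) (R : Fin (m + 1) → SPolytope d),
    (R 0).V.card = d + 1 ∧
    R (Fin.last m) = P ∧
    ∀ k : Fin m, ∃ v : Fin d → ℝ,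
      BeyondExactlyOne (R (Fin.castSucc k)) v ∧
      polyBody (R (Fin.succ k)).V =
        convexHull ℝ (polyBody (R (Fin.castSucc k)).V ∪ {v})

/-- Every `d` vertices of `P`, no two of which are antipodal, are affinely independent. -/
def GenPos {d : ℕ} (P : SPolytope d) : Prop :=
  ∀ S : Finset (Fin d → ℝ), S ⊆ P.V → S.card = d →
    (∀ x ∈ S, ∀ y ∈ S, x ≠ -y) →
    AffineIndependent ℝ (fun s : {x : Fin d → ℝ // x ∈ S} => (s : Fin d → ℝ))

/-- The graph of the cone `v₀ * S` over a simplicial complex `S` (a set of finsets):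
the vertices of `S` together with `v₀`, and the edges of `S` together with all edges
from `v₀` to vertices of `S`. -/
def coneGraph {d : ℕ} (P : SPolytope d) (v0 : Fin d → ℝ)
    (S : Set (Finset (Fin d → ℝ))) : FinGraph (Fin d → ℝ) :=
  ⟨insert v0 (P.V.filter fun u => ({u} : Finset (Fin d → ℝ)) ∈ S),
   (P.V.powerset.filter fun e => e.card = 2 ∧ e ∈ S) ∪
     (P.V.filter fun u => ({u} : Finset (Fin d → ℝ)) ∈ S).image
       fun u => ({v0, u} : Finset (Fin d → ℝ))⟩

set_option linter.all false

namespace CSP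

variable {E : Type} [AddCommGroup E] [Module ℝ E] [FiniteDimensional ℝ E]

/-- Abstract centrally symmetric simplicial polytope data. -/
structure Sys (V : Finset E) (d : ℕ) : Prop where
  fr : Module.finrank ℝ E = d
  neg : ∀ v ∈ V, -v ∈ V
  span : Submodule.span ℝ (V : Set E) = ⊤
  simp : ∀ n : Module.Dual ℝ E, (∀ v ∈ V, n v ≤ 1) →
    LinearIndepOn ℝ id {v : E | v ∈ V ∧ n v = 1}
  vtx : ∀ v ∈ V, ∃ n : Module.Dual ℝ E, n v = 1 ∧ ∀ u ∈ V, n u ≤ 1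

/-- facets -/
def Fct (V : Finset E) (d : ℕ) (F : Finset E) : Prop :=
  F ⊆ V ∧ F.card = d ∧ ∃ n : Module.Dual ℝ E, (∀ v ∈ F, n v = 1) ∧ ∀ v ∈ V, v ∉ F → n v < 1

/-- faces -/
def Fc (V : Finset E) (d : ℕ) (s : Finset E) : Prop := ∃ F, Fct V d F ∧ s ⊆ F

/-- dual basis of a finset -/
def crd (F : Finset E) : E → Module.Dual ℝ E :=
  if h : ∃ c : E → Module.Dual ℝ E, (∀ u ∈ F, ∀ w ∈ F, c w u = if u = w then 1 else 0) ∧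
      ∀ x, x = ∑ w ∈ F, c w x • w then h.choose else 0

/-- normal functional -/
def nrm (F : Finset E) : Module.Dual ℝ E := ∑ w ∈ F, crd F w

theorem exists_crd {F : Finset E} (hli : LinearIndepOn ℝ id (F : Set E))
    (hc : F.card = Module.finrank ℝ E) :
    ∃ c : E → Module.Dual ℝ E, (∀ u ∈ F, ∀ w ∈ F, c w u = if u = w then 1 else 0) ∧
      ∀ x, x = ∑ w ∈ F, c w x • w := by
  have hli' : LinearIndependent ℝ (fun x : F => (x : E)) := hli
  let b : Module.Basis F ℝ E := basisOfLinearIndependentOfCardEqFinrank' (fun x : F => (x : E)) hli'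
    (by simpa using hc)
  have hb : ∀ i, b i = (i : E) := by intro i; simp [b]
  refine ⟨fun w => if h : w ∈ F then b.coord ⟨w, h⟩ else 0, ?_, ?_⟩
  · intro u hu w hw
    have : u = b ⟨u, hu⟩ := (hb ⟨u, hu⟩).symm
    simp only [hw, dif_pos]
    conv_lhs => rw [this]
    rw [Module.Basis.coord_apply, Module.Basis.repr_self, Finsupp.single_apply]
    simp [Subtype.mk_eq_mk]
  · intro x
    conv_lhs => rw [← b.sum_repr x]
    rw [← Finset.sum_coe_sort F]
    refine Finset.sum_congr rfl fun i _ => ?_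
    simp [hb]

theorem crd_spec {F : Finset E} (hli : LinearIndepOn ℝ id (F : Set E))
    (hc : F.card = Module.finrank ℝ E) :
    (∀ u ∈ F, ∀ w ∈ F, crd F w u = if u = w then 1 else 0) ∧
      ∀ x, x = ∑ w ∈ F, crd F w x • w := by
  have h := exists_crd hli hc
  unfold crd
  rw [dif_pos h]
  exact h.choose_spec

variable {V : Finset E} {d : ℕ}

theorem Fct.sub {F : Finset E} (h : Fct V d F) : F ⊆ V := h.1
theorem Fct.card {F : Finset E} (h : Fct V d F) : F.card = d := h.2.1

theorem Fct.li {F : Finset E} (h : Fct V d F) (hS : Sys V d) :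
    LinearIndepOn ℝ id (F : Set E) := by
  obtain ⟨h1, h2, n, h3, h4⟩ := h
  have := hS.simp n (fun v hv => by
    by_cases hF : v ∈ F
    · exact (h3 v hF).le
    · exact (h4 v hv hF).le)
  refine this.mono ?_
  intro v hv
  exact ⟨h1 hv, h3 v hv⟩

theorem Fct.crd_eq {F : Finset E} (h : Fct V d F) (hS : Sys V d) {u w : E} (hu : u ∈ F) (hw : w ∈ F) :
    crd F w u = if u = w then 1 else 0 :=
  (crd_spec (h.li hS) (h.card.trans hS.fr.symm)).1 u hu w hw

theorem Fct.crd_self {F : Finset E} (h : Fct V d F) (hS : Sys V d) {w : E} (hw : w ∈ F) :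
    crd F w w = 1 := by simp [h.crd_eq hS hw hw]

theorem Fct.crd_ne {F : Finset E} (h : Fct V d F) (hS : Sys V d) {u w : E} (hu : u ∈ F) (hw : w ∈ F)
    (hne : u ≠ w) : crd F w u = 0 := by simp [h.crd_eq hS hu hw, hne]

theorem Fct.expand {F : Finset E} (h : Fct V d F) (hS : Sys V d) (x : E) :
    x = ∑ w ∈ F, crd F w x • w :=
  (crd_spec (h.li hS) (h.card.trans hS.fr.symm)).2 x

theorem Fct.map_expand {F : Finset E} (h : Fct V d F) (hS : Sys V d) {M : Type*} [AddCommGroup M]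
    [Module ℝ M] (f : E →ₗ[ℝ] M) (x : E) : f x = ∑ w ∈ F, crd F w x • f w := by
  conv_lhs => rw [h.expand hS x]
  simp

theorem Fct.ext {F : Finset E} (h : Fct V d F) (hS : Sys V d) {M : Type*} [AddCommGroup M]
    [Module ℝ M] {f g : E →ₗ[ℝ] M} (hfg : ∀ w ∈ F, f w = g w) : f = g := by
  ext x
  rw [h.map_expand hS f, h.map_expand hS g]
  exact Finset.sum_congr rfl fun w hw => by rw [hfg w hw]

theorem Fct.nrm_mem {F : Finset E} (h : Fct V d F) (hS : Sys V d) {v : E} (hv : v ∈ F) :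
    nrm F v = 1 := by
  unfold nrm
  rw [LinearMap.sum_apply, Finset.sum_eq_single v]
  · exact h.crd_self hS hv
  · intro w hw hne
    exact h.crd_ne hS hv hw hne.symm
  · simp [hv]

theorem Fct.nrm_unique {F : Finset E} (h : Fct V d F) (hS : Sys V d) {n : Module.Dual ℝ E}
    (hn : ∀ v ∈ F, n v = 1) : n = nrm F :=
  h.ext hS fun w hw => by rw [hn w hw, h.nrm_mem hS hw]

theorem Fct.nrm_lt {F : Finset E} (h : Fct V d F) (hS : Sys V d) {v : E} (hv : v ∈ V) (hF : v ∉ F) :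
    nrm F v < 1 := by
  obtain ⟨n, h3, h4⟩ := h.2.2
  rw [← h.nrm_unique hS h3]
  exact h4 v hv hF

theorem Fct.nrm_le {F : Finset E} (h : Fct V d F) (hS : Sys V d) {v : E} (hv : v ∈ V) :
    nrm F v ≤ 1 := by
  by_cases hF : v ∈ F
  · exact (h.nrm_mem hS hF).le
  · exact (h.nrm_lt hS hv hF).le

theorem Fct.mem_of_nrm {F : Finset E} (h : Fct V d F) (hS : Sys V d) {v : E} (hv : v ∈ V)
    (h1 : nrm F v = 1) : v ∈ F := by
  by_contra hF
  exact (h.nrm_lt hS hv hF).ne h1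

theorem Fct.eq_of_sub {F G : Finset E} (h : Fct V d F) (h' : Fct V d G) (hs : F ⊆ G) : F = G :=
  Finset.eq_of_subset_of_card_le hs (by rw [h.card, h'.card])

theorem Fc.mono {s t : Finset E} (h : Fc V d t) (hs : s ⊆ t) : Fc V d s := by
  obtain ⟨F, hF, ht⟩ := h
  exact ⟨F, hF, hs.trans ht⟩

theorem Fct.fc {F : Finset E} (h : Fct V d F) : Fc V d F := ⟨F, h, Subset.rfl⟩

theorem Fc.fct {s : Finset E} (h : Fc V d s) (hc : s.card = d) : Fct V d s := by
  obtain ⟨F, hF, hs⟩ := h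
  have : s = F := Finset.eq_of_subset_of_card_le hs (by rw [hF.card, hc])
  rwa [this]

theorem Fc.sub {s : Finset E} (h : Fc V d s) : s ⊆ V := by
  obtain ⟨F, hF, hs⟩ := h
  exact hs.trans hF.sub

theorem Fc.card_le {s : Finset E} (h : Fc V d s) : s.card ≤ d := by
  obtain ⟨F, hF, hs⟩ := h
  rw [← hF.card]; exact Finset.card_le_card hs

theorem Fc.not_anti {s : Finset E} (h : Fc V d s) (hS : Sys V d) {v : E} (h1 : v ∈ s) (h2 : -v ∈ s) :
    False := by
  obtain ⟨F, hF, hs⟩ := h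
  have a := hF.nrm_mem hS (hs h1)
  have b := hF.nrm_mem hS (hs h2)
  rw [map_neg, a] at b
  norm_num at b

theorem Fct.neg {F : Finset E} (h : Fct V d F) (hS : Sys V d) : Fct V d (F.image (fun v => -v)) := by
  refine ⟨?_, ?_, -nrm F, ?_, ?_⟩
  · intro v hv
    obtain ⟨u, hu, rfl⟩ := Finset.mem_image.1 hv
    exact hS.neg _ (h.sub hu)
  · rw [Finset.card_image_of_injective _ neg_injective, h.card]
  · intro v hv
    obtain ⟨u, hu, rfl⟩ := Finset.mem_image.1 hv
    simp [h.nrm_mem hS hu]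
  · intro v hv hF
    have : -v ∉ F := fun h' => hF (Finset.mem_image.2 ⟨-v, h', by simp⟩)
    have := h.nrm_lt hS (hS.neg _ hv) this
    simpa using this

theorem Fc.neg {s : Finset E} (h : Fc V d s) (hS : Sys V d) : Fc V d (s.image (fun v => -v)) := by
  obtain ⟨F, hF, hs⟩ := h
  exact ⟨_, hF.neg hS, Finset.image_subset_image hs⟩

theorem card_le_of_sup (hS : Sys V d) {n : Module.Dual ℝ E} (hn : ∀ v ∈ V, n v ≤ 1) :
    (V.filter (fun v => n v = 1)).card ≤ d := by
  have h := hS.simp n hn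
  have h' : LinearIndependent ℝ (fun x : (V.filter (fun v => n v = 1)) => (x : E)) := by
    have h2 : LinearIndepOn ℝ id ((V.filter (fun v => n v = 1) : Finset E) : Set E) := by
      refine h.mono ?_
      intro v hv
      simpa using hv
    exact h2
  have := h'.fintype_card_le_finrank
  rw [hS.fr] at this
  simpa using this

theorem fct_of_sup (hS : Sys V d) {n : Module.Dual ℝ E} (hn : ∀ v ∈ V, n v ≤ 1) {F : Finset E}
    (hFV : F ⊆ V) (hF : ∀ v ∈ F, n v = 1) (hc : F.card = d) : Fct V d F := by
  have h1 : F ⊆ V.filter (fun v => n v = 1) := fun v hv => Finset.mem_filter.2 ⟨hFV hv, hF v hv⟩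
  have h2 : F = V.filter (fun v => n v = 1) :=
    Finset.eq_of_subset_of_card_le h1 (by rw [hc]; exact card_le_of_sup hS hn)
  refine ⟨hFV, hc, n, hF, fun v hv hvF => lt_of_le_of_ne (hn v hv) fun h => hvF ?_⟩
  rw [h2]; exact Finset.mem_filter.2 ⟨hv, h⟩

/-- moving the functional in direction `D` until a new vertex is hit -/
theorem move {n D : Module.Dual ℝ E} (hn : ∀ v ∈ V, n v ≤ 1) (hD : ∃ v ∈ V, 0 < D v) :
    ∃ s : ℝ, 0 ≤ s ∧ (∀ v ∈ V, (n + s • D) v ≤ 1) ∧ ∃ x ∈ V, 0 < D x ∧ (n + s • D) x = 1 := by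
  obtain ⟨v0, hv0, hDv0⟩ := hD
  obtain ⟨x, hx, hmin⟩ := Finset.exists_min_image (V.filter (fun v => 0 < D v))
    (fun v => (1 - n v) / D v) ⟨v0, Finset.mem_filter.2 ⟨hv0, hDv0⟩⟩
  obtain ⟨hxV, hDx⟩ := Finset.mem_filter.1 hx
  have hs0 : 0 ≤ (1 - n x) / D x := div_nonneg (by linarith [hn x hxV]) hDx.le
  refine ⟨(1 - n x) / D x, hs0, ?_, x, hxV, hDx, ?_⟩
  · intro v hv
    simp only [LinearMap.add_apply, LinearMap.smul_apply, smul_eq_mul]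
    rcases le_or_gt (D v) 0 with h | h
    · have := hn v hv
      nlinarith
    · have := hmin v (Finset.mem_filter.2 ⟨hv, h⟩)
      rw [le_div_iff₀ h] at this
      linarith
  · simp only [LinearMap.add_apply, LinearMap.smul_apply, smul_eq_mul]
    field_simp
    ring

theorem exists_pos (hS : Sys V d) {D : Module.Dual ℝ E} (hD : D ≠ 0) : ∃ v ∈ V, 0 < D v := by
  by_contra hcon
  push Not at hcon
  apply hD
  have hz : ∀ v ∈ V, D v = 0 := by
    intro v hv
    have h1 := hcon v hv
    have h2 := hcon (-v) (hS.neg v hv)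
    rw [map_neg] at h2
    linarith
  refine LinearMap.ext_on hS.span ?_
  intro v hv
  simpa using hz v hv

theorem extend_sup (hS : Sys V d) {n : Module.Dual ℝ E} (hn : ∀ v ∈ V, n v ≤ 1) :
    ∃ F, Fct V d F ∧ ∀ v ∈ V, n v = 1 → v ∈ F := by
  obtain ⟨k, hk⟩ : ∃ k, k = d - (V.filter (fun v => n v = 1)).card := ⟨_, rfl⟩
  induction k using Nat.strong_induction_on generalizing n with
  | _ k ih =>
  have hle := card_le_of_sup hS hn
  rcases hle.eq_or_lt with h | h
  · exact ⟨_, fct_of_sup hS hn (Finset.filter_subset _ _)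
      (fun v hv => (Finset.mem_filter.1 hv).2) h, fun v hv h1 => Finset.mem_filter.2 ⟨hv, h1⟩⟩
  · set T := V.filter (fun v => n v = 1) with hT
    have hlt : Submodule.span ℝ (T : Set E) < ⊤ := by
      rw [lt_top_iff_ne_top]
      intro htop
      have h1 := finrank_span_finset_le_card (R := ℝ) T
      rw [Set.finrank, htop, finrank_top, hS.fr] at h1
      omega
    obtain ⟨D, hD0, hD⟩ := Submodule.exists_le_ker_of_lt_top _ hlt
    obtain ⟨s, hs, hle', x, hxV, hDx, hx1⟩ := move hn (exists_pos hS hD0)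
    have hDT : ∀ v ∈ T, D v = 0 := fun v hv =>
      LinearMap.mem_ker.1 (hD (Submodule.subset_span hv))
    have hsub : T ⊂ V.filter (fun v => (n + s • D) v = 1) := by
      rw [Finset.ssubset_iff_of_subset]
      · refine ⟨x, Finset.mem_filter.2 ⟨hxV, hx1⟩, fun hxT => ?_⟩
        rw [hDT x hxT] at hDx
        exact lt_irrefl _ hDx
      · intro v hv
        refine Finset.mem_filter.2 ⟨(Finset.mem_filter.1 hv).1, ?_⟩
        simp [hDT v hv, (Finset.mem_filter.1 hv).2]
    have hcl := Finset.card_lt_card hsub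
    obtain ⟨F, hF, hF2⟩ := ih _ (by omega) hle' rfl
    refine ⟨F, hF, fun v hv h1 => hF2 v hv ?_⟩
    exact (Finset.mem_filter.1 (hsub.1 (Finset.mem_filter.2 ⟨hv, h1⟩))).2

theorem fc_single (hS : Sys V d) {v : E} (hv : v ∈ V) : Fc V d {v} := by
  obtain ⟨n, h1, h2⟩ := hS.vtx v hv
  obtain ⟨F, hF, hF2⟩ := extend_sup hS h2
  exact ⟨F, hF, by simpa using hF2 v hv h1⟩

theorem fc_empty (hS : Sys V d) : Fc V d ∅ := by
  obtain ⟨F, hF, -⟩ := extend_sup hS (n := 0) (by simp)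
  exact ⟨F, hF, by simp⟩

theorem pivot (hS : Sys V d) {F : Finset E} (hF : Fct V d F) {w : E} (hw : w ∈ F) :
    ∃ x, x ∉ F ∧ Fct V d (insert x (F.erase w)) ∧ ∃ s : ℝ, 0 < s ∧
      nrm (insert x (F.erase w)) = nrm F - s • crd F w := by
  have hn : ∀ v ∈ V, nrm F v ≤ 1 := fun v hv => hF.nrm_le hS hv
  obtain ⟨s, hs, hle, x, hxV, hDx, hx1⟩ := move (D := -crd F w) hn
    ⟨-w, hS.neg _ (hF.sub hw), by simp [hF.crd_self hS hw]⟩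
  have hxF : x ∉ F := by
    intro hx
    simp only [LinearMap.neg_apply] at hDx
    rw [hF.crd_eq hS hx hw] at hDx
    split_ifs at hDx <;> norm_num at hDx
  have hs' : 0 < s := by
    rcases hs.eq_or_lt with h | h
    · exfalso
      rw [← h] at hx1
      simp at hx1
      exact (hF.nrm_lt hS hxV hxF).ne hx1
    · exact h
  have hF' : ∀ v ∈ insert x (F.erase w), (nrm F + s • (-crd F w)) v = 1 := by
    intro v hv
    rcases Finset.mem_insert.1 hv with rfl | hv
    · exact hx1
    · obtain ⟨h1, h2⟩ := Finset.mem_erase.1 hv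
      simp [hF.nrm_mem hS h2, hF.crd_ne hS h2 hw h1]
  have hfct : Fct V d (insert x (F.erase w)) := by
    refine fct_of_sup hS hle ?_ hF' ?_
    · intro v hv
      rcases Finset.mem_insert.1 hv with rfl | hv
      · exact hxV
      · exact hF.sub (Finset.mem_of_mem_erase hv)
    · rw [Finset.card_insert_of_notMem (fun h => hxF (Finset.mem_of_mem_erase h)),
        Finset.card_erase_of_mem hw, hF.card]
      have : 0 < F.card := Finset.card_pos.2 ⟨w, hw⟩
      rw [hF.card] at this
      omega
  refine ⟨x, hxF, hfct, s, hs', ?_⟩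
  rw [← hfct.nrm_unique hS hF']
  simp [sub_eq_add_neg]

/-- normals of adjacent facets -/
theorem adj_nrm (hS : Sys V d) {F : Finset E} (hF : Fct V d F) {w x : E} (hw : w ∈ F) (hx : x ∉ F)
    (hF' : Fct V d (insert x (F.erase w))) : ∃ s : ℝ, 0 < s ∧
      nrm (insert x (F.erase w)) = nrm F - s • crd F w := by
  have hwx : w ≠ x := fun h => hx (h ▸ hw)
  have hw' : w ∉ insert x (F.erase w) := by simp [hwx]
  have h1 := hF'.nrm_lt hS (hF.sub hw) hw'
  refine ⟨1 - nrm (insert x (F.erase w)) w, by linarith, ?_⟩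
  refine hF.ext hS fun v hv => ?_
  by_cases hvw : v = w
  · subst hvw
    simp [hF.nrm_mem hS hv, hF.crd_self hS hv]
  · have : v ∈ insert x (F.erase w) := by simp [hvw, hv]
    simp [hF.nrm_mem hS hv, hF.crd_ne hS hv hw hvw, hF'.nrm_mem hS this]

theorem adj_crd_neg (hS : Sys V d) {F : Finset E} (hF : Fct V d F) {w x : E} (hw : w ∈ F)
    (hx : x ∉ F) (hF' : Fct V d (insert x (F.erase w))) : crd F w x < 0 := by
  obtain ⟨s, hs, he⟩ := adj_nrm hS hF hw hx hF'
  have hxV : x ∈ V := hF'.sub (by simp)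
  have h1 := hF'.nrm_mem hS (Finset.mem_insert_self x _)
  rw [he] at h1
  simp only [LinearMap.sub_apply, LinearMap.smul_apply, smul_eq_mul] at h1
  have h2 := hF.nrm_lt hS hxV hx
  by_contra hcon
  push Not at hcon
  nlinarith

theorem adj_unique (hS : Sys V d) {F : Finset E} (hF : Fct V d F) {w x y : E} (hw : w ∈ F)
    (hx : x ∉ F) (hy : y ∉ F) (hF' : Fct V d (insert x (F.erase w)))
    (hF'' : Fct V d (insert y (F.erase w))) : x = y := by
  obtain ⟨s, hs, he⟩ := adj_nrm hS hF hw hx hF'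
  obtain ⟨t, ht, he'⟩ := adj_nrm hS hF hw hy hF''
  have hxV : x ∈ V := hF'.sub (by simp)
  have hyV : y ∈ V := hF''.sub (by simp)
  have a1 := hF'.nrm_mem hS (Finset.mem_insert_self x _)
  have a2 := hF''.nrm_mem hS (Finset.mem_insert_self y _)
  have a3 := hF'.nrm_le hS hyV
  have a4 := hF''.nrm_le hS hxV
  have c1 := adj_crd_neg hS hF hw hx hF'
  have c2 := adj_crd_neg hS hF hw hy hF''
  have e1 := he
  rw [he] at a1 a3
  rw [he'] at a2 a4
  simp only [LinearMap.sub_apply, LinearMap.smul_apply, smul_eq_mul] at a1 a2 a3 a4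
  have hst : s = t := by
    apply le_antisymm
    · by_contra hcon
      push Not at hcon
      nlinarith
    · by_contra hcon
      push Not at hcon
      nlinarith
  have hy1 : nrm (insert x (F.erase w)) y = 1 := by
    rw [he]
    simp only [LinearMap.sub_apply, LinearMap.smul_apply, smul_eq_mul]
    rw [hst]; exact a2
  have hm := hF'.mem_of_nrm hS hyV hy1
  rcases Finset.mem_insert.1 hm with h | h
  · exact h.symm
  · exact absurd (Finset.mem_of_mem_erase h) hy

theorem conn (hS : Sys V d) (θ : Finset E) (p : Finset E → Prop)
    (hstep : ∀ F w x, Fct V d F → θ ⊆ F → w ∈ F → w ∉ θ → x ∉ F →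
      Fct V d (insert x (F.erase w)) → p F → p (insert x (F.erase w)))
    {F G : Finset E} (hF : Fct V d F) (hθF : θ ⊆ F) (hpF : p F) (hG : Fct V d G) (hθG : θ ⊆ G) :
    p G := by
  set q : E := ∑ g ∈ G \ θ, g with hq
  obtain ⟨H, hH, hmax⟩ := Finset.exists_max_image
    (V.powerset.filter (fun F => Fct V d F ∧ θ ⊆ F ∧ p F)) (fun F => nrm F q)
    ⟨F, by simp [hF, hθF, hpF, hF.sub]⟩
  simp only [Finset.mem_filter, Finset.mem_powerset] at hH hmax
  obtain ⟨hHV, hHf, hθH, hpH⟩ := hH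
  by_cases hHG : H = G
  · rwa [← hHG]
  exfalso
  have hex : ∃ w ∈ H, w ∉ θ ∧ crd H w q < 0 := by
    by_contra hcon
    push Not at hcon
    have h1 : nrm H q < ((G \ θ).card : ℝ) := by
      obtain ⟨g, hgG, hgH⟩ : ∃ g ∈ G, g ∉ H := by
        by_contra hc
        push Not at hc
        exact hHG (hG.eq_of_sub hHf hc).symm
      rw [hq, map_sum, Finset.card_eq_sum_ones]
      push_cast
      refine Finset.sum_lt_sum (fun i hi => hHf.nrm_le hS (hG.sub (Finset.mem_sdiff.1 hi).1)) ?_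
      exact ⟨g, Finset.mem_sdiff.2 ⟨hgG, fun h => hgH (hθH h)⟩, hHf.nrm_lt hS (hG.sub hgG) hgH⟩
    have h2 : nrm G q = ((G \ θ).card : ℝ) := by
      rw [hq, map_sum, Finset.card_eq_sum_ones]
      push_cast
      exact Finset.sum_congr rfl fun i hi => hG.nrm_mem hS (Finset.mem_sdiff.1 hi).1
    have h3 : nrm G q ≤ nrm H q := by
      rw [hHf.map_expand hS (nrm G) q, hHf.map_expand hS (nrm H) q]
      refine Finset.sum_le_sum fun w hw => ?_
      simp only [smul_eq_mul]
      rw [hHf.nrm_mem hS hw]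
      by_cases hwθ : w ∈ θ
      · rw [hG.nrm_mem hS (hθG hwθ)]
      · exact mul_le_mul_of_nonneg_left (hG.nrm_le hS (hHf.sub hw)) (hcon w hw hwθ)
    linarith
  obtain ⟨w, hwH, hwθ, hneg⟩ := hex
  obtain ⟨x, hx, hF', s, hs, he⟩ := pivot hS hHf hwH
  have := hmax (insert x (H.erase w)) ⟨hF'.sub, hF', ?_, hstep H w x hHf hθH hwH hwθ hx hF' hpH⟩
  · rw [he] at this
    simp only [LinearMap.sub_apply, LinearMap.smul_apply, smul_eq_mul] at this
    nlinarith
  · intro v hv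
    have : v ≠ w := fun h => hwθ (h ▸ hv)
    simp [this, hθH hv]

theorem expose (hS : Sys V d) {τ : Finset E} (hτ : Fc V d τ) :
    ∃ f : Module.Dual ℝ E, (∀ v ∈ τ, f v = 1) ∧ ∀ v ∈ V, v ∉ τ → f v < 1 := by
  set A := V.powerset.filter (fun F => Fct V d F ∧ τ ⊆ F) with hA
  have hmem : ∀ F, F ∈ A ↔ Fct V d F ∧ τ ⊆ F := by
    intro F
    simp only [hA, Finset.mem_filter, Finset.mem_powerset]
    exact ⟨fun h => h.2, fun h => ⟨h.1.sub, h⟩⟩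
  obtain ⟨F0, hF0, hτ0⟩ := hτ
  have hF0A : F0 ∈ A := (hmem _).2 ⟨hF0, hτ0⟩
  have hpos : (0:ℝ) < A.card := by exact_mod_cast Finset.card_pos.2 ⟨F0, hF0A⟩
  refine ⟨(A.card : ℝ)⁻¹ • ∑ F ∈ A, nrm F, ?_, ?_⟩
  · intro v hv
    simp only [LinearMap.smul_apply, LinearMap.sum_apply, smul_eq_mul]
    rw [Finset.sum_congr rfl (g := fun _ => (1:ℝ)) fun F hF => ((hmem F).1 hF).1.nrm_mem hS
      (((hmem F).1 hF).2 hv)]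
    simp [hpos.ne']
  · intro v hv hvτ
    simp only [LinearMap.smul_apply, LinearMap.sum_apply, smul_eq_mul]
    have : ∑ F ∈ A, nrm F v < ∑ F ∈ A, (1:ℝ) := by
      refine Finset.sum_lt_sum (fun F hF => ((hmem F).1 hF).1.nrm_le hS hv) ?_
      by_cases hvF : v ∈ F0
      · obtain ⟨x, hx, hF', -⟩ := pivot hS hF0 hvF
        refine ⟨_, (hmem _).2 ⟨hF', ?_⟩, hF'.nrm_lt hS hv ?_⟩
        · intro u hu
          have : u ≠ v := fun h => hvτ (h ▸ hu)
          simp [this, hτ0 hu]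
        · have : v ≠ x := fun h => hx (h ▸ hvF)
          simp [this]
      · exact ⟨F0, hF0A, hF0.nrm_lt hS hv hvF⟩
    rw [inv_mul_lt_iff₀ hpos]
    simpa using this

theorem lemmaSigma (hS : Sys V d) {Sg θ : Finset E} (hc : Sg.card = d + 1) (hθ : θ ⊆ Sg)
    (hne : ∃ x ∈ Sg, x ∉ θ) (hf : ∀ x ∈ Sg, x ∉ θ → Fct V d (Sg.erase x)) {G : Finset E}
    (hG : Fct V d G) (hθG : θ ⊆ G) : G ⊆ Sg := by
  obtain ⟨x0, hx0, hx0θ⟩ := hne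
  have hsubθ : ∀ x, x ∉ θ → θ ⊆ Sg.erase x := fun x hx u hu =>
    Finset.mem_erase.2 ⟨fun h => hx (h ▸ hu), hθ hu⟩
  refine conn hS θ (fun F => F ⊆ Sg) ?_ (hf x0 hx0 hx0θ) (hsubθ _ hx0θ) (Finset.erase_subset _ _) hG hθG
  intro F w x hF hθF hw hwθ hx hF' hFS
  obtain ⟨z, hz, hzF⟩ : ∃ z ∈ Sg, z ∉ F := by
    by_contra hcon
    push Not at hcon
    have := Finset.card_le_card (show Sg ⊆ F from hcon)
    rw [hF.card, hc] at this
    omega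
  have hFz : F = Sg.erase z := by
    refine Finset.eq_of_subset_of_card_le (fun u hu => Finset.mem_erase.2 ⟨fun h => hzF (h ▸ hu), hFS hu⟩) ?_
    rw [Finset.card_erase_of_mem hz, hc, hF.card]
    simp
  have hwz : w ≠ z := fun h => hzF (h ▸ hw)
  have heq : Sg.erase w = insert z (F.erase w) := by
    rw [hFz, Finset.erase_right_comm, Finset.insert_erase]
    exact Finset.mem_erase.2 ⟨hwz.symm, hz⟩
  have h2 : Fct V d (insert z (F.erase w)) := heq ▸ hf w (hFS hw) hwθ
  have hxz := adj_unique hS hF hw hx hzF hF' h2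
  rw [hxz, ← heq]
  exact Finset.erase_subset _ _

end CSP

namespace CSP

variable {E : Type} [AddCommGroup E] [Module ℝ E] [FiniteDimensional ℝ E]
variable {V : Finset E} {d : ℕ}

/-- an area form for the codimension two face `κ` -/
structure Area (κ : Finset E) (ω : E →ₗ[ℝ] E →ₗ[ℝ] ℝ) : Prop where
  alt : ∀ x, ω x x = 0
  ker : ∀ t ∈ κ, ω t = 0
  nz : ω ≠ 0

theorem alt_swap {ω : E →ₗ[ℝ] E →ₗ[ℝ] ℝ} (h : ∀ x, ω x x = 0) (x y : E) : ω x y = - ω y x := by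
  have := h (x + y)
  simp only [map_add, LinearMap.add_apply, h] at this
  linarith

theorem Area.swap {κ : Finset E} {ω : E →ₗ[ℝ] E →ₗ[ℝ] ℝ} (h : Area κ ω) (x y : E) :
    ω x y = - ω y x := alt_swap h.alt x y

theorem Area.ker' {κ : Finset E} {ω : E →ₗ[ℝ] E →ₗ[ℝ] ℝ} (h : Area κ ω) {t : E} (ht : t ∈ κ) (x : E) :
    ω x t = 0 := by
  rw [h.swap, h.ker t ht]; simp

theorem Area.neg {κ : Finset E} {ω : E →ₗ[ℝ] E →ₗ[ℝ] ℝ} (h : Area κ ω) : Area κ (-ω) :=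
  ⟨fun x => by simp [h.alt], fun t ht => by simp [h.ker t ht], fun h0 => h.nz (by
    ext x y
    have := congrArg (fun f : E →ₗ[ℝ] E →ₗ[ℝ] ℝ => f x y) h0
    simp only [LinearMap.neg_apply, LinearMap.zero_apply] at this ⊢
    linarith)⟩

/-- alternating forms with kernel containing `κ` are determined by one value -/
theorem alt2_ext (hS : Sys V d) {κ : Finset E} {a b : E} (hF : Fct V d (insert b (insert a κ)))
    {ω ω' : E →ₗ[ℝ] E →ₗ[ℝ] ℝ} (h : ∀ x, ω x x = 0) (h' : ∀ x, ω' x x = 0)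
    (hk : ∀ t ∈ κ, ω t = 0) (hk' : ∀ t ∈ κ, ω' t = 0) (hab : ω a b = ω' a b) : ω = ω' := by
  refine hF.ext hS fun x hx => hF.ext hS fun y hy => ?_
  have s := alt_swap h
  have s' := alt_swap h'
  simp only [Finset.mem_insert] at hx hy
  have hk2 : ∀ t ∈ κ, ∀ x, ω x t = ω' x t := fun t ht x => by rw [s, s', hk t ht, hk' t ht]
  have hk1 : ∀ t ∈ κ, ω t = ω' t := fun t ht => by rw [hk t ht, hk' t ht]
  rcases hx with rfl | rfl | hx
  · rcases hy with rfl | rfl | hy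
    · rw [h, h']
    · rw [s, s', hab]
    · exact hk2 _ hy _
  · rcases hy with rfl | rfl | hy
    · exact hab
    · rw [h, h']
    · exact hk2 _ hy _
  · rw [hk1 _ hx]

theorem Area.ne (hS : Sys V d) {κ : Finset E} {ω : E →ₗ[ℝ] E →ₗ[ℝ] ℝ} (h : Area κ ω) {a b : E}
    (hF : Fct V d (insert b (insert a κ))) : ω a b ≠ 0 := by
  intro h0
  apply h.nz
  exact alt2_ext hS hF h.alt (by simp) h.ker (by simp) (by simp [h0])

/-- neighbours in the link of `κ` -/
def Nb (V : Finset E) (d : ℕ) (κ : Finset E) : Finset E :=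
  V.filter (fun u => u ∉ κ ∧ Fc V d (insert u κ))

theorem mem_Nb {κ : Finset E} {u : E} : u ∈ Nb V d κ ↔ u ∉ κ ∧ Fc V d (insert u κ) := by
  unfold Nb
  rw [Finset.mem_filter]
  exact ⟨fun h => h.2, fun h => ⟨h.2.sub (Finset.mem_insert_self _ _), h⟩⟩

/-- the next vertex in the circular link -/
def nxt (V : Finset E) (d : ℕ) (κ : Finset E) (ω : E →ₗ[ℝ] E →ₗ[ℝ] ℝ) (u : E) : E :=
  if h : ∃ a, Fct V d (insert a (insert u κ)) ∧ 0 < ω u a then h.choose else u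

theorem card_two {κ : Finset E} (hc : κ.card + 2 = d) {a u : E} (hF : (insert a (insert u κ)).card = d) :
    u ∉ κ ∧ a ∉ κ ∧ a ≠ u := by
  refine ⟨fun h => ?_, fun h => ?_, fun h => ?_⟩
  · rw [Finset.insert_eq_of_mem h] at hF
    have := Finset.card_insert_le a κ
    omega
  · rw [Finset.insert_eq_of_mem (Finset.mem_insert_of_mem h)] at hF
    have := Finset.card_insert_le u κ
    omega
  · rw [h, Finset.insert_idem] at hF
    have := Finset.card_insert_le u κ
    omega

theorem nxt_exists (hS : Sys V d) {κ : Finset E} (hc : κ.card + 2 = d)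
    {ω : E →ₗ[ℝ] E →ₗ[ℝ] ℝ} (h : Area κ ω) {u : E} (hu : u ∈ Nb V d κ) :
    ∃ a, Fct V d (insert a (insert u κ)) ∧ 0 < ω u a := by
  obtain ⟨huk, F, hF, hs⟩ := mem_Nb.1 hu
  obtain ⟨a, haF, ha⟩ : ∃ a ∈ F, a ∉ insert u κ := by
    by_contra hcon
    push Not at hcon
    have := Finset.card_le_card (show F ⊆ insert u κ from hcon)
    rw [hF.card, Finset.card_insert_of_notMem huk] at this
    omega
  have hFe : insert a (insert u κ) = F := by
    refine Finset.eq_of_subset_of_card_le ?_ ?_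
    · intro x hx
      rcases Finset.mem_insert.1 hx with rfl | hx
      · exact haF
      · exact hs hx
    · rw [Finset.card_insert_of_notMem ha, Finset.card_insert_of_notMem huk, hF.card]; omega
  have hF2 : Fct V d (insert a (insert u κ)) := hFe ▸ hF
  rcases lt_or_gt_of_ne (h.ne hS hF2) with hlt | hgt
  · obtain ⟨x, hx, hF', -⟩ := pivot hS hF haF
    have hneg := adj_crd_neg hS hF haF hx hF'
    have he : F.erase a = insert u κ := by rw [← hFe, Finset.erase_insert ha]
    have hxx : ω u = ω u a • crd F a := by
      refine hF.ext hS fun y hy => ?_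
      by_cases hya : y = a
      · subst hya
        simp [hF.crd_self hS haF]
      · have : y ∈ F.erase a := Finset.mem_erase.2 ⟨hya, hy⟩
        rw [he] at this
        simp only [LinearMap.smul_apply, hF.crd_ne hS hy haF hya, smul_zero]
        rcases Finset.mem_insert.1 this with rfl | h'
        · exact h.alt _
        · exact h.ker' h' _
    rw [he] at hF'
    refine ⟨x, hF', ?_⟩
    rw [hxx]
    simp only [LinearMap.smul_apply, smul_eq_mul]
    exact mul_pos_of_neg_of_neg hlt hneg
  · exact ⟨a, hF2, hgt⟩

theorem nxt_uniq (hS : Sys V d) {κ : Finset E} (hc : κ.card + 2 = d)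
    {ω : E →ₗ[ℝ] E →ₗ[ℝ] ℝ} (h : Area κ ω) {u a b : E} 
    (ha : Fct V d (insert a (insert u κ))) (ha0 : 0 < ω u a)
    (hb : Fct V d (insert b (insert u κ))) (hb0 : 0 < ω u b) : a = b := by
  by_contra hab
  obtain ⟨h1, h2, h3⟩ := card_two hc ha.card
  obtain ⟨-, h4, h5⟩ := card_two hc hb.card
  have ha' : a ∉ insert u κ := by simp [h2, h3]
  have hbF : b ∉ insert a (insert u κ) := by simp [h4, h5, Ne.symm hab]
  have he : (insert a (insert u κ)).erase a = insert u κ := Finset.erase_insert ha'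
  have hneg := adj_crd_neg hS ha (Finset.mem_insert_self _ _) hbF (by rw [he]; exact hb)
  have hxx : ω u = ω u a • crd (insert a (insert u κ)) a := by
    refine ha.ext hS fun y hy => ?_
    by_cases hya : y = a
    · subst hya
      simp [ha.crd_self hS hy]
    · simp only [LinearMap.smul_apply, ha.crd_ne hS hy (Finset.mem_insert_self _ _) hya, smul_zero]
      rcases Finset.mem_insert.1 (Finset.mem_of_mem_insert_of_ne hy hya) with rfl | h'
      · exact h.alt _
      · exact h.ker' h' _
  rw [hxx] at hb0
  simp only [LinearMap.smul_apply, smul_eq_mul] at hb0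
  nlinarith

section fan
variable {κ : Finset E} {ω : E →ₗ[ℝ] E →ₗ[ℝ] ℝ}

theorem nxt_fct (hS : Sys V d) (hc : κ.card + 2 = d) (h : Area κ ω) {u : E} (hu : u ∈ Nb V d κ) :
    Fct V d (insert (nxt V d κ ω u) (insert u κ)) := by
  have := nxt_exists hS hc h hu
  unfold nxt
  rw [dif_pos this]
  exact this.choose_spec.1

theorem nxt_pos (hS : Sys V d) (hc : κ.card + 2 = d) (h : Area κ ω) {u : E} (hu : u ∈ Nb V d κ) :
    0 < ω u (nxt V d κ ω u) := by
  have := nxt_exists hS hc h hu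
  unfold nxt
  rw [dif_pos this]
  exact this.choose_spec.2

theorem nxt_eq (hS : Sys V d) (hc : κ.card + 2 = d) (h : Area κ ω) {u b : E} 
    (hb : Fct V d (insert b (insert u κ))) (hb0 : 0 < ω u b) : nxt V d κ ω u = b := by
  have hu : u ∈ Nb V d κ := mem_Nb.2 ⟨(card_two hc hb.card).1, _, hb, Finset.subset_insert _ _⟩
  exact nxt_uniq hS hc h (nxt_fct hS hc h hu) (nxt_pos hS hc h hu) hb hb0

theorem Nb_of_fct (hc : κ.card + 2 = d) {a u : E} (hF : Fct V d (insert a (insert u κ))) :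
    a ∈ Nb V d κ ∧ u ∈ Nb V d κ := by
  obtain ⟨h1, h2, h3⟩ := card_two hc hF.card
  refine ⟨mem_Nb.2 ⟨h2, _, hF, ?_⟩, mem_Nb.2 ⟨h1, _, hF, Finset.subset_insert _ _⟩⟩
  exact Finset.insert_subset_insert _ (Finset.subset_insert _ _)

theorem nxt_mem (hS : Sys V d) (hc : κ.card + 2 = d) (h : Area κ ω) {u : E} (hu : u ∈ Nb V d κ) :
    nxt V d κ ω u ∈ Nb V d κ := (Nb_of_fct hc (nxt_fct hS hc h hu)).1

/-- previous vertex -/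
def prv (V : Finset E) (d : ℕ) (κ : Finset E) (ω : E →ₗ[ℝ] E →ₗ[ℝ] ℝ) (u : E) : E :=
  nxt V d κ (-ω) u

theorem prv_mem (hS : Sys V d) (hc : κ.card + 2 = d) (h : Area κ ω) {u : E} (hu : u ∈ Nb V d κ) :
    prv V d κ ω u ∈ Nb V d κ := nxt_mem hS hc h.neg hu

theorem prv_fct (hS : Sys V d) (hc : κ.card + 2 = d) (h : Area κ ω) {u : E} (hu : u ∈ Nb V d κ) :
    Fct V d (insert (prv V d κ ω u) (insert u κ)) := nxt_fct hS hc h.neg hu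

theorem prv_neg (hS : Sys V d) (hc : κ.card + 2 = d) (h : Area κ ω) {u : E} (hu : u ∈ Nb V d κ) :
    ω u (prv V d κ ω u) < 0 := by
  have := nxt_pos hS hc h.neg hu
  simpa [prv] using this

theorem nxt_prv (hS : Sys V d) (hc : κ.card + 2 = d) (h : Area κ ω) {u : E} (hu : u ∈ Nb V d κ) :
    nxt V d κ ω (prv V d κ ω u) = u := by
  refine nxt_eq hS hc h ?_ ?_
  · rw [Finset.insert_comm]; exact prv_fct hS hc h hu
  · rw [h.swap]; linarith [prv_neg hS hc h hu]

theorem prv_nxt (hS : Sys V d) (hc : κ.card + 2 = d) (h : Area κ ω) {u : E} (hu : u ∈ Nb V d κ) :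
    prv V d κ ω (nxt V d κ ω u) = u := by
  have := nxt_prv hS hc h.neg hu
  unfold prv at this
  have e : - -ω = ω := by ext x y; simp
  rw [e] at this
  exact this

theorem sum_nxt (hS : Sys V d) (hc : κ.card + 2 = d) (h : Area κ ω) {M : Type*} [AddCommMonoid M]
    (f : E → M) : ∑ u ∈ Nb V d κ, f (nxt V d κ ω u) = ∑ u ∈ Nb V d κ, f u :=
  Finset.sum_nbij' (nxt V d κ ω) (prv V d κ ω) (fun u hu => nxt_mem hS hc h hu)
    (fun u hu => prv_mem hS hc h hu) (fun u hu => prv_nxt hS hc h hu)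
    (fun u hu => nxt_prv hS hc h hu) (fun _ _ => rfl)

theorem sum_prv (hS : Sys V d) (hc : κ.card + 2 = d) (h : Area κ ω) {M : Type*} [AddCommMonoid M]
    (f : E → M) : ∑ u ∈ Nb V d κ, f (prv V d κ ω u) = ∑ u ∈ Nb V d κ, f u :=
  sum_nxt hS hc h.neg f

/-- 2-dim expansion of functionals vanishing on `κ` -/
theorem expand2 (hS : Sys V d) (h : Area κ ω) {u a : E} (hF : Fct V d (insert a (insert u κ)))
    {f : Module.Dual ℝ E} (hf : ∀ t ∈ κ, f t = 0) (x : E) :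
    ω u a * f x = ω x a * f u - ω x u * f a := by
  have : ω u a • f = (f u) • (-(ω a)) - (f a) • (-(ω u)) := by
    refine hF.ext hS fun y hy => ?_
    simp only [LinearMap.smul_apply, LinearMap.sub_apply, LinearMap.neg_apply, smul_eq_mul]
    rcases Finset.mem_insert.1 hy with rfl | hy
    · rw [h.alt]; ring
    · rcases Finset.mem_insert.1 hy with rfl | hy
      · rw [h.alt, h.swap a y]; ring
      · rw [hf y hy, h.ker' hy, h.ker' hy]; ring
  have := congrArg (fun g : Module.Dual ℝ E => g x) this
  simp only [LinearMap.smul_apply, LinearMap.sub_apply, LinearMap.neg_apply, smul_eq_mul] at this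
  rw [this, h.swap a x, h.swap u x]; ring

end fan

theorem quad {N : Finset E} {k D D' : E → ℝ} {u1 : E}
    (hone : ∀ u ∈ N, ∀ w ∈ N, k u < 0 → k w < 0 → u ≠ u1 → w ≠ u1 → u = w)
    (hD' : ∀ u ∈ N, k u < 0 → u ≠ u1 → D' u ≠ 0) (h1 : D u1 = 0) (h1' : D' u1 = 0)
    (hort : ∑ u ∈ N, k u * D u * D' u = 0) (hneg : ∑ u ∈ N, k u * D' u ^ 2 < 0) :
    0 ≤ ∑ u ∈ N, k u * D u ^ 2 ∧ (∑ u ∈ N, k u * D u ^ 2 = 0 → ∀ u ∈ N, k u * D u = 0) := by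
  obtain ⟨l, hl⟩ : ∃ l : ℝ, ∀ u ∈ N, k u < 0 → D u + l * D' u = 0 := by
    by_cases hex : ∃ u ∈ N, k u < 0 ∧ u ≠ u1
    · obtain ⟨u, hu, hku, hu1⟩ := hex
      refine ⟨-(D u / D' u), fun w hw hkw => ?_⟩
      by_cases hw1 : w = u1
      · rw [hw1, h1, h1']; ring
      · have := hone u hu w hw hku hkw hu1 hw1
        subst this
        have := hD' u hu hku hu1
        field_simp
        ring
    · push Not at hex
      refine ⟨0, fun w hw hkw => ?_⟩
      rw [hex w hw hkw, h1]; ring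
  have hterm : ∀ u ∈ N, 0 ≤ k u * (D u + l * D' u) ^ 2 := by
    intro u hu
    rcases lt_or_ge (k u) 0 with h | h
    · rw [hl u hu h]; simp
    · positivity
  have hsum := Finset.sum_nonneg hterm
  have hexp : ∑ u ∈ N, k u * (D u + l * D' u) ^ 2 =
      ∑ u ∈ N, k u * D u ^ 2 + l ^ 2 * ∑ u ∈ N, k u * D' u ^ 2 := by
    have : ∑ u ∈ N, k u * (D u + l * D' u) ^ 2 = ∑ u ∈ N, k u * D u ^ 2 +
        2 * l * ∑ u ∈ N, k u * D u * D' u + l ^ 2 * ∑ u ∈ N, k u * D' u ^ 2 := by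
      rw [Finset.mul_sum, Finset.mul_sum, ← Finset.sum_add_distrib, ← Finset.sum_add_distrib]
      exact Finset.sum_congr rfl fun u _ => by ring
    rw [this, hort]; ring
  rw [hexp] at hsum
  refine ⟨by nlinarith [sq_nonneg l], fun h0 => ?_⟩
  rw [h0] at hsum hexp
  have hl0 : l = 0 := by
    by_contra hne
    have : 0 < l ^ 2 := by positivity
    nlinarith
  rw [hl0] at hexp hterm
  simp only [zero_mul, add_zero, ne_eq, OfNat.ofNat_ne_zero, not_false_eq_true, zero_pow] at hexp hterm
  intro u hu
  have := (Finset.sum_eq_zero_iff_of_nonneg hterm).1 hexp u hu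
  rcases mul_eq_zero.1 this with h | h
  · rw [h]; ring
  · rw [pow_eq_zero_iff (by norm_num)] at h; rw [h]; ring

section loc
variable {κ : Finset E} {ω : E →ₗ[ℝ] E →ₗ[ℝ] ℝ}

theorem cone_uniq (hS : Sys V d) (h : Area κ ω) {u a w b : E}
    (hF : Fct V d (insert a (insert u κ))) (hG : Fct V d (insert b (insert w κ))) {p q p' q' : ℝ}
    (hp : 0 < p) (hq : 0 < q) (hp' : 0 < p') (hq' : 0 < q')
    (heq : ∀ f : Module.Dual ℝ E, (∀ t ∈ κ, f t = 0) → p * f u + q * f a = p' * f w + q' * f b) :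
    insert a (insert u κ) = insert b (insert w κ) := by
  set F := insert a (insert u κ) with hFd
  set G := insert b (insert w κ) with hGd
  have huF : u ∈ F := by simp [hFd]
  have haF : a ∈ F := by simp [hFd]
  have hwG : w ∈ G := by simp [hGd]
  have hbG : b ∈ G := by simp [hGd]
  have hkF : κ ⊆ F := fun x hx => by simp [hFd, hx]
  have hkG : κ ⊆ G := fun x hx => by simp [hGd, hx]
  have e := heq (nrm F - nrm G) (fun t ht => by
    simp [hF.nrm_mem hS (hkF ht), hG.nrm_mem hS (hkG ht)])
  simp only [LinearMap.sub_apply, hF.nrm_mem hS huF, hF.nrm_mem hS haF, hG.nrm_mem hS hwG,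
    hG.nrm_mem hS hbG] at e
  have i1 := hG.nrm_le hS (hF.sub huF)
  have i2 := hG.nrm_le hS (hF.sub haF)
  have i3 := hF.nrm_le hS (hG.sub hwG)
  have i4 := hF.nrm_le hS (hG.sub hbG)
  have j1 : nrm G u = 1 := by nlinarith
  have j2 : nrm G a = 1 := by nlinarith
  refine hF.eq_of_sub hG ?_
  intro x hx
  rcases Finset.mem_insert.1 hx with rfl | hx
  · exact hG.mem_of_nrm hS (hF.sub haF) j2
  · rcases Finset.mem_insert.1 hx with rfl | hx
    · exact hG.mem_of_nrm hS (hF.sub huF) j1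
    · exact hkG hx

theorem cone_uniq' (hS : Sys V d) (hc : κ.card + 2 = d) (h : Area κ ω) {u a w b : E}
    (hF : Fct V d (insert a (insert u κ))) (hG : Fct V d (insert b (insert w κ)))
    (hua : 0 < ω u a) (hwb : 0 < ω w b)
    (heq : insert a (insert u κ) = insert b (insert w κ)) : u = w := by
  obtain ⟨h1, h2, h3⟩ := card_two hc hF.card
  obtain ⟨h4, h5, h6⟩ := card_two hc hG.card
  have hu : u ∈ insert b (insert w κ) := heq ▸ (by simp)
  have ha : a ∈ insert b (insert w κ) := heq ▸ (by simp)
  simp only [Finset.mem_insert, h1, h2, or_false] at hu ha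
  rcases hu with hu | hu
  · rcases ha with ha | ha
    · exact absurd (ha.trans hu.symm) h3
    · subst hu; subst ha
      rw [h.swap] at hwb
      linarith
  · exact hu

theorem local_lemma (hS : Sys V d) (hc : κ.card + 2 = d) (hω : Area κ ω)
    (β : E → Module.Dual ℝ E) (h C : E → ℝ) {u1 : E} (hu1 : u1 ∈ Nb V d κ)
    (hk : ∀ u ∈ Nb V d κ, ∀ t ∈ κ, β u t = h t)
    (hb1 : ∀ u ∈ Nb V d κ, β u u = h u)
    (hb2 : ∀ u ∈ Nb V d κ, β u (nxt V d κ ω u) = h (nxt V d κ ω u))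
    (hC : ∀ u ∈ Nb V d κ, β u - β (prv V d κ ω u) = C u • ω u)
    (hcc : ∑ u ∈ Nb V d κ, C u * (1 - nrm (insert (nxt V d κ ω u1) (insert u1 κ)) u) = 0) :
    ∑ u ∈ Nb V d κ, C u * (h u - β u1 u) ≤ 0 ∧
    (∑ u ∈ Nb V d κ, C u * (h u - β u1 u) = 0 → ∀ u ∈ Nb V d κ, C u = 0) := by
  set N := Nb V d κ with hN
  set π := nxt V d κ ω with hπ
  set L : E → Finset E := fun u => insert (π u) (insert u κ) with hL
  have hLf : ∀ u ∈ N, Fct V d (L u) := fun u hu => nxt_fct hS hc hω hu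
  have hs : ∀ u ∈ N, 0 < ω u (π u) := fun u hu => nxt_pos hS hc hω hu
  have hπN : ∀ u ∈ N, π u ∈ N := fun u hu => nxt_mem hS hc hω hu
  have hNV : ∀ u ∈ N, u ∈ V := fun u hu => (mem_Nb.1 hu).2.sub (by simp)
  have huL : ∀ u, u ∈ L u := fun u => by simp [hL]
  have hpL : ∀ u, π u ∈ L u := fun u => by simp [hL]
  have hkL : ∀ u, κ ⊆ L u := fun u x hx => by simp [hL, hx]
  -- choose x0
  obtain ⟨e, he, hell⟩ : ∃ e : ℝ, 0 < e ∧ ∀ u ∈ N, ω (u1 + e • π u1) u ≠ 0 := by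
    obtain ⟨e, he, hne⟩ := (Set.Ioi_infinite (0:ℝ)).exists_notMem_finset
      (N.image fun u => -(ω u1 u) / ω (π u1) u)
    refine ⟨e, he, fun u hu h0 => ?_⟩
    simp only [map_add, map_smul, LinearMap.add_apply, LinearMap.smul_apply, smul_eq_mul] at h0
    by_cases hz : ω (π u1) u = 0
    · rw [hz, mul_zero, add_zero] at h0
      have hz' : ω u = 0 := by
        refine (hLf u1 hu1).ext hS fun y hy => ?_
        rw [hω.swap]
        rcases Finset.mem_insert.1 hy with rfl | hy
        · simp [hz]
        · rcases Finset.mem_insert.1 hy with rfl | hy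
          · simp [h0]
          · simp [hω.ker y hy]
      have := hs u hu
      rw [hz'] at this
      simp at this
    · apply hne
      refine Finset.mem_image.2 ⟨u, hu, ?_⟩
      field_simp
      linarith
  set x0 := u1 + e • π u1 with hx0
  set ℓ : E → ℝ := fun u => ω x0 u with hℓ
  set n0 := nrm (L u1) with hn0
  set β0 := β u1 with hβ0
  -- general summation by parts
  have key : ∀ (G : E → Module.Dual ℝ E) (g c : E → ℝ), (∀ u ∈ N, ∀ t ∈ κ, G u t = 0) →
      (∀ u ∈ N, G u u = g u) → (∀ u ∈ N, G u (π u) = g (π u)) →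
      (∀ u ∈ N, G u - G (prv V d κ ω u) = c u • ω u) →
      (∀ u ∈ N, G u x0 = - (ℓ u * ℓ (π u) / ω u (π u)) * (g (π u) / ℓ (π u) - g u / ℓ u)) ∧
      (∀ u ∈ N, c u * ℓ u = G (prv V d κ ω u) x0 - G u x0) ∧
      ∀ g' : E → ℝ, ∑ u ∈ N, c u * g' u = - ∑ u ∈ N, (ℓ u * ℓ (π u) / ω u (π u)) *
        (g (π u) / ℓ (π u) - g u / ℓ u) * (g' (π u) / ℓ (π u) - g' u / ℓ u) := by
    intro G g c h1 h2 h3 h4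
    have hA : ∀ u ∈ N, G u x0 =
        - (ℓ u * ℓ (π u) / ω u (π u)) * (g (π u) / ℓ (π u) - g u / ℓ u) := by
      intro u hu
      have := expand2 hS hω (hLf u hu) (h1 u hu) x0
      rw [h2 u hu, h3 u hu] at this
      have p1 := hs u hu
      have p2 := hell u hu
      have p3 := hell _ (hπN u hu)
      simp only [hℓ]
      field_simp
      linarith
    have hB : ∀ u ∈ N, c u * ℓ u = G (prv V d κ ω u) x0 - G u x0 := by
      intro u hu
      have := congrArg (fun f : Module.Dual ℝ E => f x0) (h4 u hu)
      simp only [LinearMap.sub_apply, LinearMap.smul_apply, smul_eq_mul] at this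
      rw [hω.swap u x0] at this
      simp only [hℓ]
      linarith
    refine ⟨hA, hB, fun g' => ?_⟩
    have e1 : ∑ u ∈ N, c u * g' u = ∑ u ∈ N, G (prv V d κ ω u) x0 * (g' u / ℓ u)
        - ∑ u ∈ N, G u x0 * (g' u / ℓ u) := by
      rw [← Finset.sum_sub_distrib]
      refine Finset.sum_congr rfl fun u hu => ?_
      rw [← sub_mul, ← hB u hu]
      have p2 : ℓ u ≠ 0 := hell u hu
      field_simp
    have e2 : ∑ u ∈ N, G (prv V d κ ω u) x0 * (g' u / ℓ u) =
        ∑ u ∈ N, G u x0 * (g' (π u) / ℓ (π u)) := by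
      rw [← sum_nxt hS hc hω (fun u => G (prv V d κ ω u) x0 * (g' u / ℓ u))]
      refine Finset.sum_congr rfl fun u hu => ?_
      rw [prv_nxt hS hc hω hu]
    rw [e1, e2, ← Finset.sum_sub_distrib, ← Finset.sum_neg_distrib]
    refine Finset.sum_congr rfl fun u hu => ?_
    rw [hA u hu]; ring
  -- the two functions
  obtain ⟨hA1, hB1, hQ1⟩ := key (fun u => β u - β0) (fun u => h u - β0 u) C
    (fun u hu t ht => by simp [hk u hu t ht, hβ0, hk u1 hu1 t ht])
    (fun u hu => by simp [hb1 u hu]) (fun u hu => by simp [hb2 u hu])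
    (fun u hu => by rw [← hC u hu]; abel)
  have hRf : ∀ u ∈ N, L (prv V d κ ω u) = insert (prv V d κ ω u) (insert u κ) := by
    intro u hu
    simp only [hL]
    rw [hπ, nxt_prv hS hc hω hu, Finset.insert_comm]
  have hko : ∃ c : E → ℝ, ∀ u ∈ N, 0 < c u ∧ nrm (L u) - nrm (L (prv V d κ ω u)) = c u • ω u := by
    refine ⟨fun u => (1 - nrm (L (prv V d κ ω u)) (π u)) / ω u (π u), fun u hu => ?_⟩
    have hR := hLf _ (prv_mem hS hc hω hu)
    have hRe := hRf u hu
    have hn : π u ∉ L (prv V d κ ω u) := by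
      rw [hRe]
      obtain ⟨-, q1, q2⟩ := card_two hc (hLf u hu).card
      simp only [Finset.mem_insert, q1, q2, or_false]
      intro hh
      have a1 := hs u hu
      have a2 := prv_neg hS hc hω hu
      rw [← hh] at a2
      linarith
    refine ⟨div_pos ?_ (hs u hu), ?_⟩
    · linarith [hR.nrm_lt hS (hNV _ (hπN u hu)) hn]
    · refine (hLf u hu).ext hS fun y hy => ?_
      have hsu := hs u hu
      simp only [LinearMap.sub_apply, LinearMap.smul_apply, smul_eq_mul]
      rw [(hLf u hu).nrm_mem hS hy]
      rcases Finset.mem_insert.1 hy with rfl | hy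
      · field_simp
      · rw [hR.nrm_mem hS (by rw [hRe]; exact Finset.mem_insert_of_mem hy)]
        rcases Finset.mem_insert.1 hy with rfl | hy
        · rw [hω.alt]; ring
        · rw [hω.ker' hy]; ring
  obtain ⟨co, hco⟩ := hko
  obtain ⟨hA2, hB2, hQ2⟩ := key (fun u => nrm (L u) - n0) (fun u => 1 - n0 u) co
    (fun u hu t ht => by
      simp [(hLf u hu).nrm_mem hS (hkL u ht), hn0, (hLf u1 hu1).nrm_mem hS (hkL u1 ht)])
    (fun u hu => by simp [(hLf u hu).nrm_mem hS (huL u)])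
    (fun u hu => by simp [(hLf u hu).nrm_mem hS (hpL u)])
    (fun u hu => by rw [← (hco u hu).2]; abel)
  set k : E → ℝ := fun u => ℓ u * ℓ (π u) / ω u (π u) with hkdef
  set D : E → ℝ := fun u => (h (π u) - β0 (π u)) / ℓ (π u) - (h u - β0 u) / ℓ u with hD
  set D' : E → ℝ := fun u => (1 - n0 (π u)) / ℓ (π u) - (1 - n0 u) / ℓ u with hD'
  -- crossings
  have hcross1 : ∀ u ∈ N, ℓ u < 0 → 0 < ℓ (π u) → u = u1 := by
    intro u hu l1 l2
    refine cone_uniq' hS hc hω (hLf u hu) (hLf u1 hu1) (hs u hu) (hs u1 hu1) ?_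
    refine cone_uniq hS hω (hLf u hu) (hLf u1 hu1) (p := ℓ (π u)) (q := -ℓ u)
      (p' := ω u (π u)) (q' := ω u (π u) * e) l2 (by linarith) (hs u hu)
      (mul_pos (hs u hu) he) ?_
    intro f hf
    have := expand2 hS hω (hLf u hu) hf x0
    rw [hx0] at this
    simp only [map_add, map_smul, smul_eq_mul] at this
    rw [← map_smul, ← map_add, ← hx0] at this
    simp only [hℓ]
    linarith
  have hcross2 : ∀ u ∈ N, ∀ w ∈ N, 0 < ℓ u → ℓ (π u) < 0 → 0 < ℓ w → ℓ (π w) < 0 → u = w := by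
    intro u hu w hw l1 l2 l3 l4
    refine cone_uniq' hS hc hω (hLf u hu) (hLf w hw) (hs u hu) (hs w hw) ?_
    have s1 := hs u hu
    have s2 := hs w hw
    refine cone_uniq hS hω (hLf u hu) (hLf w hw) (p := -ℓ (π u) / ω u (π u)) (q := ℓ u / ω u (π u))
      (p' := -ℓ (π w) / ω w (π w)) (q' := ℓ w / ω w (π w)) (div_pos (by linarith) s1)
      (div_pos l1 s1) (div_pos (by linarith) s2) (div_pos l3 s2) ?_
    intro f hf
    have e1 := expand2 hS hω (hLf u hu) hf x0
    have e2 := expand2 hS hω (hLf w hw) hf x0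
    have f1 : f x0 = (ℓ (π u) * f u - ℓ u * f (π u)) / ω u (π u) := by
      rw [eq_div_iff s1.ne']; simp only [hℓ]; linarith
    have f2 : f x0 = (ℓ (π w) * f w - ℓ w * f (π w)) / ω w (π w) := by
      rw [eq_div_iff s2.ne']; simp only [hℓ]; linarith
    have f3 := f1.symm.trans f2
    rw [sub_div, sub_div] at f3
    have g1 : -ℓ (π u) / ω u (π u) * f u + ℓ u / ω u (π u) * f (π u) =
      -(ℓ (π u) * f u / ω u (π u) - ℓ u * f (π u) / ω u (π u)) := by ring
    have g2 : -ℓ (π w) / ω w (π w) * f w + ℓ w / ω w (π w) * f (π w) =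
      -(ℓ (π w) * f w / ω w (π w) - ℓ w * f (π w) / ω w (π w)) := by ring
    rw [g1, g2, f3]
  have hkneg : ∀ u ∈ N, k u < 0 → u ≠ u1 → 0 < ℓ u ∧ ℓ (π u) < 0 := by
    intro u hu hku hne
    have h1 : ℓ u * ℓ (π u) < 0 := by
      have := hs u hu
      by_contra hcon
      push Not at hcon
      have : 0 ≤ k u := div_nonneg hcon this.le
      linarith
    rcases mul_neg_iff.1 h1 with h | h
    · exact h
    · exact absurd (hcross1 u hu h.1 h.2) hne
  have hhn : ∀ y ∈ L u1, n0 y = 1 := fun y hy => (hLf u1 hu1).nrm_mem hS hy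
  have hquad := quad (N := N) (k := k) (D := D) (D' := D') (u1 := u1) ?_ ?_ ?_ ?_ ?_ ?_
  · have hq := hQ1 (fun u => h u - β0 u)
    have hq' : ∑ u ∈ N, C u * (h u - β0 u) = - ∑ u ∈ N, k u * D u ^ 2 := by
      rw [hq]
      congr 1
      exact Finset.sum_congr rfl fun u _ => by simp only [hkdef, hD]; ring
    rw [hq']
    refine ⟨by linarith [hquad.1], fun h0 u hu => ?_⟩
    have hz := hquad.2 (by linarith)
    have hA0 : ∀ u ∈ N, (β u - β0) x0 = 0 := by
      intro u hu
      rw [hA1 u hu]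
      have := hz u hu
      simp only [hkdef, hD] at this
      linarith
    have := hB1 u hu
    rw [hA0 u hu, hA0 _ (prv_mem hS hc hω hu), sub_zero] at this
    exact (mul_eq_zero.1 this).resolve_right (hell u hu)
  · intro u hu w hw hku hkw hu1' hw1'
    obtain ⟨a1, a2⟩ := hkneg u hu hku hu1'
    obtain ⟨b1, b2⟩ := hkneg w hw hkw hw1'
    exact hcross2 u hu w hw a1 a2 b1 b2
  · intro u hu hku hne h0
    have h2 := hA2 u hu
    simp only [hD'] at h0
    rw [h0, mul_zero] at h2
    simp only [LinearMap.sub_apply, hx0, map_add, map_smul, smul_eq_mul] at h2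
    rw [hhn _ (huL u1), hhn _ (hpL u1)] at h2
    have i1 := (hLf u hu).nrm_le hS (hNV u1 hu1)
    have i2 := (hLf u hu).nrm_le hS (hNV _ (hπN u1 hu1))
    have j1 : nrm (L u) u1 = 1 := by nlinarith
    have j2 : nrm (L u) (π u1) = 1 := by nlinarith
    apply hne
    refine (cone_uniq' hS hc hω (hLf u1 hu1) (hLf u hu) (hs u1 hu1) (hs u hu) ?_).symm
    refine (hLf u1 hu1).eq_of_sub (hLf u hu) ?_
    intro x hx
    rcases Finset.mem_insert.1 hx with rfl | hx
    · exact (hLf u hu).mem_of_nrm hS (hNV _ (hπN u1 hu1)) j2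
    · rcases Finset.mem_insert.1 hx with rfl | hx
      · exact (hLf u hu).mem_of_nrm hS (hNV _ hu1) j1
      · exact hkL u hx
  · simp only [hD]
    rw [hβ0, hb1 u1 hu1, hb2 u1 hu1]; simp
  · simp only [hD']
    rw [hhn _ (huL u1), hhn _ (hpL u1)]; simp
  · have := hQ1 (fun u => 1 - n0 u)
    rw [hcc] at this
    simp only [hkdef, hD, hD']
    linarith
  · have hq := hQ2 (fun u => 1 - n0 u)
    have hq' : ∑ u ∈ N, k u * D' u ^ 2 = - ∑ u ∈ N, co u * (1 - n0 u) := by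
      rw [hq, neg_neg]
      exact Finset.sum_congr rfl fun u _ => by simp only [hkdef, hD']; ring
    rw [hq', neg_lt_zero]
    refine Finset.sum_pos' (fun u hu => mul_nonneg (hco u hu).1.le ?_) ?_
    · linarith [(hLf u1 hu1).nrm_le hS (hNV u hu)]
    · refine ⟨prv V d κ ω u1, prv_mem hS hc hω hu1, mul_pos (hco _ (prv_mem hS hc hω hu1)).1 ?_⟩
      have hn : prv V d κ ω u1 ∉ L u1 := by
        obtain ⟨-, q1, q2⟩ := card_two hc (prv_fct hS hc hω hu1).card
        simp only [hL, Finset.mem_insert, q1, q2, or_false]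
        intro hh
        have a1 := hs u1 hu1
        have a2 := prv_neg hS hc hω hu1
        rw [hh] at a2
        linarith
      have := (hLf u1 hu1).nrm_lt hS (hNV _ (prv_mem hS hc hω hu1)) hn
      linarith

end loc
end CSP

namespace CSP

variable {E : Type} [AddCommGroup E] [Module ℝ E] [FiniteDimensional ℝ E]
variable {V : Finset E} {d : ℕ}

/-- infinitesimal motion of the star of `θ` -/
def Mot (V : Finset E) (d : ℕ) (θ : Finset E) (m : E → Module.Dual ℝ E) : Prop :=
  ∀ u v, Fc V d (insert u (insert v θ)) → (m u - m v) (u - v) = 0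

/-- translation part of the field on a facet -/
def fb (m : E → Module.Dual ℝ E) (F : Finset E) : Module.Dual ℝ E := ∑ w ∈ F, m w w • crd F w

/-- alternating part of the field on a facet -/
def fB (m : E → Module.Dual ℝ E) (F : Finset E) : E →ₗ[ℝ] E →ₗ[ℝ] ℝ :=
  ∑ w ∈ F, (crd F w).smulRight (m w - fb m F)

theorem fb_mem (hS : Sys V d) {F : Finset E} (hF : Fct V d F) (m : E → Module.Dual ℝ E) {w : E}
    (hw : w ∈ F) : fb m F w = m w w := by
  unfold fb
  rw [LinearMap.sum_apply, Finset.sum_eq_single w]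
  · simp [hF.crd_self hS hw]
  · intro u hu hne
    simp [hF.crd_ne hS hw hu hne.symm]
  · simp [hw]

theorem fB_mem (hS : Sys V d) {F : Finset E} (hF : Fct V d F) (m : E → Module.Dual ℝ E) {w : E}
    (hw : w ∈ F) : fB m F w = m w - fb m F := by
  unfold fB
  rw [LinearMap.sum_apply, Finset.sum_eq_single w]
  · simp [hF.crd_self hS hw]
  · intro u hu hne
    simp [hF.crd_ne hS hw hu hne.symm]
  · simp [hw]

theorem fB_alt (hS : Sys V d) {F : Finset E} (hF : Fct V d F) {m : E → Module.Dual ℝ E}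
    (hm : ∀ u ∈ F, ∀ v ∈ F, (m u - m v) (u - v) = 0) (x : E) : fB m F x x = 0 := by
  have h : fB m F = -(fB m F).flip := by
    refine hF.ext hS fun u hu => hF.ext hS fun v hv => ?_
    simp only [LinearMap.neg_apply, LinearMap.flip_apply]
    rw [fB_mem hS hF m hu, fB_mem hS hF m hv]
    simp only [LinearMap.sub_apply]
    rw [fb_mem hS hF m hu, fb_mem hS hF m hv]
    have := hm u hu v hv
    simp only [LinearMap.sub_apply, map_sub] at this
    linarith
  have := congrArg (fun f : E →ₗ[ℝ] E →ₗ[ℝ] ℝ => f x x) h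
  simp only [LinearMap.neg_apply, LinearMap.flip_apply] at this
  linarith

theorem field_uniq (hS : Sys V d) {F : Finset E} (hF : Fct V d F) {B B' : E →ₗ[ℝ] E →ₗ[ℝ] ℝ}
    {b b' : Module.Dual ℝ E} (hB : ∀ x, B x x = 0) (hB' : ∀ x, B' x x = 0)
    (h : ∀ w ∈ F, B w + b = B' w + b') : B = B' ∧ b = b' := by
  have hb : b = b' := hF.ext hS fun w hw => by
    have := congrArg (fun f : Module.Dual ℝ E => f w) (h w hw)
    simp only [LinearMap.add_apply, hB, hB'] at this
    linarith
  refine ⟨hF.ext hS fun w hw => ?_, hb⟩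
  have := h w hw
  rw [hb] at this
  exact add_right_cancel this

theorem field_ridge (hS : Sys V d) {R : Finset E} {a : E} (hF : Fct V d (insert a R))
    {B : E →ₗ[ℝ] E →ₗ[ℝ] ℝ} {b : Module.Dual ℝ E} (hB : ∀ x, B x x = 0)
    (h : ∀ w ∈ R, B w + b = 0) (ha : b a = 0) : B = 0 ∧ b = 0 := by
  have hb : b = 0 := hF.ext hS fun w hw => by
    rcases Finset.mem_insert.1 hw with rfl | hw
    · simpa using ha
    · have := congrArg (fun f : Module.Dual ℝ E => f w) (h w hw)
      simp only [LinearMap.add_apply, hB] at this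
      simpa using this
  have hR : ∀ w ∈ R, B w = 0 := fun w hw => by simpa [hb] using h w hw
  refine ⟨hF.ext hS fun w hw => ?_, hb⟩
  rcases Finset.mem_insert.1 hw with rfl | hw
  · refine hF.ext hS fun y hy => ?_
    rcases Finset.mem_insert.1 hy with rfl | hy
    · simp [hB]
    · rw [alt_swap hB, hR y hy]; simp
  · rw [hR w hw]; simp

theorem Mot.sub_field {θ : Finset E} {m : E → Module.Dual ℝ E} (hm : Mot V d θ m)
    {B : E →ₗ[ℝ] E →ₗ[ℝ] ℝ} (hB : ∀ x, B x x = 0) (b : Module.Dual ℝ E) :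
    Mot V d θ (fun v => m v - (B v + b)) := by
  intro u v huv
  have h1 := hm u v huv
  have h2 := hB (u - v)
  have : (m u - (B u + b) - (m v - (B v + b))) = (m u - m v) - B (u - v) := by
    rw [map_sub]; abel
  rw [this, LinearMap.sub_apply, h1, h2, sub_zero]

theorem Mot.mono {θ τ : Finset E} {m : E → Module.Dual ℝ E} (hm : Mot V d θ m) (h : θ ⊆ τ) :
    Mot V d τ m := fun u v huv =>
  hm u v (huv.mono (Finset.insert_subset_insert _ (Finset.insert_subset_insert _ h)))

theorem Mot.fct {θ F : Finset E} {m : E → Module.Dual ℝ E} (hm : Mot V d θ m) (hF : Fct V d F)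
    (h : θ ⊆ F) : ∀ u ∈ F, ∀ v ∈ F, (m u - m v) (u - v) = 0 := fun u hu v hv =>
  hm u v ⟨F, hF, Finset.insert_subset hu (Finset.insert_subset hv h)⟩

/-- volume form for a codimension three face -/
structure Vol (τ : Finset E) (T : E →ₗ[ℝ] E →ₗ[ℝ] E →ₗ[ℝ] ℝ) : Prop where
  a1 : ∀ x y, T x x y = 0
  a2 : ∀ x y, T x y y = 0
  ker : ∀ t ∈ τ, T t = 0
  nz : T ≠ 0

theorem Vol.s1 {τ : Finset E} {T : E →ₗ[ℝ] E →ₗ[ℝ] E →ₗ[ℝ] ℝ} (h : Vol τ T) (x y z : E) :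
    T x y z = - T y x z := by
  have := h.a1 (x + y) z
  simp only [map_add, LinearMap.add_apply, h.a1] at this
  linarith

theorem Vol.s2 {τ : Finset E} {T : E →ₗ[ℝ] E →ₗ[ℝ] E →ₗ[ℝ] ℝ} (h : Vol τ T) (x y z : E) :
    T x y z = - T x z y := by
  have := h.a2 x (y + z)
  simp only [map_add, LinearMap.add_apply, h.a2] at this
  linarith

theorem vol_exists (hS : Sys V d) {τ : Finset E} (hτ : Fc V d τ) (hc : τ.card + 3 = d) :
    ∃ T : E →ₗ[ℝ] E →ₗ[ℝ] E →ₗ[ℝ] ℝ, Vol τ T := by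
  obtain ⟨F, hF, hs⟩ := hτ
  have hcard : (F \ τ).card = 3 := by
    rw [Finset.card_sdiff_of_subset hs, hF.card]; omega
  obtain ⟨a, b, c, hab, hac, hbc, he⟩ := Finset.card_eq_three.1 hcard
  have ha : a ∈ F \ τ := by rw [he]; simp
  have hb : b ∈ F \ τ := by rw [he]; simp
  have hcc : c ∈ F \ τ := by rw [he]; simp
  rw [Finset.mem_sdiff] at ha hb hcc
  set p := crd F a
  set q := crd F b
  set r := crd F c
  refine ⟨p.smulRight (q.smulRight r - r.smulRight q) + q.smulRight (r.smulRight p - p.smulRight r)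
    + r.smulRight (p.smulRight q - q.smulRight p), ?_, ?_, ?_, ?_⟩
  · intro x y
    simp only [LinearMap.add_apply, LinearMap.smulRight_apply, LinearMap.smul_apply,
      LinearMap.sub_apply, smul_eq_mul]
    ring
  · intro x y
    simp only [LinearMap.add_apply, LinearMap.smulRight_apply, LinearMap.smul_apply,
      LinearMap.sub_apply, smul_eq_mul]
    ring
  · intro t ht
    have h1 : p t = 0 := hF.crd_ne hS (hs ht) ha.1 (fun h => ha.2 (h ▸ ht))
    have h2 : q t = 0 := hF.crd_ne hS (hs ht) hb.1 (fun h => hb.2 (h ▸ ht))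
    have h3 : r t = 0 := hF.crd_ne hS (hs ht) hcc.1 (fun h => hcc.2 (h ▸ ht))
    simp [h1, h2, h3]
  · intro h0
    have := congrArg (fun f : E →ₗ[ℝ] E →ₗ[ℝ] E →ₗ[ℝ] ℝ => f a b c) h0
    simp only [LinearMap.add_apply, LinearMap.smulRight_apply, LinearMap.smul_apply,
      LinearMap.sub_apply, smul_eq_mul, LinearMap.zero_apply] at this
    have e1 : p a = 1 := hF.crd_self hS ha.1
    have e2 : q b = 1 := hF.crd_self hS hb.1
    have e3 : r c = 1 := hF.crd_self hS hcc.1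
    have e4 : p b = 0 := hF.crd_ne hS hb.1 ha.1 hab.symm
    have e5 : p c = 0 := hF.crd_ne hS hcc.1 ha.1 hac.symm
    have e6 : q a = 0 := hF.crd_ne hS ha.1 hb.1 hab
    have e7 : q c = 0 := hF.crd_ne hS hcc.1 hb.1 hbc.symm
    have e8 : r a = 0 := hF.crd_ne hS ha.1 hcc.1 hac
    have e9 : r b = 0 := hF.crd_ne hS hb.1 hcc.1 hbc
    rw [e1, e2, e3, e4, e5, e6, e7, e8, e9] at this
    norm_num at this

theorem Vol.area (hS : Sys V d) {τ : Finset E} {T : E →ₗ[ℝ] E →ₗ[ℝ] E →ₗ[ℝ] ℝ} (h : Vol τ T)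
    (hc : τ.card + 3 = d) {v : E} (hv : v ∈ Nb V d τ) : Area (insert v τ) (T v) := by
  refine ⟨fun x => h.a2 v x, ?_, ?_⟩
  · intro t ht
    rcases Finset.mem_insert.1 ht with rfl | ht
    · ext y; simp [h.a1]
    · ext y; rw [h.s1, h.ker t ht]; simp
  · intro h0
    apply h.nz
    obtain ⟨hvτ, F, hF, hs⟩ := mem_Nb.1 hv
    have hcard : (F \ insert v τ).card = 2 := by
      rw [Finset.card_sdiff_of_subset hs, hF.card, Finset.card_insert_of_notMem hvτ]; omega
    obtain ⟨a, b, hab, he⟩ := Finset.card_eq_two.1 hcard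
    have hFm : ∀ x ∈ F, T x = 0 ∨ x = a ∨ x = b := by
      intro x hx
      by_cases hx2 : x ∈ insert v τ
      · left
        rcases Finset.mem_insert.1 hx2 with rfl | hx2
        · exact h0
        · exact h.ker x hx2
      · right
        have : x ∈ F \ insert v τ := Finset.mem_sdiff.2 ⟨hx, hx2⟩
        rw [he] at this
        simpa using this
    refine hF.ext hS fun x hx => hF.ext hS fun y hy => hF.ext hS fun z hz => ?_
    simp only [LinearMap.zero_apply]
    have k2 : ∀ y, T y = 0 → ∀ x z, T x y z = 0 := fun y hy x z => by rw [h.s1, hy]; simp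
    have k3 : ∀ z, T z = 0 → ∀ x y, T x y z = 0 := fun z hz x y => by rw [h.s2, k2 z hz]; simp
    rcases hFm x hx with hx | hx
    · rw [hx]; simp
    rcases hFm y hy with hy | hy
    · exact k2 y hy _ _
    rcases hFm z hz with hz | hz
    · exact k3 z hz _ _
    have a3 : ∀ x y, T x y x = 0 := fun x y => by rw [h.s2, h.a1]; simp
    rcases hx with rfl | rfl <;> rcases hy with rfl | rfl <;> rcases hz with rfl | rfl <;>
      first | exact h.a1 _ _ | exact h.a2 _ _ | exact a3 _ _

section jump
variable {τ : Finset E} {T : E →ₗ[ℝ] E →ₗ[ℝ] E →ₗ[ℝ] ℝ}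

/-- the facet following `u` in the link of `τ ∪ v` -/
def LL (V : Finset E) (d : ℕ) (τ : Finset E) (T : E →ₗ[ℝ] E →ₗ[ℝ] E →ₗ[ℝ] ℝ) (v u : E) : Finset E :=
  insert (nxt V d (insert v τ) (T v) u) (insert u (insert v τ))

/-- jump coefficient -/
def CC (V : Finset E) (d : ℕ) (τ : Finset E) (T : E →ₗ[ℝ] E →ₗ[ℝ] E →ₗ[ℝ] ℝ)
    (m : E → Module.Dual ℝ E) (v u : E) : ℝ :=
  (fb m (LL V d τ T v u) - fb m (LL V d τ T v (prv V d (insert v τ) (T v) u)))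
    (nxt V d (insert v τ) (T v) u) / T v u (nxt V d (insert v τ) (T v) u)

theorem card_ins (hc : τ.card + 3 = d) {v : E} (hv : v ∈ Nb V d τ) : (insert v τ).card + 2 = d := by
  rw [Finset.card_insert_of_notMem (mem_Nb.1 hv).1]; omega

theorem LL_prv (hS : Sys V d) (hc : τ.card + 3 = d) (hT : Vol τ T) {v u : E} (hv : v ∈ Nb V d τ)
    (hu : u ∈ Nb V d (insert v τ)) : LL V d τ T v (prv V d (insert v τ) (T v) u) =
      insert (prv V d (insert v τ) (T v) u) (insert u (insert v τ)) := by
  unfold LL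
  rw [nxt_prv hS (card_ins hc hv) (hT.area hS hc hv) hu, Finset.insert_comm]

theorem LL_fct (hS : Sys V d) (hc : τ.card + 3 = d) (hT : Vol τ T) {v u : E} (hv : v ∈ Nb V d τ)
    (hu : u ∈ Nb V d (insert v τ)) : Fct V d (LL V d τ T v u) :=
  nxt_fct hS (card_ins hc hv) (hT.area hS hc hv) hu

theorem CC_spec (hS : Sys V d) (hc : τ.card + 3 = d) (hT : Vol τ T) (m : E → Module.Dual ℝ E)
    {v u : E} (hv : v ∈ Nb V d τ) (hu : u ∈ Nb V d (insert v τ)) :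
    fb m (LL V d τ T v u) - fb m (LL V d τ T v (prv V d (insert v τ) (T v) u)) =
      CC V d τ T m v u • T v u := by
  have hA := hT.area hS hc hv
  have hc2 := card_ins hc hv
  have hL := LL_fct hS hc hT hv hu
  have hR := LL_fct hS hc hT hv (prv_mem hS hc2 hA hu)
  refine hL.ext hS fun y hy => ?_
  rcases Finset.mem_insert.1 hy with rfl | hy'
  · simp only [LinearMap.smul_apply, smul_eq_mul, CC]
    have := nxt_pos hS hc2 hA hu
    field_simp
  · have hyR : y ∈ LL V d τ T v (prv V d (insert v τ) (T v) u) := by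
      rw [LL_prv hS hc hT hv hu]; exact Finset.mem_insert_of_mem hy'
    simp only [LinearMap.sub_apply, LinearMap.smul_apply, smul_eq_mul]
    rw [fb_mem hS hL m hy, fb_mem hS hR m hyR]
    rcases Finset.mem_insert.1 hy' with rfl | hy'
    · rw [hA.alt]; ring
    · rw [hA.ker' hy']; ring

theorem Nb_symm {v u : E} (hv : v ∈ Nb V d τ) (hu : u ∈ Nb V d (insert v τ)) :
    u ∈ Nb V d τ ∧ v ∈ Nb V d (insert u τ) := by
  obtain ⟨h1, h2⟩ := mem_Nb.1 hv
  obtain ⟨h3, h4⟩ := mem_Nb.1 hu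
  simp only [Finset.mem_insert, not_or] at h3
  refine ⟨mem_Nb.2 ⟨h3.2, h4.mono (Finset.insert_subset_insert _ (Finset.subset_insert _ _))⟩,
    mem_Nb.2 ⟨?_, ?_⟩⟩
  · simp [h1, Ne.symm h3.1]
  · rw [Finset.insert_comm]; exact h4

theorem CC_symm (hS : Sys V d) (hc : τ.card + 3 = d) (hT : Vol τ T) (m : E → Module.Dual ℝ E)
    {v u : E} (hv : v ∈ Nb V d τ) (hu : u ∈ Nb V d (insert v τ)) :
    CC V d τ T m v u = CC V d τ T m u v := by
  have key : ∀ {v u : E} (hv : v ∈ Nb V d τ) (hu : u ∈ Nb V d (insert v τ)),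
      LL V d τ T u v = LL V d τ T v (prv V d (insert v τ) (T v) u) := by
    intro v u hv hu
    obtain ⟨hu', hv'⟩ := Nb_symm hv hu
    rw [LL_prv hS hc hT hv hu]
    have hA := hT.area hS hc hv
    have hA' := hT.area hS hc hu'
    have hc2 := card_ins hc hv
    have : nxt V d (insert u τ) (T u) v = prv V d (insert v τ) (T v) u := by
      refine nxt_eq hS (card_ins hc hu') hA' ?_ ?_
      · rw [Finset.insert_comm v u τ]; exact prv_fct hS hc2 hA hu
      · rw [hT.s1]; linarith [prv_neg hS hc2 hA hu]
    unfold LL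
    rw [this, Finset.insert_comm v u τ]
  obtain ⟨hu', hv'⟩ := Nb_symm hv hu
  have e1 := CC_spec hS hc hT m hv hu
  have e2 := CC_spec hS hc hT m hu' hv'
  rw [← key hv hu] at e1
  rw [← key hu' hv', ← neg_sub, e1] at e2
  have e3 := congrArg (fun f : Module.Dual ℝ E => f (nxt V d (insert v τ) (T v) u)) e2
  have hp := nxt_pos hS (card_ins hc hv) (hT.area hS hc hv) hu
  simp only [LinearMap.neg_apply, LinearMap.smul_apply, smul_eq_mul] at e3
  rw [hT.s1 u v] at e3
  have : (CC V d τ T m v u - CC V d τ T m u v) * T v u (nxt V d (insert v τ) (T v) u) = 0 := by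
    linarith
  rcases mul_eq_zero.1 this with h | h
  · linarith
  · exact absurd h hp.ne'

theorem CC_sum (hS : Sys V d) (hc : τ.card + 3 = d) (hT : Vol τ T) (m : E → Module.Dual ℝ E)
    {v : E} (hv : v ∈ Nb V d τ) :
    ∑ u ∈ Nb V d (insert v τ), CC V d τ T m v u • T v u = 0 := by
  have hA := hT.area hS hc hv
  have hc2 := card_ins hc hv
  rw [Finset.sum_congr rfl fun u hu => (CC_spec hS hc hT m hv hu).symm, Finset.sum_sub_distrib,
    sum_prv hS hc2 hA (fun u => fb m (LL V d τ T v u)), sub_self]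

theorem CC_norm (hS : Sys V d) (hc : τ.card + 3 = d) (hT : Vol τ T) {m : E → Module.Dual ℝ E}
    (hm : Mot V d τ m) {v u1 : E} (hv : v ∈ Nb V d τ) (hu1 : u1 ∈ Nb V d (insert v τ)) :
    ∑ u ∈ Nb V d (insert v τ), CC V d τ T m v u * (1 - nrm (LL V d τ T v u1) u) = 0 := by
  have hA := hT.area hS hc hv
  have hc2 := card_ins hc hv
  set κ := insert v τ with hκ
  set n0 := nrm (LL V d τ T v u1) with hn0
  set a := u1
  set b := nxt V d κ (T v) u1 with hb
  have hL1 := LL_fct hS hc hT hv hu1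
  have na : n0 a = 1 := hL1.nrm_mem hS (by simp [LL])
  have nb : n0 b = 1 := hL1.nrm_mem hS (Finset.mem_insert_self _ _)
  have nk : ∀ t ∈ κ, n0 t = 1 := fun t ht => hL1.nrm_mem hS (by simp [LL, ← hκ, ht])
  have hsub : ∀ u, τ ⊆ LL V d τ T v u := fun u x hx => by simp [LL, hx]
  have main : ∀ u ∈ Nb V d κ, (fB m (LL V d τ T v u) - fB m (LL V d τ T v (prv V d κ (T v) u)))
      + CC V d τ T m v u • (n0.smulRight (T v u) - (T v u).smulRight n0) =
      (-(CC V d τ T m v u * (1 - n0 u))) • T v := by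
    intro u hu
    have hL := LL_fct hS hc hT hv hu
    have hR := LL_fct hS hc hT hv (prv_mem hS hc2 hA hu)
    have hRe := LL_prv hS hc hT hv hu
    have hJ := CC_spec hS hc hT m hv hu
    have hridge : ∀ t ∈ insert u κ, (fB m (LL V d τ T v u) -
        fB m (LL V d τ T v (prv V d κ (T v) u))) t = - (CC V d τ T m v u • T v u) := by
      intro t ht
      have h1 : t ∈ LL V d τ T v u := Finset.mem_insert_of_mem ht
      have h2 : t ∈ LL V d τ T v (prv V d κ (T v) u) := by
        rw [hRe]; exact Finset.mem_insert_of_mem ht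
      rw [LinearMap.sub_apply, fB_mem hS hL m h1, fB_mem hS hR m h2, ← hJ]
      abel
    refine alt2_ext hS (κ := κ) (a := u) (b := nxt V d κ (T v) u) hL ?_ ?_ ?_ ?_ ?_
    · intro x
      have e1 := fB_alt hS hL (hm.fct hL (hsub _)) x
      have e2 := fB_alt hS hR (hm.fct hR (hsub _)) x
      simp only [LinearMap.add_apply, LinearMap.sub_apply, LinearMap.smul_apply,
        LinearMap.smulRight_apply, smul_eq_mul, e1, e2]
      ring
    · intro x
      simp [hT.a2]
    · intro t ht
      rw [LinearMap.add_apply, hridge t (Finset.mem_insert_of_mem ht)]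
      simp only [LinearMap.sub_apply, LinearMap.smul_apply, LinearMap.smulRight_apply, nk t ht,
        hA.ker' ht]
      simp
    · intro t ht
      rw [LinearMap.smul_apply, hA.ker t ht, smul_zero]
    · rw [LinearMap.add_apply, hridge u (Finset.mem_insert_self _ _)]
      simp only [LinearMap.sub_apply, LinearMap.smul_apply, LinearMap.smulRight_apply,
        LinearMap.add_apply, LinearMap.neg_apply, smul_eq_mul, hA.alt]
      ring
  have hsum := Finset.sum_congr rfl main
  have hs2 := congrArg (fun f : E →ₗ[ℝ] E →ₗ[ℝ] ℝ => f a b) hsum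
  simp only [LinearMap.sum_apply, LinearMap.add_apply, LinearMap.sub_apply] at hs2
  rw [Finset.sum_add_distrib, Finset.sum_sub_distrib,
    sum_prv hS hc2 hA (fun u => fB m (LL V d τ T v u) a b), sub_self, zero_add] at hs2
  simp only [LinearMap.sum_apply, LinearMap.sub_apply, LinearMap.smul_apply,
    LinearMap.smulRight_apply, smul_eq_mul, na, nb] at hs2
  have z := CC_sum hS hc hT m hv
  have zb := congrArg (fun f : Module.Dual ℝ E => f b) z
  have za := congrArg (fun f : Module.Dual ℝ E => f a) z
  simp only [LinearMap.sum_apply, LinearMap.smul_apply, smul_eq_mul, LinearMap.zero_apply] at za zb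
  have e1 : ∑ u ∈ Nb V d κ, CC V d τ T m v u * (1 * T v u b - T v u a * 1) = 0 := by
    have : ∀ u ∈ Nb V d κ, CC V d τ T m v u * (1 * T v u b - T v u a * 1) =
      CC V d τ T m v u * T v u b - CC V d τ T m v u * T v u a := fun u _ => by ring
    rw [Finset.sum_congr rfl this, Finset.sum_sub_distrib, za, zb, sub_zero]
  rw [e1, ← Finset.sum_mul, Finset.sum_neg_distrib] at hs2
  have hp : 0 < T v a b := nxt_pos hS hc2 hA hu1
  rcases mul_eq_zero.1 hs2.symm with h | h
  · linarith
  · exact absurd h hp.ne'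

theorem CC_comb (hS : Sys V d) (hc : τ.card + 3 = d) (hT : Vol τ T) (m : E → Module.Dual ℝ E)
    {v : E} (hv : v ∈ Nb V d τ) : ∃ α : ℝ, ∀ f : Module.Dual ℝ E, (∀ t ∈ τ, f t = 0) →
    ∑ u ∈ Nb V d (insert v τ), CC V d τ T m v u * f u = α * f v := by
  have hA := hT.area hS hc hv
  have hc2 := card_ins hc hv
  obtain ⟨u1, hu1⟩ : ∃ u1, u1 ∈ Nb V d (insert v τ) := by
    obtain ⟨hvτ, F, hF, hs⟩ := mem_Nb.1 hv
    obtain ⟨x, hx, hxn⟩ : ∃ x ∈ F, x ∉ insert v τ := by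
      by_contra hcon
      push Not at hcon
      have := Finset.card_le_card (show F ⊆ insert v τ from hcon)
      rw [hF.card] at this
      omega
    exact ⟨x, mem_Nb.2 ⟨hxn, F, hF, Finset.insert_subset hx hs⟩⟩
  set w := ∑ u ∈ Nb V d (insert v τ), CC V d τ T m v u • u with hw
  have hL := LL_fct hS hc hT hv hu1
  have hvL : v ∈ LL V d τ T v u1 := by simp [LL]
  have hTw : T v w = 0 := by
    rw [hw, map_sum]
    simp only [map_smul]
    exact CC_sum hS hc hT m hv
  refine ⟨crd (LL V d τ T v u1) v w, fun f hf => ?_⟩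
  have hfw : ∑ u ∈ Nb V d (insert v τ), CC V d τ T m v u * f u = f w := by
    rw [hw, map_sum]; simp
  rw [hfw]
  have := expand2 hS hA hL (f := f - f v • crd (LL V d τ T v u1) v) (by
    intro t ht
    rcases Finset.mem_insert.1 ht with rfl | ht
    · simp [hL.crd_self hS hvL]
    · have h1 : t ∈ LL V d τ T v u1 := by simp [LL, ht]
      have h2 : t ≠ v := fun h => (mem_Nb.1 hv).1 (h ▸ ht)
      simp [hf t ht, hL.crd_ne hS h1 hvL h2]) w
  rw [hTw] at this
  simp only [LinearMap.zero_apply, zero_mul, sub_zero] at this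
  have hp := nxt_pos hS hc2 hA hu1
  have h0 := (mul_eq_zero.1 this).resolve_left hp.ne'
  simp only [LinearMap.sub_apply, LinearMap.smul_apply, smul_eq_mul] at h0
  linarith

theorem CC_zero (hS : Sys V d) (hτ : Fc V d τ) (hc : τ.card + 3 = d) (hT : Vol τ T)
    {m : E → Module.Dual ℝ E}
    (hm : Mot V d τ m) (h0 : ∀ t ∈ τ, m t = 0) {v u : E} (hv : v ∈ Nb V d τ)
    (hu : u ∈ Nb V d (insert v τ)) : CC V d τ T m v u = 0 := by
  obtain ⟨f, hf1, hf2⟩ := expose hS hτ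
  set C := CC V d τ T m with hCdef
  set N := Nb V d τ with hN
  set N2 : E → Finset E := fun v => Nb V d (insert v τ) with hN2
  have hne : ∀ v ∈ N, ∃ u1, u1 ∈ N2 v := by
    intro v hv
    obtain ⟨hvτ, F, hF, hs⟩ := mem_Nb.1 hv
    obtain ⟨x, hx, hxn⟩ : ∃ x ∈ F, x ∉ insert v τ := by
      by_contra hcon
      push Not at hcon
      have := Finset.card_le_card (show F ⊆ insert v τ from hcon)
      rw [hF.card] at this
      have := card_ins hc hv
      omega
    exact ⟨x, mem_Nb.2 ⟨hxn, F, hF, Finset.insert_subset hx hs⟩⟩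
  choose! u1 hu1 using hne
  have hα : ∀ v ∈ N, ∃ α : ℝ, ∀ f : Module.Dual ℝ E, (∀ t ∈ τ, f t = 0) →
    ∑ u ∈ N2 v, C v u * f u = α * f v := fun v hv => CC_comb hS hc hT m hv
  choose! α hα using hα
  set S : E → ℝ := fun v => ∑ u ∈ N2 v, C v u * (m u u - fb m (LL V d τ T v (u1 v)) u) with hSdef
  have hloc : ∀ v ∈ N, S v ≤ 0 ∧ (S v = 0 → ∀ u ∈ N2 v, C v u = 0) := by
    intro v hv
    have hA := hT.area hS hc hv
    have hc2 := card_ins hc hv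
    refine local_lemma hS hc2 hA (fun u => fb m (LL V d τ T v u)) (fun u => m u u) (C v) (hu1 v hv)
      ?_ ?_ ?_ ?_ ?_
    · intro u hu t ht
      exact fb_mem hS (LL_fct hS hc hT hv hu) m (by unfold LL; simp only [Finset.mem_insert] at ht ⊢; tauto)
    · intro u hu
      exact fb_mem hS (LL_fct hS hc hT hv hu) m (by simp [LL])
    · intro u hu
      exact fb_mem hS (LL_fct hS hc hT hv hu) m (by simp [LL])
    · intro u hu
      exact CC_spec hS hc hT m hv hu
    · exact CC_norm hS hc hT hm hv (hu1 v hv)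
  have hfb : ∀ v ∈ N, ∀ t ∈ τ, fb m (LL V d τ T v (u1 v)) t = 0 := by
    intro v hv t ht
    rw [fb_mem hS (LL_fct hS hc hT hv (hu1 v hv)) m (by simp [LL, ht]), h0 t ht]; simp
  have hS1 : ∀ v ∈ N, S v = ∑ u ∈ N2 v, C v u * m u u - α v * m v v := by
    intro v hv
    have h1 := hα v hv _ (hfb v hv)
    rw [fb_mem hS (LL_fct hS hc hT hv (hu1 v hv)) m (by simp [LL])] at h1
    rw [← h1, ← Finset.sum_sub_distrib]
    exact Finset.sum_congr rfl fun u _ => by ring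
  have hp1 : ∀ v ∈ N, ∑ u ∈ N2 v, C v u * (1 - f u) = α v * (1 - f v) := by
    intro v hv
    have hLf := LL_fct hS hc hT hv (hu1 v hv)
    have h1 := hα v hv (nrm (LL V d τ T v (u1 v)) - f) (fun t ht => by
      rw [LinearMap.sub_apply, hf1 t ht, hLf.nrm_mem hS (by simp [LL, ht]), sub_self])
    simp only [LinearMap.sub_apply] at h1
    rw [hLf.nrm_mem hS (by simp [LL])] at h1
    have h2 := CC_norm hS hc hT hm hv (hu1 v hv)
    rw [← h1]
    have : ∑ u ∈ N2 v, C v u * (1 - f u) = ∑ u ∈ N2 v, C v u * (1 - nrm (LL V d τ T v (u1 v)) u)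
        + ∑ u ∈ N2 v, C v u * (nrm (LL V d τ T v (u1 v)) u - f u) := by
      rw [← Finset.sum_add_distrib]
      exact Finset.sum_congr rfl fun u _ => by ring
    rw [this, h2, zero_add]
  have hsum : ∑ v ∈ N, (1 - f v) * S v = 0 := by
    have e1 : ∑ v ∈ N, (1 - f v) * S v = ∑ v ∈ N, ∑ u ∈ N2 v, (1 - f v) * (C v u * m u u)
        - ∑ v ∈ N, (1 - f v) * (α v * m v v) := by
      rw [← Finset.sum_sub_distrib]
      refine Finset.sum_congr rfl fun v hv => ?_
      rw [hS1 v hv, mul_sub, Finset.mul_sum]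
    have e2 : ∑ v ∈ N, ∑ u ∈ N2 v, (1 - f v) * (C v u * m u u) =
        ∑ u ∈ N, ∑ v ∈ N2 u, (1 - f v) * (C v u * m u u) := by
      refine Finset.sum_comm' fun v u => ⟨fun h => ?_, fun h => ?_⟩
      · exact ⟨(Nb_symm h.1 h.2).2, (Nb_symm h.1 h.2).1⟩
      · exact ⟨(Nb_symm h.2 h.1).1, (Nb_symm h.2 h.1).2⟩
    have e3 : ∑ u ∈ N, ∑ v ∈ N2 u, (1 - f v) * (C v u * m u u) =
        ∑ u ∈ N, (1 - f u) * (α u * m u u) := by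
      refine Finset.sum_congr rfl fun u hu => ?_
      have : (1 - f u) * (α u * m u u) = (∑ v ∈ N2 u, C u v * (1 - f v)) * m u u := by
        rw [hp1 u hu]; ring
      rw [this, Finset.sum_mul]
      refine Finset.sum_congr rfl fun v hv => ?_
      rw [hCdef, CC_symm hS hc hT m hu hv]; ring
    rw [e1, e2, e3, sub_self]
  have hpos : ∀ v ∈ N, 0 < 1 - f v := by
    intro v hv
    have := mem_Nb.1 hv
    linarith [hf2 v (this.2.sub (by simp)) this.1]
  have hnn : ∀ v ∈ N, (1 - f v) * S v ≤ 0 := fun v hv =>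
    mul_nonpos_of_nonneg_of_nonpos (hpos v hv).le (hloc v hv).1
  have hz := (Finset.sum_eq_zero_iff_of_nonpos hnn).1 hsum v hv
  have hSv : S v = 0 := (mul_eq_zero.1 hz).resolve_left (hpos v hv).ne'
  exact (hloc v hv).2 hSv u hu

end jump

theorem rigid0 (hS : Sys V d) {τ : Finset E} (hτ : Fc V d τ) (hc : τ.card + 3 = d)
    {m : E → Module.Dual ℝ E} (hm : Mot V d τ m) :
    ∃ (B : E →ₗ[ℝ] E →ₗ[ℝ] ℝ) (b : Module.Dual ℝ E), (∀ x, B x x = 0) ∧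
      ∀ v, Fc V d (insert v τ) → m v = B v + b := by
  obtain ⟨T, hT⟩ := vol_exists hS hτ hc
  obtain ⟨F0, hF0, hs0⟩ := id hτ
  have hB0 := fB_alt hS hF0 (hm.fct hF0 hs0)
  refine ⟨fB m F0, fb m F0, hB0, fun v hv => ?_⟩
  set m' : E → Module.Dual ℝ E := fun v => m v - (fB m F0 v + fb m F0) with hm'
  have hmm : Mot V d τ m' := hm.sub_field hB0 _
  have hz0 : ∀ w ∈ F0, m' w = 0 := fun w hw => by
    simp only [hm']; rw [fB_mem hS hF0 m hw]; abel
  obtain ⟨G, hG, hsG⟩ := hv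
  have hp : fb m' G = 0 ∧ fB m' G = 0 := by
    refine conn hS τ (fun F => fb m' F = 0 ∧ fB m' F = 0) ?_ hF0 hs0 ?_ hG
      ((Finset.subset_insert _ _).trans hsG)
    · intro F w x hF hτF hw hwτ hx hF' ⟨hb, hB⟩
      have hcard : ((F.erase w) \ τ).card = 2 := by
        have hsub : τ ⊆ F.erase w := fun t ht =>
          Finset.mem_erase.2 ⟨fun h => hwτ (h ▸ ht), hτF ht⟩
        rw [Finset.card_sdiff_of_subset hsub,
          Finset.card_erase_of_mem hw, hF.card]
        omega
      obtain ⟨v, u, hvu, he⟩ := Finset.card_eq_two.1 hcard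
      have hRe : F.erase w = insert u (insert v τ) := by
        ext y
        have := congrArg (fun s => y ∈ s) he
        simp only [Finset.mem_sdiff, Finset.mem_insert, Finset.mem_singleton, eq_iff_iff] at this
        by_cases hy : y ∈ τ
        · have h1 : y ∈ F.erase w := Finset.mem_erase.2 ⟨fun h => hwτ (h ▸ hy), hτF hy⟩
          simp only [h1, true_iff]
          simp [hy]
        · simp only [Finset.mem_insert, hy, or_false]
          rw [or_comm, ← this]
          simp [hy]
      have hv1 : v ∈ F.erase w \ τ := by rw [he]; simp
      have hu1 : u ∈ F.erase w \ τ := by rw [he]; simp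
      rw [Finset.mem_sdiff] at hv1 hu1
      have hRF : Fc V d (insert u (insert v τ)) := hRe ▸ ⟨F, hF, Finset.erase_subset _ _⟩
      have hv : v ∈ Nb V d τ := mem_Nb.2 ⟨hv1.2, hRF.mono (Finset.subset_insert _ _)⟩
      have hu : u ∈ Nb V d (insert v τ) := mem_Nb.2 ⟨by simp [hu1.2, Ne.symm hvu], hRF⟩
      have hA := hT.area hS hc hv
      have hc2 := card_ins hc hv
      have hJ := CC_spec hS hc hT m' hv hu
      rw [CC_zero hS hτ hc hT hmm (fun t ht => hz0 t (hs0 ht)) hv hu, zero_smul, sub_eq_zero,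
        LL_prv hS hc hT hv hu] at hJ
      have hcase : ∀ a, Fct V d (insert a (insert u (insert v τ))) → a = w ∨ a = x := by
        intro a ha
        by_cases haF : a ∈ F
        · left
          by_contra hne
          have h1 : a ∈ insert u (insert v τ) := hRe ▸ Finset.mem_erase.2 ⟨hne, haF⟩
          have := ha.card
          obtain ⟨-, h2, h3⟩ := card_two hc2 this
          simp only [Finset.mem_insert] at h1 h2
          tauto
        · right
          rw [← hRe] at ha
          exact adj_unique hS hF hw haF hx ha hF'
      have hwF : insert w (insert u (insert v τ)) = F := by rw [← hRe, Finset.insert_erase hw]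
      have hxF : insert x (insert u (insert v τ)) = insert x (F.erase w) := by rw [← hRe]
      have hne : nxt V d (insert v τ) (T v) u ≠ prv V d (insert v τ) (T v) u := by
        intro h
        have h1 := nxt_pos hS hc2 hA hu
        have h2 := prv_neg hS hc2 hA hu
        rw [h] at h1
        linarith
      have hbb : fb m' F = fb m' (insert x (F.erase w)) := by
        unfold LL at hJ
        rcases hcase _ (nxt_fct hS hc2 hA hu) with h1 | h1 <;>
          rcases hcase _ (prv_fct hS hc2 hA hu) with h2 | h2
        · exact absurd (h1.trans h2.symm) hne
        · rw [h1, h2, hwF, hxF] at hJ; exact hJ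
        · rw [h1, h2, hwF, hxF] at hJ; exact hJ.symm
        · exact absurd (h1.trans h2.symm) hne
      have hb' : fb m' (insert x (F.erase w)) = 0 := hbb ▸ hb
      have hτF' : τ ⊆ insert x (F.erase w) := by
        rw [hRe]; intro t ht; simp [ht]
      have := field_ridge hS hF' (fB_alt hS hF' (hmm.fct hF' hτF')) (b := fb m' (insert x (F.erase w)))
        (fun y hy => ?_) (by rw [hb']; simp)
      · exact ⟨this.2, this.1⟩
      · have hyF := Finset.mem_of_mem_erase hy
        rw [fB_mem hS hF' m' (Finset.mem_insert_of_mem hy)]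
        have h3 := fB_mem hS hF m' hyF
        rw [hB, hb] at h3
        simp only [LinearMap.zero_apply, sub_zero] at h3
        rw [← h3]; abel
    · have hb : fb m' F0 = 0 := by
        refine hF0.ext hS fun w hw => ?_
        rw [fb_mem hS hF0 m' hw, hz0 w hw]
      refine ⟨hb, hF0.ext hS fun w hw => ?_⟩
      rw [fB_mem hS hF0 m' hw, hz0 w hw, hb]; simp
  have hvG : v ∈ G := hsG (Finset.mem_insert_self _ _)
  have h3 := fB_mem hS hG m' hvG
  rw [hp.1, hp.2] at h3
  simp only [LinearMap.zero_apply, sub_zero] at h3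
  have h4 : m v - (fB m F0 v + fb m F0) = 0 := h3.symm
  exact sub_eq_zero.1 h4

theorem rigid (hS : Sys V d) {θ : Finset E} (hθ : Fc V d θ) (hc : θ.card + 3 ≤ d)
    {m : E → Module.Dual ℝ E} (hm : Mot V d θ m) :
    ∃ (B : E →ₗ[ℝ] E →ₗ[ℝ] ℝ) (b : Module.Dual ℝ E), (∀ x, B x x = 0) ∧
      ∀ v, Fc V d (insert v θ) → m v = B v + b := by
  obtain ⟨F0, hF0, hs0⟩ := id hθ
  have hB0 := fB_alt hS hF0 (hm.fct hF0 hs0)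
  refine ⟨fB m F0, fb m F0, hB0, fun v hv => ?_⟩
  obtain ⟨G, hG, hsG⟩ := hv
  refine conn hS θ (fun F => ∀ w ∈ F, m w = fB m F0 w + fb m F0) ?_ hF0 hs0 ?_ hG
      ((Finset.subset_insert _ _).trans hsG) v (hsG (Finset.mem_insert_self _ _))
  · intro F w x hF hθF hw hwθ hx hF' hp
    have hsub : θ ⊆ F.erase w := fun t ht => Finset.mem_erase.2 ⟨fun h => hwθ (h ▸ ht), hθF ht⟩
    obtain ⟨τ, hθτ, hτR, hcτ⟩ := Finset.exists_subsuperset_card_eq hsub (n := d - 3) (by omega)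
      (by rw [Finset.card_erase_of_mem hw, hF.card]; omega)
    obtain ⟨B, b, hB, hBb⟩ := rigid0 hS (τ := τ) ⟨F, hF, hτR.trans (Finset.erase_subset _ _)⟩
      (by omega) (hm.mono hθτ)
    have hu := field_uniq hS hF hB hB0 (b := b) (b' := fb m F0) (fun y hy => by
      rw [← hp y hy, hBb y ⟨F, hF, Finset.insert_subset hy (hτR.trans (Finset.erase_subset _ _))⟩])
    intro y hy
    rw [hBb y ⟨_, hF', Finset.insert_subset hy (hτR.trans (Finset.subset_insert _ _))⟩, hu.1, hu.2]
  · intro w hw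
    rw [fB_mem hS hF0 m hw]; abel

end CSP

namespace CSP

variable {E : Type} [AddCommGroup E] [Module ℝ E] [FiniteDimensional ℝ E]
variable {V : Finset E} {d : ℕ}

/-- infinitesimal change of edge length -/
def rho (m : E → Module.Dual ℝ E) (u v : E) : ℝ := (m u - m v) (u - v)

theorem rho_add (m m' : E → Module.Dual ℝ E) (u v : E) : rho (m + m') u v = rho m u v + rho m' u v := by
  simp only [rho, Pi.add_apply, LinearMap.sub_apply, LinearMap.add_apply]; ring

theorem rho_sub (m m' : E → Module.Dual ℝ E) (u v : E) : rho (m - m') u v = rho m u v - rho m' u v := by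
  simp only [rho, Pi.sub_apply, LinearMap.sub_apply]; ring

theorem rho_smul (c : ℝ) (m : E → Module.Dual ℝ E) (u v : E) : rho (c • m) u v = c * rho m u v := by
  simp only [rho, Pi.smul_apply, LinearMap.sub_apply, LinearMap.smul_apply, smul_eq_mul]; ring

theorem rho_symm (m : E → Module.Dual ℝ E) (u v : E) : rho m u v = rho m v u := by
  simp only [rho, LinearMap.sub_apply, map_sub]; ring

theorem rho_self (m : E → Module.Dual ℝ E) (u : E) : rho m u u = 0 := by
  simp [rho]

theorem rho_even {m : E → Module.Dual ℝ E} (hm : ∀ v, m (-v) = m v) (u v : E) :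
    rho m (-u) (-v) = - rho m u v := by
  simp only [rho, hm, LinearMap.sub_apply, map_sub, map_neg]; ring

theorem rho_odd {m : E → Module.Dual ℝ E} (hm : ∀ v, m (-v) = - m v) (u v : E) :
    rho m (-u) (-v) = rho m u v := by
  simp only [rho, hm, LinearMap.sub_apply, LinearMap.neg_apply, map_sub, map_neg]; ring

theorem rho_field {m : E → Module.Dual ℝ E} {B : E →ₗ[ℝ] E →ₗ[ℝ] ℝ} {b : Module.Dual ℝ E}
    (hB : ∀ x, B x x = 0) {u v : E} (hu : m u = B u + b) (hv : m v = B v + b) : rho m u v = 0 := by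
  have := alt_swap hB u v
  simp only [rho, hu, hv, LinearMap.sub_apply, LinearMap.add_apply, map_sub, hB]; linarith

theorem rho_congr {m m' : E → Module.Dual ℝ E} {u v : E} (hu : m u = m' u) (hv : m v = m' v) :
    rho m u v = rho m' u v := by simp only [rho, hu, hv]

/-- extension by a sign from a half -/
def ex (U : Finset E) (ε : ℝ) : ({v // v ∈ U} → Module.Dual ℝ E) →ₗ[ℝ] (E → Module.Dual ℝ E) where
  toFun m v := if h : v ∈ U then m ⟨v, h⟩ else if h : -v ∈ U then ε • m ⟨-v, h⟩ else 0
  map_add' m m' := by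
    ext v x
    by_cases h : v ∈ U <;> by_cases h' : -v ∈ U <;> simp [h, h', mul_add]
  map_smul' c m := by
    ext v x
    by_cases h : v ∈ U <;> by_cases h' : -v ∈ U <;> simp [h, h']
    ring

theorem ex_mem {U : Finset E} {ε : ℝ} (m : {v // v ∈ U} → Module.Dual ℝ E) {v : E} (h : v ∈ U) :
    ex U ε m v = m ⟨v, h⟩ := by simp [ex, h]

theorem ex_neg {U : Finset E} {ε : ℝ} (hε : ε * ε = 1) (hU : ∀ v ∈ U, -v ∉ U)
    (m : {v // v ∈ U} → Module.Dual ℝ E) (v : E) :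
    ex U ε m (-v) = ε • ex U ε m v := by
  by_cases h : v ∈ U
  · have h' := hU v h
    simp [ex, h, h']
  · by_cases h' : -v ∈ U
    · simp [ex, h, h', smul_smul, hε]
    · simp [ex, h, h']

theorem ex_out {U : Finset E} {ε : ℝ} (m : {v // v ∈ U} → Module.Dual ℝ E) {v : E} (h : v ∉ U)
    (h' : -v ∉ U) : ex U ε m v = 0 := by simp [ex, h, h']

/-- generic functional -/
theorem exists_gen (V : Finset E) : ∃ φ : Module.Dual ℝ E, ∀ u ∈ V, ∀ v ∈ V, u + v ≠ 0 → φ (u + v) ≠ 0 := by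
  obtain ⟨φ, hφ⟩ := Module.exists_dual_forall_apply_ne_zero (K := ℝ) (M := E)
    (ι := {p : E × E // p ∈ (V ×ˢ V).filter (fun p => p.1 + p.2 ≠ 0)}) (fun p => p.1.1 + p.1.2)
    (fun p => (Finset.mem_filter.1 p.2).2)
  exact ⟨φ, fun u hu v hv h => hφ ⟨(u, v), by simp [hu, hv, h]⟩⟩

theorem ne_neg_self (hS : Sys V d) {v : E} (hv : v ∈ V) : v + v ≠ 0 := by
  intro h
  obtain ⟨F, hF, hs⟩ := fc_single hS hv
  have h1 : v ∈ F := hs (by simp)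
  have : -v = v := by rw [neg_eq_iff_add_eq_zero, h]
  exact hF.fc.not_anti hS h1 (by rwa [this])

theorem zero_notMem (hS : Sys V d) {v : E} (hv : v ∈ V) : v ≠ 0 := fun h =>
  ne_neg_self hS hv (by simp [h])

/-- ordered edges -/
def OE (V : Finset E) (d : ℕ) : Finset (E × E) :=
  (V ×ˢ V).filter (fun p => p.1 ≠ p.2 ∧ Fc V d {p.1, p.2})

theorem card_half {X : Finset E} (φ : Module.Dual ℝ E) (hX : ∀ v ∈ X, -v ∈ X) (h0 : ∀ v ∈ X, φ v ≠ 0) :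
    2 * (X.filter (fun v => 0 < φ v)).card = X.card := by
  have h1 : (X.filter (fun v => 0 < φ v)).card = (X.filter (fun v => ¬ 0 < φ v)).card := by
    refine Finset.card_bij' (fun v _ => -v) (fun v _ => -v) ?_ ?_ ?_ ?_
    · intro v hv
      simp only [Finset.mem_filter, map_neg] at hv ⊢
      exact ⟨hX v hv.1, by linarith [hv.2]⟩
    · intro v hv
      simp only [Finset.mem_filter, map_neg] at hv ⊢
      have := h0 v hv.1
      exact ⟨hX v hv.1, by have := lt_of_le_of_ne (not_lt.1 hv.2) this; linarith⟩
    · simp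
    · simp
  have := Finset.card_filter_add_card_filter_not (s := X) (fun v => 0 < φ v)
  omega

theorem card_half2 {X : Finset (E × E)} (q : E × E → ℝ) (σ : E × E → E × E) (hσ : ∀ p, σ (σ p) = p)
    (hX : ∀ p ∈ X, σ p ∈ X) (hq : ∀ p, q (σ p) = - q p) (h0 : ∀ p ∈ X, q p ≠ 0) :
    2 * (X.filter (fun p => 0 < q p)).card = X.card := by
  have h1 : (X.filter (fun v => 0 < q v)).card = (X.filter (fun v => ¬ 0 < q v)).card := by
    refine Finset.card_bij' (fun v _ => σ v) (fun v _ => σ v) ?_ ?_ ?_ ?_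
    · intro v hv
      simp only [Finset.mem_filter, hq] at hv ⊢
      exact ⟨hX v hv.1, by linarith [hv.2]⟩
    · intro v hv
      simp only [Finset.mem_filter, hq] at hv ⊢
      have := h0 v hv.1
      exact ⟨hX v hv.1, by have := lt_of_le_of_ne (not_lt.1 hv.2) this; linarith⟩
    · simp [hσ]
    · simp [hσ]
  have := Finset.card_filter_add_card_filter_not (s := X) (fun v => 0 < q v)
  omega

/-- edge count hypothesis -/
def EC (V : Finset E) (d : ℕ) : Prop := (OE V d).card + 4 * d = 2 * d * V.card

theorem mem_OE {u v : E} : (u, v) ∈ OE V d ↔ u ≠ v ∧ Fc V d {u, v} := by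
  simp only [OE, Finset.mem_filter, Finset.mem_product]
  refine ⟨fun h => h.2, fun h => ⟨⟨h.2.sub (by simp), h.2.sub (by simp)⟩, h⟩⟩

theorem Fc_neg2 (hS : Sys V d) {u v : E} (h : Fc V d {u, v}) : Fc V d {-u, -v} := by
  have := h.neg hS
  rwa [Finset.image_insert, Finset.image_singleton] at this

/-- rank nullity surjectivity -/
theorem surj_of_ker {M N K : Type*} [AddCommGroup M] [Module ℝ M] [FiniteDimensional ℝ M]
    [AddCommGroup N] [Module ℝ N] [FiniteDimensional ℝ N] [AddCommGroup K] [Module ℝ K]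
    [FiniteDimensional ℝ K]
    (L : M →ₗ[ℝ] N) (C : K →ₗ[ℝ] M) (hk : ∀ x, L x = 0 → ∃ k, C k = x) :
    Module.finrank ℝ M ≤ Module.finrank ℝ (LinearMap.range L) + Module.finrank ℝ K := by
  have h1 := LinearMap.finrank_range_add_finrank_ker L
  have h2 : Module.finrank ℝ (LinearMap.ker L) ≤ Module.finrank ℝ (LinearMap.range C) :=
    Submodule.finrank_mono (fun x hx => by
      obtain ⟨k, hk⟩ := hk x hx
      exact ⟨k, hk⟩)
  have h3 := LinearMap.finrank_range_le C
  omega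

theorem surj (hS : Sys V d) (hd : 3 ≤ d) (hE : EC V d) (b : E → E → ℝ) (hsym : ∀ u v, b u v = b v u)
    (hodd : ∀ u v, b (-u) (-v) = - b u v) :
    ∃ m : E → Module.Dual ℝ E, (∀ v, m (-v) = m v) ∧
      ∀ u v, u ≠ v → Fc V d {u, v} → rho m u v = b u v := by
  obtain ⟨φ, hφ⟩ := exists_gen V
  have hV0 : ∀ v ∈ V, φ v ≠ 0 := fun v hv h => hφ v hv v hv (ne_neg_self hS hv) (by simp [h])
  set Vp := V.filter (fun v => 0 < φ v) with hVp
  have cV : 2 * Vp.card = V.card := card_half φ hS.neg hV0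
  have hne1 : ∀ p ∈ OE V d, φ (p.1 + p.2) ≠ 0 := by
    rintro ⟨u, v⟩ hp
    have h := mem_OE.1 hp
    refine hφ u (h.2.sub (by simp)) v (h.2.sub (by simp)) fun h0 => ?_
    exact h.2.not_anti hS (v := u) (by simp) (by simp [neg_eq_of_add_eq_zero_right h0])
  have hne2 : ∀ p ∈ OE V d, φ (p.2 - p.1) ≠ 0 := by
    rintro ⟨u, v⟩ hp
    have h := mem_OE.1 hp
    show φ (v - u) ≠ 0
    rw [sub_eq_add_neg]
    refine hφ v (h.2.sub (by simp)) (-u) (hS.neg _ (h.2.sub (by simp))) fun h0 => ?_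
    exact h.1 (by rw [← sub_eq_add_neg, sub_eq_zero] at h0; exact h0.symm)
  set E1 := (OE V d).filter (fun p => 0 < φ (p.1 + p.2)) with hE1
  set Ep := E1.filter (fun p => 0 < φ (p.2 - p.1)) with hEp
  have c1 : 2 * E1.card = (OE V d).card := by
    refine card_half2 (fun p => φ (p.1 + p.2)) (fun p => (-p.1, -p.2)) (by simp) ?_ ?_ hne1
    · rintro ⟨u, v⟩ hp
      have h := mem_OE.1 hp
      exact mem_OE.2 ⟨fun h' => h.1 (neg_injective h'), Fc_neg2 hS h.2⟩
    · intro p; simp only [← neg_add, map_neg]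
  have c2 : 2 * Ep.card = E1.card := by
    refine card_half2 (fun p => φ (p.2 - p.1)) (fun p => (p.2, p.1)) (by simp) ?_ ?_ ?_
    · rintro ⟨u, v⟩ hp
      simp only [hE1, Finset.mem_filter, mem_OE] at hp ⊢
      exact ⟨⟨hp.1.1.symm, by rw [Finset.pair_comm]; exact hp.1.2⟩, by rw [add_comm]; exact hp.2⟩
    · intro p; simp
    · intro p hp; exact hne2 p (Finset.mem_filter.1 hp).1
  have hVneg : ∀ v ∈ Vp, -v ∉ Vp := by
    intro v hv h
    simp only [hVp, Finset.mem_filter, map_neg] at hv h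
    linarith [hv.2, h.2]
  have hcase : ∀ v ∈ V, v ∈ Vp ∨ -v ∈ Vp := by
    intro v hv
    simp only [hVp, Finset.mem_filter, map_neg]
    rcases lt_or_gt_of_ne (hV0 v hv) with h | h
    · exact Or.inr ⟨hS.neg v hv, by linarith⟩
    · exact Or.inl ⟨hv, h⟩
  let L : ({v // v ∈ Vp} → Module.Dual ℝ E) →ₗ[ℝ] ({p // p ∈ Ep} → ℝ) :=
    { toFun := fun m p => rho (ex Vp 1 m) p.1.1 p.1.2
      map_add' := fun m m' => by ext p; simp only [map_add, rho_add, Pi.add_apply]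
      map_smul' := fun c m => by
        ext p; simp only [map_smul, rho_smul, Pi.smul_apply, RingHom.id_apply, smul_eq_mul] }
  have hev : ∀ m v, ex Vp 1 m (-v) = ex Vp 1 m v := fun m v => by
    rw [ex_neg (by norm_num) hVneg, one_smul]
  -- transport from `Ep` to all edges
  have htr : ∀ m (b' : E → E → ℝ), (∀ u v, b' u v = b' v u) → (∀ u v, b' (-u) (-v) = - b' u v) →
      (∀ p (hp : p ∈ Ep), L m ⟨p, hp⟩ = b' p.1 p.2) →
      ∀ u v, u ≠ v → Fc V d {u, v} → rho (ex Vp 1 m) u v = b' u v := by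
    intro m b' hs ho hL u v huv hf
    have step : ∀ u v, (u, v) ∈ E1 → rho (ex Vp 1 m) u v = b' u v := by
      intro u v h
      have h' := Finset.mem_filter.1 h
      rcases lt_or_gt_of_ne (hne2 _ h'.1) with h2 | h2
      · have : (v, u) ∈ Ep := by
          have h3 := mem_OE.1 h'.1
          simp only [hEp, hE1, Finset.mem_filter, mem_OE]
          refine ⟨⟨⟨h3.1.symm, by rw [Finset.pair_comm]; exact h3.2⟩, by rw [add_comm]; exact h'.2⟩, ?_⟩
          simp only [map_sub] at h2 ⊢
          linarith
        rw [rho_symm, hs]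
        exact hL (v, u) this
      · exact hL (u, v) (Finset.mem_filter.2 ⟨h, h2⟩)
    have h0 : (u, v) ∈ OE V d := mem_OE.2 ⟨huv, hf⟩
    rcases lt_or_gt_of_ne (hne1 _ h0) with h2 | h2
    · have := step (-u) (-v) (Finset.mem_filter.2 ⟨mem_OE.2 ⟨fun h' => huv (neg_injective h'), Fc_neg2 hS hf⟩, by
        simp only [map_add, map_neg] at h2 ⊢; linarith⟩)
      rw [rho_even (hev m), ho] at this
      linarith
    · exact step u v (Finset.mem_filter.2 ⟨h0, h2⟩)
  let C : Module.Dual ℝ E →ₗ[ℝ] ({v // v ∈ Vp} → Module.Dual ℝ E) :=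
    LinearMap.pi (fun _ => LinearMap.id)
  have hker : ∀ m, L m = 0 → ∃ k, C k = m := by
    intro m hm
    have hz := htr m (fun _ _ => 0) (by simp) (by simp) (fun p hp => by rw [hm]; rfl)
    have hmot : Mot V d ∅ (ex Vp 1 m) := by
      intro u v h
      by_cases huv : u = v
      · subst huv; exact rho_self _ _
      · exact hz u v huv h
    obtain ⟨B, k, hB, hk⟩ := rigid hS (fc_empty hS) (by simpa using hd) hmot
    refine ⟨k, ?_⟩
    ext1 ⟨v, hv⟩
    have hvV : v ∈ V := (Finset.mem_filter.1 hv).1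
    have e1 := hk v (fc_single hS hvV)
    have e2 := hk (-v) (fc_single hS (hS.neg v hvV))
    rw [hev, e1, map_neg] at e2
    have e3 : B v = 0 := by
      ext x
      have := congrArg (fun f : Module.Dual ℝ E => f x) e2
      simp only [LinearMap.add_apply, LinearMap.neg_apply] at this
      simp only [LinearMap.zero_apply]
      linarith
    rw [e3, zero_add, ex_mem m hv] at e1
    rw [e1]; rfl
  have hrk := surj_of_ker L C hker
  have hd1 : Module.finrank ℝ (Module.Dual ℝ E) = d := by rw [Subspace.dual_finrank_eq, hS.fr]
  have hd2 : Module.finrank ℝ ({v // v ∈ Vp} → Module.Dual ℝ E) = Vp.card * d := by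
    rw [Module.finrank_pi_fintype]; simp [hd1]
  have hd3 : Module.finrank ℝ ({p // p ∈ Ep} → ℝ) = Ep.card := by simp
  rw [hd1, hd2] at hrk
  have hle := Submodule.finrank_le (LinearMap.range L)
  rw [hd3] at hle
  have htop : LinearMap.range L = ⊤ := by
    apply Submodule.eq_top_of_finrank_eq
    rw [hd3]
    unfold EC at hE
    have : 4 * Ep.card + 4 * d = 4 * (Vp.card * d) := by
      have : 2 * d * V.card = 4 * (Vp.card * d) := by rw [← cV]; ring
      omega
    omega
  have : (fun p : {p // p ∈ Ep} => b p.1.1 p.1.2) ∈ LinearMap.range L := by rw [htop]; trivial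
  obtain ⟨m, hm⟩ := this
  exact ⟨ex Vp 1 m, hev m, htr m b hsym hodd (fun p hp => by rw [hm])⟩

theorem surjA (hS : Sys V d) (hd : 3 ≤ d) (hE : EC V d) (A : E → E → Prop) (hA : ∀ u v, A u v → A v u)
    (hdis : ∀ u v, Fc V d {u, v} → A u v → A (-u) (-v) → False) (b : E → E → ℝ) (hsym : ∀ u v, b u v = b v u) :
    ∃ m : E → Module.Dual ℝ E, (∀ v, m (-v) = m v) ∧
      (∀ u v, u ≠ v → Fc V d {u, v} → A u v → rho m u v = b u v) ∧
      (∀ u v, u ≠ v → Fc V d {u, v} → ¬ A u v → ¬ A (-u) (-v) → rho m u v = 0) := by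
  have hA' : ∀ u v, A u v ↔ A v u := fun u v => ⟨hA u v, hA v u⟩
  obtain ⟨m, hm, h⟩ := surj hS hd hE
    (fun u v => (if A u v then b u v else 0) - (if A (-u) (-v) then b (-u) (-v) else 0))
    (fun u v => by simp only [hA' u v, hA' (-u) (-v), hsym u v, hsym (-u) (-v)])
    (fun u v => by simp only [neg_neg]; ring)
  refine ⟨m, hm, fun u v huv hf hAu => ?_, fun u v huv hf h1 h2 => ?_⟩
  · rw [h u v huv hf, if_pos hAu, if_neg (hdis u v hf hAu), sub_zero]
  · rw [h u v huv hf, if_neg h1, if_neg h2, sub_zero]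

theorem surjQ (hS : Sys V d) (hd : 3 ≤ d) (hE : EC V d) (Q : Finset (E × E))
    (hQ : ∀ u v, (u, v) ∈ Q → u ≠ v ∧ Fc V d {u, v}) (h1 : ∀ u v, (u, v) ∈ Q → (v, u) ∉ Q)
    (h2 : ∀ u v, (u, v) ∈ Q → (-u, -v) ∉ Q) (h3 : ∀ u v, (u, v) ∈ Q → (-v, -u) ∉ Q) (b : E × E → ℝ) :
    ∃ m : E → Module.Dual ℝ E, (∀ v, m (-v) = m v) ∧ ∀ u v, (u, v) ∈ Q → rho m u v = b (u, v) := by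
  obtain ⟨m, hm, h⟩ := surj hS hd hE
    (fun u v => ((if (u, v) ∈ Q then b (u, v) else 0) + (if (v, u) ∈ Q then b (v, u) else 0))
      - ((if (-u, -v) ∈ Q then b (-u, -v) else 0) + (if (-v, -u) ∈ Q then b (-v, -u) else 0)))
    (fun u v => by beta_reduce; ring)
    (fun u v => by simp only [neg_neg]; ring)
  refine ⟨m, hm, fun u v huv => ?_⟩
  rw [h u v (hQ u v huv).1 (hQ u v huv).2, if_pos huv, if_neg (h1 u v huv), if_neg (h2 u v huv),
    if_neg (h3 u v huv)]
  ring

end CSP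

namespace CSP

variable {E : Type} [AddCommGroup E] [Module ℝ E] [FiniteDimensional ℝ E]
variable {V : Finset E} {d : ℕ}

structure Good (V : Finset E) (d : ℕ) : Prop where
  S : Sys V d
  hd : 5 ≤ d
  E : EC V d

/-- antipodal pairs in the link -/
def Wt (V : Finset E) (d : ℕ) (θ : Finset E) : Finset E :=
  (Nb V d θ).filter (fun x => -x ∈ Nb V d θ)

theorem mem_Wt {θ : Finset E} {x : E} : x ∈ Wt V d θ ↔ x ∈ Nb V d θ ∧ -x ∈ Nb V d θ := by
  simp [Wt]

theorem Wt_neg {θ : Finset E} {x : E} (h : x ∈ Wt V d θ) : -x ∈ Wt V d θ := by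
  rw [mem_Wt] at h ⊢; rw [neg_neg]; exact h.symm

theorem mem_V_of_Nb {θ : Finset E} {x : E} (h : x ∈ Nb V d θ) : x ∈ V :=
  (mem_Nb.1 h).2.sub (Finset.mem_insert_self _ _)

theorem mem_Wt_of (hS : Sys V d) {θ : Finset E} {x : E} (h : Fc V d (insert x θ))
    (h' : Fc V d (insert (-x) θ)) : x ∈ Wt V d θ := by
  rw [mem_Wt, mem_Nb, mem_Nb]
  refine ⟨⟨fun hx => ?_, h⟩, fun hx => ?_, h'⟩
  · exact h'.not_anti hS (v := x) (Finset.mem_insert_of_mem hx) (Finset.mem_insert_self _ _)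
  · exact h.not_anti hS (v := x) (Finset.mem_insert_self _ _) (Finset.mem_insert_of_mem hx)

theorem Wt_anti (hS : Sys V d) {θ θ' : Finset E} (hs : θ ⊆ θ') : Wt V d θ' ⊆ Wt V d θ := by
  intro x hx
  rw [mem_Wt, mem_Nb, mem_Nb] at hx
  exact mem_Wt_of hS (hx.1.2.mono (Finset.insert_subset_insert _ hs))
    (hx.2.2.mono (Finset.insert_subset_insert _ hs))

theorem Wt_empty_anti (hS : Sys V d) {θ θ' : Finset E} (hs : θ ⊆ θ') (h : Wt V d θ = ∅) :
    Wt V d θ' = ∅ := Finset.subset_empty.1 (h ▸ Wt_anti hS hs)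

theorem Wt_both (hS : Sys V d) {θ : Finset E} {u v : E} (h : Fc V d (insert u (insert v θ)))
    (h' : Fc V d (insert (-u) (insert (-v) θ))) : u ∈ Wt V d θ ∧ v ∈ Wt V d θ := by
  have a : ∀ u v : E, insert u θ ⊆ insert u (insert v θ) := fun u v =>
    Finset.insert_subset_insert _ (Finset.subset_insert _ _)
  have b : ∀ u v : E, insert v θ ⊆ insert u (insert v θ) := fun u v => Finset.subset_insert _ _
  exact ⟨mem_Wt_of hS (h.mono (a u v)) (h'.mono (a _ _)), mem_Wt_of hS (h.mono (b u v)) (h'.mono (b _ _))⟩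

theorem Fc.pair {θ : Finset E} {u v : E} (h : Fc V d (insert u (insert v θ))) : Fc V d {u, v} :=
  h.mono (by intro x; simp; tauto)

theorem Fc.swap2 {θ : Finset E} {u v : E} (h : Fc V d (insert u (insert v θ))) :
    Fc V d (insert v (insert u θ)) := by rwa [Finset.insert_comm]

theorem Fc.base2 {θ : Finset E} {u v : E} (h : Fc V d (insert u (insert v θ))) :
    Fc V d θ := h.mono ((Finset.subset_insert _ _).trans (Finset.subset_insert _ _))

theorem mot_of_rho {θ : Finset E} {m : E → Module.Dual ℝ E}
    (h : ∀ u v, u ≠ v → Fc V d (insert u (insert v θ)) → rho m u v = 0) : Mot V d θ m := by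
  intro u v hf
  by_cases huv : u = v
  · subst huv; exact rho_self _ _
  · exact h u v huv hf

/-- Theorem S -/
theorem thmS (hG : Good V d) {θ : Finset E} (hθ : Fc V d θ) (hc : θ.card + 3 ≤ d)
    {m : E → Module.Dual ℝ E} (hodd : ∀ x ∈ Wt V d θ, m (-x) = - m x)
    (hm : ∀ x ∈ Wt V d θ, ∀ y ∈ Wt V d θ, x ≠ y → Fc V d (insert x (insert y θ)) →
      Fc V d (insert (-x) (insert (-y) θ)) → rho m x y = 0) :
    ∃ B : E →ₗ[ℝ] E →ₗ[ℝ] ℝ, (∀ x, B x x = 0) ∧ ∀ x ∈ Wt V d θ, m x = B x := by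
  have hS := hG.S
  set M : E → Module.Dual ℝ E := fun x => if x ∈ Wt V d θ then m x else 0 with hM
  have hMW : ∀ x ∈ Wt V d θ, M x = m x := fun x hx => by simp [hM, hx]
  obtain ⟨Y, hY, hY1, hY2⟩ := surjA hS (by have := hG.hd; omega) hG.E
    (fun u v => Fc V d (insert u (insert v θ)) ∧ ¬ Fc V d (insert (-u) (insert (-v) θ)))
    (fun u v h => ⟨h.1.swap2, fun h' => h.2 h'.swap2⟩)
    (fun u v _ h h' => h.2 h'.1) (rho M) (rho_symm M)
  have hmot : Mot V d θ (M - Y) := by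
    refine mot_of_rho fun u v huv hf => ?_
    rw [rho_sub]
    by_cases h' : Fc V d (insert (-u) (insert (-v) θ))
    · obtain ⟨hu, hv⟩ := Wt_both hS hf h'
      rw [hY2 u v huv hf.pair (fun h => h.2 h') (fun h => h.2 (by simpa using hf)),
        rho_congr (hMW u hu) (hMW v hv), hm u hu v hv huv hf h', sub_zero]
    · rw [hY1 u v huv hf.pair ⟨hf, h'⟩, sub_self]
  obtain ⟨B, b, hB, hb⟩ := rigid hS hθ hc hmot
  refine ⟨B, hB, fun x hx => ?_⟩
  have e1 := hb x (mem_Nb.1 (mem_Wt.1 hx).1).2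
  have e2 := hb (-x) (mem_Nb.1 (mem_Wt.1 hx).2).2
  simp only [Pi.sub_apply, hMW x hx, hMW (-x) (Wt_neg hx), hodd x hx, hY, map_neg] at e1 e2
  ext y
  have f1 := congrArg (fun f : Module.Dual ℝ E => f y) e1
  have f2 := congrArg (fun f : Module.Dual ℝ E => f y) e2
  simp only [LinearMap.add_apply, LinearMap.neg_apply, LinearMap.sub_apply] at f1 f2
  linarith

/-- Lemma M -/
theorem lemM (hG : Good V d) {ζ : Finset E} (hζ : Fc V d ζ) (hc : ζ.card + 3 ≤ d) {x y : E}
    (hxy : Fc V d {x, y}) (hx : Fc V d (insert x ζ)) (hy : Fc V d (insert y ζ)) :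
    Fc V d (insert x (insert y ζ)) ∨ Fc V d (insert (-x) (insert (-y) ζ)) := by
  have hS := hG.S
  by_contra hcon
  push Not at hcon
  have hne : x ≠ y := by
    rintro rfl
    exact hcon.1 (by simpa using hx)
  have hnx : x ≠ -x := fun h => hxy.not_anti hS (v := x) (by simp) (by rw [← h]; simp)
  have hny : y ≠ -y := fun h => hxy.not_anti hS (v := y) (by simp) (by rw [← h]; simp)
  have hnxy : x ≠ -y := fun h => hxy.not_anti hS (v := y) (by simp) (by rw [← h]; simp)
  obtain ⟨Y, hY, hY1, hY2⟩ := surjA hS (by have := hG.hd; omega) hG.E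
    (fun u v => (u = x ∧ v = y) ∨ (u = y ∧ v = x)) (fun u v h => by tauto)
    (fun u v _ h h' => by
      rcases h with ⟨rfl, rfl⟩ | ⟨rfl, rfl⟩ <;> rcases h' with ⟨h1, h2⟩ | ⟨h1, h2⟩
      · exact hnx h1.symm
      · exact hnxy h2.symm
      · exact hnxy h1.symm
      · exact hny h1.symm) (fun _ _ => 1) (fun _ _ => rfl)
  have hmot : Mot V d ζ Y := by
    refine mot_of_rho fun u v huv hf => ?_
    refine hY2 u v huv hf.pair ?_ ?_
    · rintro (⟨rfl, rfl⟩ | ⟨rfl, rfl⟩)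
      · exact hcon.1 hf
      · exact hcon.1 hf.swap2
    · rintro (⟨h1, h2⟩ | ⟨h1, h2⟩)
      · rw [← h1, ← h2, neg_neg, neg_neg] at hcon; exact hcon.2 hf
      · rw [← h1, ← h2, neg_neg, neg_neg] at hcon; exact hcon.2 hf.swap2
  obtain ⟨B, b, hB, hb⟩ := rigid hS hζ hc hmot
  have h1 := rho_field hB (hb x hx) (hb y hy)
  rw [hY1 x y hne hxy (Or.inl ⟨rfl, rfl⟩)] at h1
  norm_num at h1

/-- Free -/
theorem lemFree (hG : Good V d) {τ : Finset E} (hW : Wt V d τ = ∅) (b : E → E → ℝ)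
    (hsym : ∀ u v, b u v = b v u) : ∃ m : E → Module.Dual ℝ E,
      ∀ u v, u ≠ v → Fc V d (insert u (insert v τ)) → rho m u v = b u v := by
  obtain ⟨Y, hY, hY1, hY2⟩ := surjA hG.S (by have := hG.hd; omega) hG.E
    (fun u v => Fc V d (insert u (insert v τ))) (fun u v h => h.swap2)
    (fun u v _ h h' => by have := (Wt_both hG.S h h').1; rw [hW] at this; simp at this) b hsym
  exact ⟨Y, fun u v huv h => hY1 u v huv h.pair h⟩

/-- Lemma G -/
theorem lemG (hG : Good V d) {τ : Finset E} (hW : Wt V d τ = ∅) {θ1 θ2 : Finset E} (h1 : τ ⊆ θ1)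
    (h2 : τ ⊆ θ2) (hf1 : Fc V d θ1) (hf2 : Fc V d θ2) (hc1 : θ1.card + 3 ≤ d) (hc2 : θ2.card + 3 ≤ d)
    (f : E → Module.Dual ℝ E)
    (hf : ∀ u v, u ≠ v → Fc V d (insert u (insert v θ1)) → Fc V d (insert u (insert v θ2)) → rho f u v = 0) :
    ∃ (B : E →ₗ[ℝ] E →ₗ[ℝ] ℝ) (b : Module.Dual ℝ E), (∀ x, B x x = 0) ∧
      ∀ v, Fc V d (insert v θ1) → Fc V d (insert v θ2) → f v = B v + b := by
  obtain ⟨Y, hY⟩ := lemFree hG hW (fun u v => if Fc V d (insert u (insert v θ1)) then rho f u v else 0)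
    (fun u v => by rw [rho_symm, Finset.insert_comm])
  have hm : ∀ {θ : Finset E} (h : τ ⊆ θ) {u v : E}, Fc V d (insert u (insert v θ)) →
      Fc V d (insert u (insert v τ)) := fun h u v hf =>
    hf.mono (Finset.insert_subset_insert _ (Finset.insert_subset_insert _ h))
  obtain ⟨B1, b1, hB1, hb1⟩ := rigid hG.S hf1 hc1 (m := f - Y) (mot_of_rho fun u v huv h => by
    rw [rho_sub, hY u v huv (hm h1 h), if_pos h, sub_self])
  obtain ⟨B2, b2, hB2, hb2⟩ := rigid hG.S hf2 hc2 (m := Y) (mot_of_rho fun u v huv h => by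
    rw [hY u v huv (hm h2 h)]
    split_ifs with h'
    · exact hf u v huv h' h
    · rfl)
  refine ⟨B1 + B2, b1 + b2, fun x => by simp [hB1, hB2], fun v hv1 hv2 => ?_⟩
  have e1 := hb1 v hv1
  have e2 := hb2 v hv2
  rw [Pi.sub_apply, sub_eq_iff_eq_add] at e1
  rw [e1, e2, LinearMap.add_apply]; abel

theorem exists_dual_of_span {W : Finset E} (h : Submodule.span ℝ (W : Set E) ≠ ⊤) :
    ∃ a : Module.Dual ℝ E, a ≠ 0 ∧ ∀ x ∈ W, a x = 0 := by
  obtain ⟨a, ha, hk⟩ := Submodule.exists_le_ker_of_lt_top _ (lt_top_iff_ne_top.2 h)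
  exact ⟨a, ha, fun x hx => hk (Submodule.subset_span hx)⟩

/-- Nonspanning -/
theorem nonspan (hG : Good V d) {θ : Finset E} (hθ : Fc V d θ) (hc : θ.card + 3 ≤ d)
    (hsp : Submodule.span ℝ (Wt V d θ : Set E) ≠ ⊤) (φ : E → ℝ) (hφ : ∀ x ∈ Wt V d θ, φ (-x) = - φ x) :
    ∃ c : Module.Dual ℝ E, ∀ x ∈ Wt V d θ, c x = φ x := by
  obtain ⟨a, ha, haW⟩ := exists_dual_of_span hsp
  obtain ⟨e, he⟩ : ∃ e, a e ≠ 0 := by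
    by_contra h
    push Not at h
    exact ha (LinearMap.ext h)
  obtain ⟨B, hB, hb⟩ := thmS hG hθ hc (m := fun x => φ x • a)
    (fun x hx => by ext y; simp [hφ x hx])
    (fun x hx y hy _ _ _ => by simp [rho, haW x hx, haW y hy])
  refine ⟨(a e)⁻¹ • B.flip e, fun x hx => ?_⟩
  have := congrArg (fun f : Module.Dual ℝ E => f e) (hb x hx)
  simp only [LinearMap.smul_apply, smul_eq_mul] at this
  rw [LinearMap.smul_apply, LinearMap.flip_apply, ← this, smul_eq_mul]
  field_simp

/-- pin -/
theorem pin (hG : Good V d) {θ : Finset E} (hθ : Fc V d θ) (hc : θ.card + 3 ≤ d) {w : E}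
    (hw : w ∈ Wt V d θ) (c : Module.Dual ℝ E)
    (h : ∀ x ∈ Wt V d θ, x ≠ w → Fc V d (insert w (insert x θ)) → Fc V d (insert (-w) (insert (-x) θ)) →
      c x = c w) : ∀ x ∈ Wt V d θ, c x = 0 := by
  have hS := hG.S
  have hnw : -w ≠ w := fun h => ne_neg_self hS (mem_V_of_Nb (mem_Wt.1 hw).1) (by rw [← neg_eq_iff_add_eq_zero, h])
  set m : E → Module.Dual ℝ E := fun x => if x = w then c else if x = -w then -c else 0 with hm
  have m1 : m w = c := by simp [hm]
  have m2 : m (-w) = -c := by simp [hm, hnw]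
  have m3 : ∀ x, x ≠ w → x ≠ -w → m x = 0 := fun x h1 h2 => by simp [hm, h1, h2]
  have hodd : ∀ x, m (-x) = - m x := by
    intro x
    by_cases h1 : x = w
    · rw [h1, m1, m2]
    · by_cases h2 : x = -w
      · rw [h2, neg_neg, m1, m2, neg_neg]
      · rw [m3 x h1 h2, m3 (-x) (fun h => h2 (by rw [← h, neg_neg])) (fun h => h1 (neg_injective h)), neg_zero]
  have key : ∀ y ∈ Wt V d θ, w ≠ y → Fc V d (insert w (insert y θ)) →
      Fc V d (insert (-w) (insert (-y) θ)) → rho m w y = 0 := by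
    intro y hy hne h1 h2
    have hy2 : y ≠ -w := by
      rintro rfl
      exact h1.not_anti hS (v := w) (by simp) (by simp)
    simp only [rho, m1, m3 y hne.symm hy2, sub_zero, map_sub, h y hy hne.symm h1 h2, sub_self]
  have key2 : ∀ x ∈ Wt V d θ, ∀ y ∈ Wt V d θ, x ≠ y → x = w ∨ x = -w → Fc V d (insert x (insert y θ)) →
      Fc V d (insert (-x) (insert (-y) θ)) → rho m x y = 0 := by
    rintro x hx y hy hne (rfl | rfl) h1 h2
    · exact key y hy hne h1 h2
    · have := key (-y) (Wt_neg hy) (fun h => hne (by rw [h, neg_neg])) (by simpa using h2) (by simpa using h1)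
      rw [← rho_odd hodd] at this
      simpa using this
  obtain ⟨B, hB, hb⟩ := thmS hG hθ hc (m := m) (fun x _ => hodd x) (by
    intro x hx y hy hne h1 h2
    by_cases hx1 : x = w ∨ x = -w
    · exact key2 x hx y hy hne hx1 h1 h2
    · by_cases hy1 : y = w ∨ y = -w
      · rw [rho_symm]; exact key2 y hy x hx hne.symm hy1 h1.swap2 h2.swap2
      · push Not at hx1 hy1
        simp [rho, m3 x hx1.1 hx1.2, m3 y hy1.1 hy1.2])
  have hcw : c = B w := by rw [← hb w hw, m1]
  have c0 : c w = 0 := by rw [hcw, hB]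
  intro x hx
  by_cases h1 : x = w
  · rw [h1, c0]
  by_cases h2 : x = -w
  · rw [h2, map_neg, c0, neg_zero]
  have := hb x hx
  rw [m3 x h1 h2] at this
  rw [hcw, alt_swap hB, ← this]; simp

end CSP

namespace CSP

variable {E : Type} [AddCommGroup E] [Module ℝ E] [FiniteDimensional ℝ E]
variable {V : Finset E} {d : ℕ}

/-- antisymmetric matrices -/
def AltS (d : ℕ) : Submodule ℝ (Fin d → Fin d → ℝ) where
  carrier := {a | ∀ i j, a i j = - a j i}
  add_mem' := fun {a b} ha hb i j => by
    have h1 := ha i j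
    have h2 := hb i j
    simp only [Pi.add_apply, h1, h2]; ring
  zero_mem' := fun i j => by simp
  smul_mem' := fun c a ha i j => by
    have h1 := ha i j
    simp only [Pi.smul_apply, h1, smul_eq_mul]; ring

theorem finrank_AltS (d : ℕ) : Module.finrank ℝ (AltS d) ≤ d.choose 2 := by
  let T := {p : Fin d × Fin d // p.1 < p.2}
  let Φ : AltS d →ₗ[ℝ] (T → ℝ) :=
    { toFun := fun B p => B.1 p.1.1 p.1.2
      map_add' := fun B B' => by ext p; simp
      map_smul' := fun c B => by ext p; simp }
  have hinj : Function.Injective Φ := by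
    rw [← LinearMap.ker_eq_bot, LinearMap.ker_eq_bot']
    rintro ⟨B, hB⟩ h
    have h1 : ∀ i j, i < j → B i j = 0 := fun i j hij => congrFun h ⟨(i, j), hij⟩
    have h2 : ∀ i j, B i j = 0 := by
      intro i j
      rcases lt_trichotomy i j with hij | hij | hij
      · exact h1 i j hij
      · have := hB i j
        rw [hij] at this ⊢; linarith
      · rw [hB, h1 j i hij, neg_zero]
    have : B = 0 := by ext i j; simp [h2]
    exact Subtype.ext this
  have h1 := LinearMap.finrank_le_finrank_of_injective hinj
  have h2 : Fintype.card T ≤ d.choose 2 := by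
    have : Fintype.card T ≤ (Finset.powersetCard 2 (Finset.univ : Finset (Fin d))).card := by
      rw [← Finset.card_univ]
      refine Finset.card_le_card_of_injOn (fun p => {p.1.1, p.1.2}) ?_ ?_
      · rintro ⟨⟨i, j⟩, hij⟩ _
        simp only [Finset.mem_coe, Finset.mem_powersetCard, Finset.subset_univ, true_and]
        exact Finset.card_pair (ne_of_lt hij)
      · rintro ⟨⟨i, j⟩, hij⟩ _ ⟨⟨k, l⟩, hkl⟩ _ h
        simp only at h hij hkl
        have hi : i ∈ ({k, l} : Finset (Fin d)) := by rw [← h]; simp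
        have hj : j ∈ ({k, l} : Finset (Fin d)) := by rw [← h]; simp
        simp only [Finset.mem_insert, Finset.mem_singleton] at hi hj
        have : i = k ∧ j = l := by
          rcases hi with rfl | rfl <;> rcases hj with rfl | rfl
          · exact absurd hij (lt_irrefl _)
          · exact ⟨rfl, rfl⟩
          · exact absurd hij (not_lt.2 hkl.le)
          · exact absurd hij (lt_irrefl _)
        simp [this.1, this.2]
    simpa using this
  rw [Module.finrank_fintype_fun_eq_card] at h1
  omega

/-- the symmetric edges in the link -/
def EWp (V : Finset E) (d : ℕ) (θ : Finset E) (φ : Module.Dual ℝ E) : Finset (E × E) :=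
  (Wt V d θ ×ˢ Wt V d θ).filter (fun p => p.1 ≠ p.2 ∧ Fc V d (insert p.1 (insert p.2 θ)) ∧
    Fc V d (insert (-p.1) (insert (-p.2) θ)) ∧ 0 < φ (p.1 + p.2) ∧ 0 < φ (p.2 - p.1))

theorem mem_EWp {θ : Finset E} {φ : Module.Dual ℝ E} {x y : E} : (x, y) ∈ EWp V d θ φ ↔
    (x ∈ Wt V d θ ∧ y ∈ Wt V d θ) ∧ x ≠ y ∧ Fc V d (insert x (insert y θ)) ∧
    Fc V d (insert (-x) (insert (-y) θ)) ∧ 0 < φ (x + y) ∧ 0 < φ (y - x) := by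
  simp [EWp]

theorem Wt_V {θ : Finset E} {x : E} (h : x ∈ Wt V d θ) : x ∈ V := mem_V_of_Nb (mem_Wt.1 h).1

theorem Wt_notMem {θ : Finset E} {x : E} (h : x ∈ Wt V d θ) : x ∉ θ := (mem_Nb.1 (mem_Wt.1 h).1).1

theorem Wt_notMem' {θ : Finset E} {x : E} (h : x ∈ Wt V d θ) : -x ∉ θ := (mem_Nb.1 (mem_Wt.1 h).2).1

theorem count1 (hG : Good V d) {θ : Finset E} (hθ : Fc V d θ) (hc : θ.card + 3 ≤ d)
    {φ : Module.Dual ℝ E} (hφ : ∀ u ∈ V, ∀ v ∈ V, u + v ≠ 0 → φ (u + v) ≠ 0) :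
    ((Wt V d θ).filter (fun v => 0 < φ v)).card * d ≤ (EWp V d θ φ).card + d.choose 2 := by
  have hS := hG.S
  set Wp := (Wt V d θ).filter (fun v => 0 < φ v) with hWp
  have hneg : ∀ v ∈ Wp, -v ∉ Wp := by
    intro v hv h
    simp only [hWp, Finset.mem_filter, map_neg] at hv h
    linarith [hv.2, h.2]
  let L : ({v // v ∈ Wp} → Module.Dual ℝ E) →ₗ[ℝ] ({p // p ∈ EWp V d θ φ} → ℝ) :=
    { toFun := fun m p => rho (ex Wp (-1) m) p.1.1 p.1.2
      map_add' := fun m m' => by ext p; simp only [map_add, rho_add, Pi.add_apply]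
      map_smul' := fun c m => by
        ext p; simp only [map_smul, rho_smul, Pi.smul_apply, RingHom.id_apply, smul_eq_mul] }
  let e := Module.finBasisOfFinrankEq ℝ E hS.fr
  let C : AltS d →ₗ[ℝ] ({v // v ∈ Wp} → Module.Dual ℝ E) :=
    { toFun := fun a x => ∑ i, ∑ j, (e.coord i x.1 * a.1 i j) • e.coord j
      map_add' := fun a b => by
        ext p
        simp [mul_add, add_mul, Finset.sum_add_distrib, add_smul]
      map_smul' := fun c a => by
        ext p
        simp [Finset.mul_sum, mul_assoc, mul_left_comm] }
  have hod : ∀ m v, ex Wp (-1) m (-v) = - ex Wp (-1) m v := fun m v => by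
    rw [ex_neg (by norm_num) hneg]; ext y; simp
  have hker : ∀ m, L m = 0 → ∃ k, C k = m := by
    intro m hm
    have h0 : ∀ u v, (u, v) ∈ EWp V d θ φ → rho (ex Wp (-1) m) u v = 0 := fun u v h => congrFun hm ⟨(u, v), h⟩
    obtain ⟨B, hB, hb⟩ := thmS hG hθ hc (m := ex Wp (-1) m) (fun x _ => hod m x) (by
      have s1 : ∀ x ∈ Wt V d θ, ∀ y ∈ Wt V d θ, x ≠ y → Fc V d (insert x (insert y θ)) →
          Fc V d (insert (-x) (insert (-y) θ)) → 0 < φ (x + y) → rho (ex Wp (-1) m) x y = 0 := by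
        intro x hx y hy hne h1 h2 h3
        have h4 : φ (y - x) ≠ 0 := by
          rw [sub_eq_add_neg]
          refine hφ y (Wt_V hy) (-x) (Wt_V (Wt_neg hx)) fun h => hne ?_
          rw [← sub_eq_add_neg, sub_eq_zero] at h; exact h.symm
        rcases lt_or_gt_of_ne h4 with h5 | h5
        · rw [rho_symm]
          refine h0 y x (mem_EWp.2 ⟨⟨hy, hx⟩, hne.symm, h1.swap2, h2.swap2, by rwa [add_comm], ?_⟩)
          rw [← neg_sub, map_neg]; linarith
        · exact h0 x y (mem_EWp.2 ⟨⟨hx, hy⟩, hne, h1, h2, h3, h5⟩)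
      intro x hx y hy hne h1 h2
      have h4 : φ (x + y) ≠ 0 := by
        refine hφ x (Wt_V hx) y (Wt_V hy) fun h => ?_
        exact h1.not_anti hS (v := x) (by simp) (by simp [neg_eq_of_add_eq_zero_right h])
      rcases lt_or_gt_of_ne h4 with h5 | h5
      · rw [← rho_odd (hod m)]
        refine s1 (-x) (Wt_neg hx) (-y) (Wt_neg hy) (fun h => hne (neg_injective h)) h2 (by simpa using h1) ?_
        rw [← neg_add, map_neg]; linarith
      · exact s1 x hx y hy hne h1 h2 h5)
    refine ⟨⟨fun i j => B (e i) (e j), fun i j => alt_swap hB _ _⟩, ?_⟩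
    ext1 ⟨v, hv⟩
    have := hb v (Finset.mem_filter.1 hv).1
    rw [ex_mem m hv] at this
    rw [this]
    show ∑ i, ∑ j, (e.coord i v * B (e i) (e j)) • e.coord j = B v
    ext y
    conv_rhs => rw [← e.sum_repr v, ← e.sum_repr y]
    simp only [map_sum, LinearMap.sum_apply, LinearMap.smul_apply, map_smul, smul_eq_mul,
      Module.Basis.coord_apply]
    rw [Finset.sum_comm]
    refine Finset.sum_congr rfl fun i _ => ?_
    rw [Finset.mul_sum]
    refine Finset.sum_congr rfl fun j _ => ?_
    ring
  have hrk := surj_of_ker L C hker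
  have hd1 : Module.finrank ℝ (Module.Dual ℝ E) = d := by rw [Subspace.dual_finrank_eq, hS.fr]
  have hd2 : Module.finrank ℝ ({v // v ∈ Wp} → Module.Dual ℝ E) = Wp.card * d := by
    rw [Module.finrank_pi_fintype]; simp [hd1]
  have hd3 : Module.finrank ℝ ({p // p ∈ EWp V d θ φ} → ℝ) = (EWp V d θ φ).card := by simp
  have hle := Submodule.finrank_le (LinearMap.range L)
  have := finrank_AltS d
  omega

theorem count2 (hG : Good V d) {θ : Finset E} (hθ : Fc V d θ) (hne : θ.Nonempty)
    {φ : Module.Dual ℝ E} (hφ : ∀ v ∈ V, φ v ≠ 0) :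
    (EWp V d θ φ).card + θ.card * (Wt V d θ).card ≤
      ((Wt V d θ).filter (fun v => 0 < φ v)).card * d + (θ.card - 1) * d := by
  have hS := hG.S
  obtain ⟨t0, ht0⟩ := hne
  set Wp := (Wt V d θ).filter (fun v => 0 < φ v) with hWp
  have hneg : ∀ v ∈ Wp, -v ∉ Wp := by
    intro v hv h
    simp only [hWp, Finset.mem_filter, map_neg] at hv h
    linarith [hv.2, h.2]
  set Q := EWp V d θ φ ∪ θ ×ˢ (Wt V d θ) with hQ
  have hQc : Q.card = (EWp V d θ φ).card + θ.card * (Wt V d θ).card := by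
    rw [hQ, Finset.card_union_of_disjoint, Finset.card_product]
    rw [Finset.disjoint_left]
    rintro ⟨x, y⟩ h1 h2
    exact Wt_notMem (mem_EWp.1 h1).1.1 (Finset.mem_product.1 h2).1
  have hQm : ∀ u v, (u, v) ∈ Q ↔ (u, v) ∈ EWp V d θ φ ∨ (u ∈ θ ∧ v ∈ Wt V d θ) := by
    intro u v; simp [hQ]
  have hθn : ∀ t ∈ θ, -t ∉ θ := fun t h h' => hθ.not_anti hS h h'
  have hQ0 : ∀ u v, (u, v) ∈ Q → u ≠ v ∧ Fc V d {u, v} := by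
    intro u v h
    rcases (hQm u v).1 h with h | ⟨h1, h2⟩
    · have := mem_EWp.1 h
      exact ⟨this.2.1, this.2.2.1.pair⟩
    · refine ⟨fun h => Wt_notMem h2 (h ▸ h1), (mem_Nb.1 (mem_Wt.1 h2).1).2.mono ?_⟩
      intro z hz
      simp only [Finset.mem_insert, Finset.mem_singleton] at hz ⊢
      rcases hz with rfl | rfl
      · exact Or.inr h1
      · exact Or.inl rfl
  let N : ({v // v ∈ Wp} → Module.Dual ℝ E) × ({v // v ∈ θ.erase t0} → Module.Dual ℝ E) →ₗ[ℝ]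
      (E → Module.Dual ℝ E) := LinearMap.coprod (ex Wp 1) (ex (θ.erase t0) 0)
  let L : ({v // v ∈ Wp} → Module.Dual ℝ E) × ({v // v ∈ θ.erase t0} → Module.Dual ℝ E) →ₗ[ℝ]
      ({p // p ∈ Q} → ℝ) :=
    { toFun := fun m p => rho (N m) p.1.1 p.1.2
      map_add' := fun m m' => by ext p; simp only [map_add, rho_add, Pi.add_apply]
      map_smul' := fun c m => by
        ext p; simp only [map_smul, rho_smul, Pi.smul_apply, RingHom.id_apply, smul_eq_mul] }
  have hsurj : LinearMap.range L = ⊤ := by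
    rw [LinearMap.range_eq_top]
    intro b
    obtain ⟨Y, hY, hYb⟩ := surjQ hS (by have := hG.hd; omega) hG.E Q hQ0
      (by
        intro u v h h'
        rcases (hQm u v).1 h with h1 | h1 <;> rcases (hQm v u).1 h' with h2 | h2
        · have a1 := (mem_EWp.1 h1).2.2.2.2.2
          have a2 := (mem_EWp.1 h2).2.2.2.2.2
          simp only [map_sub] at a1 a2; linarith
        · exact Wt_notMem (mem_EWp.1 h1).1.2 h2.1
        · exact Wt_notMem (mem_EWp.1 h2).1.2 h1.1
        · exact Wt_notMem h1.2 h2.1)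
      (by
        intro u v h h'
        rcases (hQm u v).1 h with h1 | h1 <;> rcases (hQm _ _).1 h' with h2 | h2
        · have a1 := (mem_EWp.1 h1).2.2.2.2.1
          have a2 := (mem_EWp.1 h2).2.2.2.2.1
          simp only [map_add, map_neg] at a1 a2; linarith
        · exact Wt_notMem' (mem_EWp.1 h1).1.1 h2.1
        · exact Wt_notMem (Wt_neg (mem_EWp.1 h2).1.1) (by simpa using h1.1)
        · exact hθn u h1.1 h2.1)
      (by
        intro u v h h'
        rcases (hQm u v).1 h with h1 | h1 <;> rcases (hQm _ _).1 h' with h2 | h2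
        · have a1 := (mem_EWp.1 h1).2.2.2.2.1
          have a2 := (mem_EWp.1 h2).2.2.2.2.1
          simp only [map_add, map_neg] at a1 a2; linarith
        · exact Wt_notMem' (mem_EWp.1 h1).1.2 h2.1
        · exact Wt_notMem (Wt_neg (mem_EWp.1 h2).1.2) (by simpa using h1.1)
        · exact Wt_notMem' h1.2 h2.1) (fun p => if h : p ∈ Q then b ⟨p, h⟩ else 0)
    refine ⟨(fun x => Y x - Y t0, fun t => Y t - Y t0), ?_⟩
    set m : {v // v ∈ Wp} → Module.Dual ℝ E := fun x => Y x - Y t0 with hm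
    set n : {v // v ∈ θ.erase t0} → Module.Dual ℝ E := fun x => Y x - Y t0 with hn
    have hNv : ∀ z, z ∈ Wt V d θ ∨ z ∈ θ → N (m, n) z = Y z - Y t0 := by
      intro z hz
      show ex Wp 1 m z + ex (θ.erase t0) 0 n z = _
      rcases hz with hz | hz
      · rw [ex_out n (fun h => Wt_notMem hz (Finset.mem_of_mem_erase h))
          (fun h => Wt_notMem' hz (Finset.mem_of_mem_erase h)), add_zero]
        rcases lt_or_gt_of_ne (hφ z (Wt_V hz)) with h | h
        · have hz' : -z ∈ Wp := Finset.mem_filter.2 ⟨Wt_neg hz, by rw [map_neg]; linarith⟩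
          have := ex_neg (ε := 1) (by norm_num) hneg m (-z)
          rw [neg_neg, one_smul, ex_mem m hz'] at this
          rw [this, hm]
          simp only [hY]
        · rw [ex_mem m (Finset.mem_filter.2 ⟨hz, h⟩)]
      · have hz1 : z ∉ Wp := fun h => Wt_notMem (Finset.mem_filter.1 h).1 hz
        have hz2 : -z ∉ Wp := fun h => Wt_notMem' (Finset.mem_filter.1 h).1 (by simpa using hz)
        rw [ex_out m hz1 hz2, zero_add]
        by_cases h : z = t0
        · subst h
          rw [ex_out n (by simp) (fun h => hθn z hz (Finset.mem_of_mem_erase h)), sub_self]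
        · rw [ex_mem n (Finset.mem_erase.2 ⟨h, hz⟩)]
    ext1 ⟨⟨u, v⟩, hp⟩
    show rho (N (m, n)) u v = _
    have huv : (u ∈ Wt V d θ ∨ u ∈ θ) ∧ (v ∈ Wt V d θ ∨ v ∈ θ) := by
      rcases (hQm u v).1 hp with h | h
      · exact ⟨Or.inl (mem_EWp.1 h).1.1, Or.inl (mem_EWp.1 h).1.2⟩
      · exact ⟨Or.inr h.1, Or.inl h.2⟩
    have e := hYb u v hp
    rw [dif_pos hp] at e
    rw [← e]
    simp only [rho, hNv u huv.1, hNv v huv.2, sub_sub_sub_cancel_right]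
  have hle := LinearMap.finrank_range_le L
  rw [hsurj, finrank_top] at hle
  have hd1 : Module.finrank ℝ (Module.Dual ℝ E) = d := by rw [Subspace.dual_finrank_eq, hS.fr]
  have hd2 : Module.finrank ℝ ({v // v ∈ Wp} → Module.Dual ℝ E) = Wp.card * d := by
    rw [Module.finrank_pi_fintype]; simp [hd1]
  have hd3 : Module.finrank ℝ ({v // v ∈ θ.erase t0} → Module.Dual ℝ E) = (θ.card - 1) * d := by
    rw [Module.finrank_pi_fintype]
    simp only [hd1, Finset.sum_const, Finset.card_univ, Fintype.card_coe, smul_eq_mul,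
      Finset.card_erase_of_mem ht0]
  have hd4 : Module.finrank ℝ ({p // p ∈ Q} → ℝ) = Q.card := by simp
  rw [Module.finrank_prod, hd2, hd3, hd4] at hle
  omega

theorem count (hG : Good V d) {θ : Finset E} (hθ : Fc V d θ) (hc : θ.card + 3 ≤ d) (hne : θ.Nonempty) :
    2 * (θ.card * (Wt V d θ).card) + 2 * d ≤ d * (d - 1) + 2 * (θ.card * d) := by
  obtain ⟨φ, hφ⟩ := exists_gen V
  have hφ0 : ∀ v ∈ V, φ v ≠ 0 := fun v hv h => hφ v hv v hv (ne_neg_self hG.S hv) (by simp [h])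
  have h1 := count1 hG hθ hc hφ
  have h2 := count2 hG hθ hne hφ0
  have h3 : 2 * d.choose 2 = d * (d - 1) := by
    rw [Nat.choose_two_right]
    exact Nat.mul_div_cancel' (Nat.even_mul_pred_self d).two_dvd
  have h4 : (θ.card - 1) * d + d = θ.card * d := by
    have := Finset.card_pos.2 hne
    rw [← Nat.succ_mul]; congr 1; omega
  omega

/-- Lemma N -/
theorem lemN (hG : Good V d) {θ : Finset E} (hθ : Fc V d θ) (hc : θ.card + 3 ≤ d) (hc' : d ≤ θ.card + 4)
    {w : E} (hw : w ∈ Wt V d θ) : (Wt V d (insert w θ)).Nonempty := by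
  have hS := hG.S
  have hd := hG.hd
  by_contra hcon
  rw [Finset.not_nonempty_iff_eq_empty] at hcon
  set N := (Wt V d θ).filter (fun x => x ≠ w ∧ Fc V d (insert w (insert x θ)) ∧
    Fc V d (insert (-w) (insert (-x) θ))) with hN
  have hNm : ∀ x, x ∈ N ↔ x ∈ Wt V d θ ∧ x ≠ w ∧ Fc V d (insert w (insert x θ)) ∧
    Fc V d (insert (-w) (insert (-x) θ)) := fun x => by rw [hN, Finset.mem_filter]
  have hNn : ∀ x ∈ N, -x ∉ N := by
    intro x hx hx'
    have h1 := ((hNm x).1 hx).2.2.1.swap2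
    have h2 := ((hNm (-x)).1 hx').2.2.1.swap2
    have := mem_Wt_of hS h1 h2
    rw [hcon] at this; simp at this
  have hwN : w ∉ N := fun h => ((hNm w).1 h).2.1 rfl
  have hwN' : -w ∉ N := fun h =>
    ((hNm _).1 h).2.2.1.not_anti hS (v := w) (by simp) (by simp)
  have hnw : -w ≠ w := fun h => ne_neg_self hS (Wt_V hw) (by rw [← neg_eq_iff_add_eq_zero, h])
  have hpin : ∀ c : Module.Dual ℝ E, (∀ x ∈ N, c x = c w) → ∀ x ∈ Wt V d θ, c x = 0 := fun c h =>
    pin hG hθ hc hw c fun x hx hne h1 h2 => h x ((hNm x).2 ⟨hx, hne, h1, h2⟩)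
  by_cases hsp : Submodule.span ℝ (Wt V d θ : Set E) = ⊤
  · have hND : d ≤ N.card := by
      by_contra hlt
      push Not at hlt
      obtain ⟨c, hc0, hcz⟩ := exists_dual_of_span (W := N.image (fun x => x - w)) (by
        intro h
        have h1 := finrank_span_finset_le_card (R := ℝ) (N.image (fun x => x - w))
        unfold Set.finrank at h1
        rw [h, finrank_top, hS.fr] at h1
        have := Finset.card_image_le (s := N) (f := fun x => x - w)
        omega)
      have hz := hpin c (fun x hx => by
        have := hcz (x - w) (Finset.mem_image_of_mem _ hx)
        rw [map_sub] at this; linarith)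
      apply hc0
      ext y
      have : y ∈ Submodule.span ℝ (Wt V d θ : Set E) := by rw [hsp]; trivial
      have hle : Submodule.span ℝ (Wt V d θ : Set E) ≤ LinearMap.ker c :=
        Submodule.span_le.2 fun x hx => hz x hx
      exact hle this
    have hWc : 2 * d + 2 ≤ (Wt V d θ).card := by
      have h1 : ((N ∪ N.image (fun x => -x)) ∪ {w, -w}).card = 2 * N.card + 2 := by
        rw [Finset.card_union_of_disjoint, Finset.card_union_of_disjoint,
          Finset.card_image_of_injective _ neg_injective, Finset.card_pair hnw.symm]
        · ring
        · rw [Finset.disjoint_left]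
          intro x hx hx'
          obtain ⟨y, hy, rfl⟩ := Finset.mem_image.1 hx'
          exact hNn y hy hx
        · rw [Finset.disjoint_left]
          intro x hx hx'
          simp only [Finset.mem_insert, Finset.mem_singleton] at hx'
          rcases Finset.mem_union.1 hx with h | h
          · rcases hx' with rfl | rfl
            · exact hwN h
            · exact hwN' h
          · obtain ⟨y, hy, rfl⟩ := Finset.mem_image.1 h
            rcases hx' with h' | h'
            · exact hwN' (by rw [← h', neg_neg]; exact hy)
            · exact hwN (by rw [← neg_injective h']; exact hy)
      have h2 : ((N ∪ N.image (fun x => -x)) ∪ {w, -w}) ⊆ Wt V d θ := by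
        intro x hx
        simp only [Finset.mem_union, Finset.mem_image, Finset.mem_insert, Finset.mem_singleton] at hx
        rcases hx with (h | ⟨y, hy, rfl⟩) | rfl | rfl
        · exact ((hNm x).1 h).1
        · exact Wt_neg ((hNm y).1 hy).1
        · exact hw
        · exact Wt_neg hw
      have := Finset.card_le_card h2
      omega
    have hct := count hG hθ hc (Finset.card_pos.1 (by omega))
    have : θ.card * (2 * d + 2) ≤ θ.card * (Wt V d θ).card := Nat.mul_le_mul_left _ hWc
    obtain ⟨q, hq⟩ : ∃ q, q = θ.card := ⟨_, rfl⟩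
    rw [← hq] at hct this hc hc'
    have hq1 : 1 ≤ q := by omega
    obtain ⟨e, rfl⟩ : ∃ e, d = e + 1 := ⟨d - 1, by omega⟩
    simp only [Nat.add_sub_cancel] at hct
    nlinarith
  · obtain ⟨c, hcφ⟩ := nonspan hG hθ hc hsp (fun x => if x = w ∨ x ∈ N then 1 else
      if -x = w ∨ -x ∈ N then -1 else 0) (by
        intro x hx
        by_cases h1 : x = w ∨ x ∈ N
        · have h2 : ¬ (-x = w ∨ -x ∈ N) := by
            rintro (h | h)
            · rcases h1 with h1 | h1
              · exact hnw (by rw [← h1]; rw [h, h1])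
              · exact hwN' (by rw [← h, neg_neg]; exact h1)
            · rcases h1 with h1 | h1
              · exact hwN' (by rw [← h1]; exact h)
              · exact hNn x h1 h
          simp only [neg_neg]
          rw [if_neg h2, if_pos h1, if_pos h1]
        · simp only [neg_neg]
          by_cases h2 : -x = w ∨ -x ∈ N
          · rw [if_pos h2, if_neg h1, if_pos h2, neg_neg]
          · rw [if_neg h2, if_neg h1, if_neg h1, if_neg h2, neg_zero])
    have c1 : c w = 1 := by rw [hcφ w hw]; simp
    have := hpin c (fun x hx => by rw [c1, hcφ x ((hNm x).1 hx).1]; simp [hx]) w hw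
    linarith

end CSP

namespace CSP

variable {E : Type} [AddCommGroup E] [Module ℝ E] [FiniteDimensional ℝ E]
variable {V : Finset E} {d : ℕ}

theorem neg_ne (hS : Sys V d) {w : E} (hw : w ∈ V) : -w ≠ w := fun h =>
  ne_neg_self hS hw (by rw [← neg_eq_iff_add_eq_zero, h])

/-- odd motions supported on two antipodal pairs -/
theorem two (hG : Good V d) {θ : Finset E} (hθ : Fc V d θ) (hc : θ.card + 3 ≤ d) {w x : E}
    (hw : w ∈ Wt V d θ) (hx : x ∈ Wt V d θ) (h1 : x ≠ w) (h2 : x ≠ -w) (c1 c2 : Module.Dual ℝ E)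
    (hc1 : ∀ y ∈ Wt V d θ, y ≠ w → y ≠ -w → y ≠ x → y ≠ -x → c1 (w - y) = 0)
    (hc2 : ∀ y ∈ Wt V d θ, y ≠ w → y ≠ -w → y ≠ x → y ≠ -x → c2 (x - y) = 0)
    (hp : Fc V d (insert w (insert x θ)) → Fc V d (insert (-w) (insert (-x) θ)) →
      (c1 - c2) (w - x) = 0)
    (hn : Fc V d (insert w (insert (-x) θ)) → Fc V d (insert (-w) (insert x θ)) →
      (c1 + c2) (w + x) = 0) :
    ∃ B : E →ₗ[ℝ] E →ₗ[ℝ] ℝ, (∀ x, B x x = 0) ∧ B w = c1 ∧ B x = c2 ∧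
      ∀ y ∈ Wt V d θ, y ≠ w → y ≠ -w → y ≠ x → y ≠ -x → B y = 0 := by
  have hS := hG.S
  set U : Finset E := {w, x} with hU
  have hUm : ∀ y, y ∈ U ↔ y = w ∨ y = x := fun y => by simp [hU]
  have hnU : ∀ y ∈ U, -y ∉ U := by
    intro y hy hy'
    rw [hUm] at hy hy'
    rcases hy with rfl | rfl <;> rcases hy' with h | h
    · exact neg_ne hS (Wt_V hw) h
    · exact h2 h.symm
    · exact h2 (by rw [← h, neg_neg])
    · exact neg_ne hS (Wt_V hx) h
  set m : E → Module.Dual ℝ E := ex U (-1) (fun z => if z.1 = w then c1 else c2) with hm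
  have hod : ∀ v, m (-v) = - m v := fun v => by
    rw [hm, ex_neg (by norm_num) hnU]; ext y; simp
  have mw : m w = c1 := by rw [hm, ex_mem _ (by simp [hU])]; simp
  have mx : m x = c2 := by rw [hm, ex_mem _ (by simp [hU])]; simp [h1]
  have m0 : ∀ y, y ∉ U → -y ∉ U → m y = 0 := fun y h h' => ex_out _ h h'
  have out : ∀ y, y ∉ U → -y ∉ U → y ≠ w ∧ y ≠ -w ∧ y ≠ x ∧ y ≠ -x := by
    intro y h h'
    rw [hUm] at h h'
    push Not at h h'
    exact ⟨h.1, fun e => h'.1 (by rw [e, neg_neg]), h.2, fun e => h'.2 (by rw [e, neg_neg])⟩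
  have key : ∀ p ∈ U, ∀ y ∈ Wt V d θ, p ≠ y → Fc V d (insert p (insert y θ)) →
      Fc V d (insert (-p) (insert (-y) θ)) → rho m p y = 0 := by
    intro p hp' y hy hne f1 f2
    have hpy : y ≠ -p := by
      rintro rfl
      exact f1.not_anti hS (v := p) (by simp) (by simp)
    by_cases hyU : y ∈ U ∨ -y ∈ U
    · rcases (hUm p).1 hp' with rfl | rfl
      · rcases hyU with hyU | hyU <;> rcases (hUm _).1 hyU with e | e
        · exact absurd e.symm hne
        · subst e; rw [rho, mw, mx]; exact hp f1 f2
        · exact absurd (by rw [← e, neg_neg]) hpy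
        · have e' : y = -x := by rw [← e, neg_neg]
          subst e'; rw [rho, mw, hod, mx, sub_neg_eq_add, sub_neg_eq_add]
          exact hn f1 (by simpa using f2)
      · rcases hyU with hyU | hyU <;> rcases (hUm _).1 hyU with e | e
        · subst e; rw [rho_symm, rho, mw, mx]; exact hp f1.swap2 f2.swap2
        · exact absurd e.symm hne
        · have e' : y = -w := by rw [← e, neg_neg]
          subst e'
          have := hn (by simpa using f2.swap2) f1.swap2
          rw [rho, mx, hod, mw, sub_neg_eq_add, sub_neg_eq_add, add_comm c2, add_comm p]
          exact this
        · exact absurd (by rw [← e, neg_neg]) hpy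
    · push Not at hyU
      obtain ⟨a1, a2, a3, a4⟩ := out y hyU.1 hyU.2
      rcases (hUm p).1 hp' with rfl | rfl
      · rw [rho, mw, m0 y hyU.1 hyU.2, sub_zero]; exact hc1 y hy a1 a2 a3 a4
      · rw [rho, mx, m0 y hyU.1 hyU.2, sub_zero]; exact hc2 y hy a1 a2 a3 a4
  have key2 : ∀ p, p ∈ U ∨ -p ∈ U → ∀ y ∈ Wt V d θ, p ≠ y → Fc V d (insert p (insert y θ)) →
      Fc V d (insert (-p) (insert (-y) θ)) → rho m p y = 0 := by
    rintro p (h | h) y hy hne f1 f2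
    · exact key p h y hy hne f1 f2
    · rw [← rho_odd hod]
      exact key (-p) h (-y) (Wt_neg hy) (fun h => hne (neg_injective h)) f2 (by simpa using f1)
  obtain ⟨B, hB, hb⟩ := thmS hG hθ hc (m := m) (fun y _ => hod y) (by
    intro p hp y hy hne f1 f2
    by_cases hpU : p ∈ U ∨ -p ∈ U
    · exact key2 p hpU y hy hne f1 f2
    · by_cases hyU : y ∈ U ∨ -y ∈ U
      · rw [rho_symm]; exact key2 y hyU p hp hne.symm f1.swap2 f2.swap2
      · push Not at hpU hyU
        simp [rho, m0 p hpU.1 hpU.2, m0 y hyU.1 hyU.2])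
  refine ⟨B, hB, by rw [← hb w hw, mw], by rw [← hb x hx, mx], fun y hy a1 a2 a3 a4 => ?_⟩
  rw [← hb y hy]
  refine m0 y (fun h => ?_) (fun h => ?_)
  · rcases (hUm _).1 h with h | h
    · exact a1 h
    · exact a3 h
  · rcases (hUm _).1 h with h | h
    · exact a2 (by rw [← h, neg_neg])
    · exact a4 (by rw [← h, neg_neg])

theorem Wt_insert {θ : Finset E} {w x : E} (hx : x ∈ Wt V d (insert w θ)) : x ≠ w ∧ x ≠ -w := by
  have h1 := Wt_notMem hx
  have h2 := Wt_notMem' hx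
  rw [Finset.mem_insert] at h1 h2
  push Not at h1 h2
  exact ⟨h1.1, fun h => h2.1 (by rw [h, neg_neg])⟩

theorem Wt_face {θ : Finset E} {x : E} (hx : x ∈ Wt V d θ) : Fc V d (insert x θ) :=
  (mem_Nb.1 (mem_Wt.1 hx).1).2

/-- three pairs -/
theorem three (hG : Good V d) {θ : Finset E} (hθ : Fc V d θ) (hc : θ.card + 3 = d)
    (hW : (Wt V d θ).Nonempty) : 6 ≤ (Wt V d θ).card := by
  have hS := hG.S
  obtain ⟨w, hw⟩ := hW
  obtain ⟨x, hx'⟩ := lemN hG hθ hc.le (by omega) hw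
  have hx : x ∈ Wt V d θ := Wt_anti hS (Finset.subset_insert _ _) hx'
  obtain ⟨h1, h2⟩ := Wt_insert hx'
  have hf := (Wt_face hx').pair
  by_contra hlt
  push Not at hlt
  have hnw := neg_ne hS (Wt_V hw)
  have hnx := neg_ne hS (Wt_V hx)
  have hall : ∀ y ∈ Wt V d θ, y ≠ w → y ≠ -w → y ≠ x → y ≠ -x → False := by
    intro y hy a1 a2 a3 a4
    have hny := neg_ne hS (Wt_V hy)
    have hsub : ({w, -w, x, -x, y, -y} : Finset E) ⊆ Wt V d θ := by
      intro z hz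
      simp only [Finset.mem_insert, Finset.mem_singleton] at hz
      rcases hz with rfl | rfl | rfl | rfl | rfl | rfl
      exacts [hw, Wt_neg hw, hx, Wt_neg hx, hy, Wt_neg hy]
    have hcard : ({w, -w, x, -x, y, -y} : Finset E).card = 6 := by
      rw [Finset.card_insert_of_notMem, Finset.card_insert_of_notMem, Finset.card_insert_of_notMem,
        Finset.card_insert_of_notMem, Finset.card_pair hny.symm]
      · simp only [Finset.mem_insert, Finset.mem_singleton, not_or]
        exact ⟨fun h => a4 h.symm, fun h => a3 (neg_injective h).symm⟩
      · simp only [Finset.mem_insert, Finset.mem_singleton, not_or]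
        exact ⟨hnx.symm, fun h => a3 h.symm, fun h => a4 (by rw [h, neg_neg])⟩
      · simp only [Finset.mem_insert, Finset.mem_singleton, not_or]
        exact ⟨fun h => h2 h.symm, fun h => h1 (neg_injective h).symm, fun h => a2 h.symm,
          fun h => a1 (neg_injective h).symm⟩
      · simp only [Finset.mem_insert, Finset.mem_singleton, not_or]
        exact ⟨hnw.symm, fun h => h1 h.symm, fun h => h2 (by rw [h, neg_neg]), fun h => a1 h.symm,
          fun h => a2 (by rw [h, neg_neg])⟩
    have := Finset.card_le_card hsub
    omega
  obtain ⟨F, hF, hsF⟩ := hf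
  have hxF : x ∈ F := hsF (by simp)
  have hwF : w ∈ F := hsF (by simp)
  have e1 : crd F w w = 1 := hF.crd_self hS hwF
  have e2 : crd F x x = 1 := hF.crd_self hS hxF
  have e3 : crd F w x = 0 := hF.crd_ne hS hxF hwF h1
  have e4 : crd F x w = 0 := hF.crd_ne hS hwF hxF h1.symm
  obtain ⟨B, hB, hBw, hBx, _⟩ := two hG hθ hc.le hw hx h1 h2 (crd F w) (-crd F x)
    (fun y hy a1 a2 a3 a4 => (hall y hy a1 a2 a3 a4).elim)
    (fun y hy a1 a2 a3 a4 => (hall y hy a1 a2 a3 a4).elim)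
    (fun _ _ => by simp [e1, e2, e3, e4]) (fun _ _ => by simp [e1, e2, e3, e4])
  have := hB w
  rw [hBw, e1] at this
  exact one_ne_zero this

theorem card_extend (hS : Sys V d) {θ : Finset E} {w : E} (hw : w ∈ Wt V d θ) {k : ℕ}
    (hk : k ≤ (Wt V d (insert w θ)).card) : k + 2 ≤ (Wt V d θ).card := by
  have hsub : insert w (insert (-w) (Wt V d (insert w θ))) ⊆ Wt V d θ := by
    intro z hz
    simp only [Finset.mem_insert] at hz
    rcases hz with rfl | rfl | h
    exacts [hw, Wt_neg hw, Wt_anti hS (Finset.subset_insert _ _) h]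
  have := Finset.card_le_card hsub
  rw [Finset.card_insert_of_notMem, Finset.card_insert_of_notMem] at this
  · omega
  · exact fun h => (Wt_insert h).2 rfl
  · rw [Finset.mem_insert]
    rintro (h | h)
    · exact neg_ne hS (Wt_V hw) h.symm
    · exact (Wt_insert h).1 rfl

/-- four pairs -/
theorem four (hG : Good V d) {τ : Finset E} (hτ : Fc V d τ) (hc : τ.card + 4 = d)
    (hW : (Wt V d τ).Nonempty) : 8 ≤ (Wt V d τ).card := by
  obtain ⟨w, hw⟩ := hW
  have h1 := lemN hG hτ (by omega) (by omega) hw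
  have hwτ := Wt_notMem hw
  have h2 := three hG (Wt_face hw) (by rw [Finset.card_insert_of_notMem hwτ]; omega) h1
  exact card_extend hG.S hw h2

end CSP

namespace CSP
variable {E : Type} [AddCommGroup E] [Module ℝ E] [FiniteDimensional ℝ E]
variable {V : Finset E} {d : ℕ}

/-- No missing facets. -/
def Prm (V : Finset E) (d : ℕ) : Prop :=
  ∀ σ : Finset E, σ.card = d → (∀ x ∈ σ, Fc V d (σ.erase x)) → Fc V d σ

theorem area_exists (hS : Sys V d) {κ : Finset E} (hκ : Fc V d κ) (hc : κ.card + 2 = d)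
    (hd : 3 ≤ d) : ∃ ω, Area κ ω := by
  have hne : κ.Nonempty := by rw [← Finset.card_pos]; omega
  obtain ⟨y, hy⟩ := hne
  have hc3 : (κ.erase y).card + 3 = d := by rw [Finset.card_erase_of_mem hy]; omega
  obtain ⟨T, hT⟩ := vol_exists hS (hκ.mono (Finset.erase_subset y κ)) hc3
  have hyN : y ∈ Nb V d (κ.erase y) := by
    rw [mem_Nb, Finset.insert_erase hy]; exact ⟨Finset.notMem_erase y κ, hκ⟩
  have := hT.area hS hc3 hyN
  rw [Finset.insert_erase hy] at this
  exact ⟨_, this⟩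

/-- Walking around the cycle `lk κ` from `nxt p` to `q`. -/
theorem walk (hS : Sys V d) {κ : Finset E} (hc : κ.card + 2 = d) {ω : E →ₗ[ℝ] E →ₗ[ℝ] ℝ}
    (h : Area κ ω) {p : E} (hp : p ∈ Nb V d κ) {X : Type*} (T : E → X)
    (bad : E → Prop) (hbp : bad p)
    (hback : ∀ x ∈ Nb V d κ, bad x → ¬ bad (nxt V d κ ω x) → x = p)
    (hst : ¬ bad (nxt V d κ ω p))
    (hT : ∀ x ∈ Nb V d κ, ¬ bad x → ¬ bad (nxt V d κ ω x) → T x = T (nxt V d κ ω x)) :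
    ∃ y ∈ Nb V d κ, ¬ bad y ∧ bad (nxt V d κ ω y) ∧ T y = T (nxt V d κ ω p) := by
  by_contra hcon
  push Not at hcon
  set S := (Nb V d κ).filter (fun x => ¬ bad x ∧ T x = T (nxt V d κ ω p)) with hSdef
  have hmem : ∀ x, x ∈ S ↔ x ∈ Nb V d κ ∧ ¬ bad x ∧ T x = T (nxt V d κ ω p) := by
    intro x; simp [hSdef]
  have hmap : ∀ x ∈ S, nxt V d κ ω x ∈ S := by
    intro x hx
    obtain ⟨hx1, hx2, hx3⟩ := (hmem x).1 hx
    have hb : ¬ bad (nxt V d κ ω x) := fun hb => hcon x hx1 hx2 hb hx3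
    exact (hmem _).2 ⟨nxt_mem hS hc h hx1, hb, by rw [← hT x hx1 hx2 hb, hx3]⟩
  have hinj : Set.InjOn (nxt V d κ ω) (S : Set E) := by
    intro x hx y hy hxy
    have h1 := prv_nxt hS hc h ((hmem x).1 hx).1
    have h2 := prv_nxt hS hc h ((hmem y).1 hy).1
    rw [← h1, ← h2, hxy]
  have himg : S.image (nxt V d κ ω) = S := by
    apply Finset.eq_of_subset_of_card_le
    · intro y hy
      obtain ⟨x, hx, rfl⟩ := Finset.mem_image.1 hy
      exact hmap x hx
    · rw [Finset.card_image_of_injOn hinj]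
  have h1 : nxt V d κ ω p ∈ S := (hmem _).2 ⟨nxt_mem hS hc h hp, hst, rfl⟩
  rw [← himg] at h1
  obtain ⟨x, hx, hxe⟩ := Finset.mem_image.1 h1
  have h3 := prv_nxt hS hc h ((hmem x).1 hx).1
  have h4 := prv_nxt hS hc h hp
  have : x = p := by rw [← h3, ← h4, hxe]
  subst this
  exact ((hmem x).1 hx).2.1 hbp

theorem aff_expand (hS : Sys V d) {F : Finset E} (hF : Fct V d F) {z : E} (hz : nrm F z < 1) (x : E) :
    ∃ c : E → ℝ, ∃ cz : ℝ, ∀ f : Module.Dual ℝ E,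
      1 - f x = cz * (1 - f z) + ∑ w ∈ F, c w * (1 - f w) := by
  set a := (1 - nrm F x) / (1 - nrm F z) with ha
  have hne : 1 - nrm F z ≠ 0 := by linarith
  refine ⟨fun w => crd F w (x - a • z), a, fun f => ?_⟩
  have e1 := hF.map_expand hS f (x - a • z)
  have e2 := hF.map_expand hS (nrm F) (x - a • z)
  simp only [smul_eq_mul] at e1 e2
  have e3 : ∑ w ∈ F, crd F w (x - a • z) * nrm F w = ∑ w ∈ F, crd F w (x - a • z) := by
    apply Finset.sum_congr rfl
    intro w hw
    rw [hF.nrm_mem hS hw, mul_one]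
  rw [e3] at e2
  have e4 : a * (1 - nrm F z) = 1 - nrm F x := by rw [ha]; field_simp
  simp only [mul_sub, mul_one, Finset.sum_sub_distrib]
  rw [← e1, ← e2]
  simp only [map_sub, map_smul, smul_eq_mul]
  linarith

theorem sepA (hS : Sys V d) {A μ : Finset E} (hμ : μ ⊆ A) (hne : μ.Nonempty)
    (hf : ∀ m ∈ μ, Fc V d (A.erase m)) (hA : ¬ Fc V d A) {a : E → ℝ} {u u' : E} {α α' : ℝ} (hα : 0 < α)
    (hα' : 0 < α')
    (hsum : ∀ f : Module.Dual ℝ E, α * (1 - f u) + α' * (1 - f u') = ∑ r ∈ A, a r * (1 - f r))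
    {G : Finset E} (hG : Fct V d G) (hτ : ∀ r ∈ A, r ∉ μ → r ∈ G) (hu : u ∈ G) (hu' : u' ∈ G)
    (hAV : A ⊆ V) : u ∈ A := by
  by_contra hcon
  have hpos : ∀ m ∈ μ, 0 < a m := by
    intro m hm
    obtain ⟨f, hf1, hf2⟩ := expose hS (hf m hm)
    have h := hsum f
    have e : ∑ r ∈ A, a r * (1 - f r) = a m * (1 - f m) := by
      apply Finset.sum_eq_single_of_mem m (hμ hm)
      intro r hr hrm
      rw [hf1 r (Finset.mem_erase.2 ⟨hrm, hr⟩)]; ring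
    rw [e] at h
    have h1 : f m < 1 := hf2 m (hAV (hμ hm)) (Finset.notMem_erase m A)
    have h2 : f u < 1 := hf2 u (hG.sub hu) (fun hh => hcon (Finset.mem_of_mem_erase hh))
    have h3 : f u' ≤ 1 := by
      by_cases hh : u' ∈ A.erase m
      · exact (hf1 u' hh).le
      · exact (hf2 u' (hG.sub hu') hh).le
    have h4 : 0 < a m * (1 - f m) := by
      rw [← h]
      have := mul_pos hα (sub_pos.2 h2)
      have := mul_nonneg hα'.le (sub_nonneg.2 h3)
      linarith
    by_contra h5
    have := mul_nonneg (neg_nonneg.2 (not_lt.1 h5)) (sub_pos.2 h1).le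
    linarith
  have h := hsum (nrm G)
  rw [hG.nrm_mem hS hu, hG.nrm_mem hS hu'] at h
  have hnn : ∀ r ∈ A, 0 ≤ a r * (1 - nrm G r) := by
    intro r hr
    by_cases hrm : r ∈ μ
    · exact mul_nonneg (hpos r hrm).le (sub_nonneg.2 (hG.nrm_le hS (hAV hr)))
    · rw [hG.nrm_mem hS (hτ r hr hrm)]; simp
  have h0 : ∑ r ∈ A, a r * (1 - nrm G r) = 0 := by rw [← h]; ring
  rw [Finset.sum_eq_zero_iff_of_nonneg hnn] at h0
  apply hA
  refine hG.fc.mono ?_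
  intro r hr
  by_cases hrm : r ∈ μ
  · have := h0 r hr
    rcases mul_eq_zero.1 this with h1 | h1
    · exact absurd h1 (hpos r hrm).ne'
    · exact hG.mem_of_nrm hS (hAV hr) (by linarith)
  · exact hτ r hr hrm

set_option maxHeartbeats 1600000 in
theorem claimA (hG : Good V d) (hpr : Prm V d) {τ A : Finset E} (hτA : τ ⊆ A) (hc : τ.card + 4 = d)
    (hAc : A.card = d) (hW : Wt V d τ = ∅) (hf : ∀ m ∈ A, m ∉ τ → Fc V d (A.erase m)) :
    Fc V d A := by
  by_contra hA
  have hS := hG.S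
  have hd := hG.hd
  obtain ⟨w, hwA, hAw⟩ : ∃ w ∈ A, ¬ Fc V d (A.erase w) := by
    by_contra hh; push Not at hh; exact hA (hpr A hAc hh)
  have hwτ : w ∈ τ := by
    by_contra hh; exact hAw (hf w hwA hh)
  set μ := A \ τ with hμ
  have hμc : μ.card = 4 := by
    rw [hμ, Finset.card_sdiff_of_subset hτA]; omega
  obtain ⟨z, hz⟩ : μ.Nonempty := by rw [← Finset.card_pos]; omega
  obtain ⟨y, hy⟩ : (μ.erase z).Nonempty := by
    rw [← Finset.card_pos, Finset.card_erase_of_mem hz]; omega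
  have hzA : z ∈ A := (Finset.mem_sdiff.1 hz).1
  have hzτ : z ∉ τ := (Finset.mem_sdiff.1 hz).2
  have hyz : y ≠ z := (Finset.mem_erase.1 hy).1
  have hyA : y ∈ A := (Finset.mem_sdiff.1 (Finset.mem_erase.1 hy).2).1
  have hyτ : y ∉ τ := (Finset.mem_sdiff.1 (Finset.mem_erase.1 hy).2).2
  have hzw : z ≠ w := fun h => hzτ (h ▸ hwτ)
  have hyw : y ≠ w := fun h => hyτ (h ▸ hwτ)
  have hAV : A ⊆ V := by
    intro r hr
    by_cases hrz : r = z
    · subst hrz; exact (hf y hyA hyτ).sub (Finset.mem_erase.2 ⟨hyz.symm, hr⟩)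
    · exact (hf z hzA hzτ).sub (Finset.mem_erase.2 ⟨hrz, hr⟩)
  set κ := (A.erase w).erase z with hκ
  have hzAw : z ∈ A.erase w := Finset.mem_erase.2 ⟨hzw, hzA⟩
  have hκc : κ.card + 2 = d := by
    rw [hκ, Finset.card_erase_of_mem hzAw, Finset.card_erase_of_mem hwA]; omega
  have hwκ : w ∉ κ := by simp [hκ]
  have hzκ : z ∉ κ := by simp [hκ]
  have hR : insert w κ = A.erase z := by
    ext r; simp only [hκ, Finset.mem_insert, Finset.mem_erase]
    constructor
    · rintro (rfl | h)
      · exact ⟨hzw.symm, hwA⟩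
      · exact ⟨h.1, h.2.2⟩
    · rintro ⟨h1, h2⟩
      by_cases h3 : r = w
      · exact Or.inl h3
      · exact Or.inr ⟨h1, h3, h2⟩
  have hzκ' : insert z κ = A.erase w := by rw [hκ, Finset.insert_erase hzAw]
  have hRf : Fc V d (insert w κ) := by rw [hR]; exact hf z hzA hzτ
  have hwN : w ∈ Nb V d κ := mem_Nb.2 ⟨hwκ, hRf⟩
  obtain ⟨ω, hω⟩ := area_exists hS (hRf.mono (Finset.subset_insert w κ)) hκc (by omega)
  set x1 := nxt V d κ ω w with hx1
  set xr := prv V d κ ω w with hxr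
  have hF1 := nxt_fct hS hκc hω hwN
  have hFr := prv_fct hS hκc hω hwN
  have hp1 := nxt_pos hS hκc hω hwN
  have hpr' := prv_neg hS hκc hω hwN
  rw [← hx1] at hF1 hp1
  rw [← hxr] at hFr hpr'
  have hx1N : x1 ∈ Nb V d κ := nxt_mem hS hκc hω hwN
  have hxrN : xr ∈ Nb V d κ := prv_mem hS hκc hω hwN
  have hx1r : x1 ≠ xr := by intro h; rw [h] at hp1; linarith
  have hx1w : x1 ≠ w := by intro h; rw [h, hω.alt] at hp1; linarith
  have hxrw : xr ≠ w := by intro h; rw [h, hω.alt] at hpr'; linarith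
  have hx1κ : x1 ∉ κ := (mem_Nb.1 hx1N).1
  have hxrκ : xr ∉ κ := (mem_Nb.1 hxrN).1
  have hzN : ∀ x ∈ Nb V d κ, x ≠ z := by
    rintro x hx rfl
    rw [mem_Nb, hzκ'] at hx
    exact hAw hx.2
  set F1 := insert x1 (insert w κ) with hF1d
  set Fr := insert xr (insert w κ) with hFrd
  have hzF1 : z ∉ F1 := by
    simp only [hF1d, Finset.mem_insert, not_or]
    exact ⟨(hzN x1 hx1N).symm, hzw, hzκ⟩
  have hzFr : z ∉ Fr := by
    simp only [hFrd, Finset.mem_insert, not_or]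
    exact ⟨(hzN xr hxrN).symm, hzw, hzκ⟩
  have hzV := hAV hzA
  have hn1 := hF1.nrm_lt hS hzV hzF1
  have hnr := hFr.nrm_lt hS hzV hzFr
  set δ : Module.Dual ℝ E := (1 - nrm F1 z) • nrm Fr - (1 - nrm Fr z) • nrm F1 with hδ
  set c0 : ℝ := nrm F1 z - nrm Fr z with hc0
  set D : E → ℝ := fun x => c0 + δ x with hD
  have hDx : ∀ x, D x = (1 - nrm Fr z) * (1 - nrm F1 x) - (1 - nrm F1 z) * (1 - nrm Fr x) := by
    intro x
    simp only [hD, hc0, hδ, LinearMap.sub_apply, LinearMap.smul_apply, smul_eq_mul]; ring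
  have hDR : ∀ r ∈ insert w κ, D r = 0 := by
    intro r hr
    rw [hDx, hF1.nrm_mem hS (Finset.mem_insert_of_mem hr), hFr.nrm_mem hS (Finset.mem_insert_of_mem hr)]
    ring
  have hDw : D w = 0 := hDR w (Finset.mem_insert_self w κ)
  have hDz : D z = 0 := by rw [hDx]; ring
  have hx1Fr : x1 ∉ Fr := by
    simp only [hFrd, Finset.mem_insert, not_or]; exact ⟨hx1r, hx1w, hx1κ⟩
  have hxrF1 : xr ∉ F1 := by
    simp only [hF1d, Finset.mem_insert, not_or]; exact ⟨hx1r.symm, hxrw, hxrκ⟩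
  have hDx1 : D x1 < 0 := by
    rw [hDx, hF1.nrm_mem hS (Finset.mem_insert_self x1 _)]
    have := mul_pos (sub_pos.2 hn1) (sub_pos.2 (hFr.nrm_lt hS (mem_V_of_Nb hx1N) hx1Fr))
    linarith
  have hDxr : 0 < D xr := by
    rw [hDx, hFr.nrm_mem hS (Finset.mem_insert_self xr _)]
    have := mul_pos (sub_pos.2 hnr) (sub_pos.2 (hF1.nrm_lt hS (mem_V_of_Nb hxrN) hxrF1))
    linarith
  -- separation
  have hcomb : ∀ x, ∃ c : E → ℝ, ∀ f : Module.Dual ℝ E,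
      1 - f x = c x1 * (1 - f x1) + ∑ r ∈ A, c r * (1 - f r) := by
    intro x
    obtain ⟨c, cz, h⟩ := aff_expand hS hF1 hn1 x
    refine ⟨fun r => if r = z then cz else c r, fun f => ?_⟩
    rw [h f, hF1d, Finset.sum_insert (by simp only [Finset.mem_insert, not_or]; exact ⟨hx1w, hx1κ⟩),
      hR, ← Finset.add_sum_erase A _ hzA]
    dsimp only
    rw [if_neg (hzN x1 hx1N), if_pos rfl]
    have : ∑ r ∈ A.erase z, (if r = z then cz else c r) * (1 - f r) = ∑ r ∈ A.erase z, c r * (1 - f r) := by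
      apply Finset.sum_congr rfl
      intro r hr
      rw [if_neg (Finset.mem_erase.1 hr).1]
    rw [this]; ring
  have hDA : ∀ r ∈ A, D r = 0 := by
    intro r hr
    by_cases hrz : r = z
    · rw [hrz, hDz]
    · exact hDR r (by rw [hR]; exact Finset.mem_erase.2 ⟨hrz, hr⟩)
  have hDc : ∀ x (c : E → ℝ), (∀ f : Module.Dual ℝ E,
      1 - f x = c x1 * (1 - f x1) + ∑ r ∈ A, c r * (1 - f r)) → D x = c x1 * D x1 := by
    intro x c h
    have e : ∑ r ∈ A, c r * D r = 0 := Finset.sum_eq_zero (fun r hr => by rw [hDA r hr, mul_zero])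
    have e2 : ∑ r ∈ A, c r * D r = (1 - nrm Fr z) * ∑ r ∈ A, c r * (1 - nrm F1 r) -
        (1 - nrm F1 z) * ∑ r ∈ A, c r * (1 - nrm Fr r) := by
      rw [Finset.mul_sum, Finset.mul_sum, ← Finset.sum_sub_distrib]
      apply Finset.sum_congr rfl
      intro r hr
      rw [hDx r]; ring
    rw [e] at e2
    rw [hDx x, h (nrm F1), h (nrm Fr), hDx x1]
    linarith
  have hsep : ∀ G, Fct V d G → τ ⊆ G → ∀ u ∈ G, ∀ u' ∈ G, ∀ α α' : ℝ, 0 < α → 0 < α' →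
      α * D u + α' * D u' = 0 → u ∈ A := by
    intro G hGf hτG u hu u' hu' α α' hα hα' h0
    obtain ⟨c, hcu⟩ := hcomb u
    obtain ⟨c', hcu'⟩ := hcomb u'
    have e1 := hDc u c hcu
    have e2 := hDc u' c' hcu'
    have e3 : α * c x1 + α' * c' x1 = 0 := by
      have : (α * c x1 + α' * c' x1) * D x1 = 0 := by rw [← h0, e1, e2]; ring
      exact (mul_eq_zero.1 this).resolve_right hDx1.ne
    refine sepA hS (μ := μ) (a := fun r => α * c r + α' * c' r) Finset.sdiff_subset ⟨z, hz⟩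
      (fun m hm => hf m (Finset.mem_sdiff.1 hm).1 (Finset.mem_sdiff.1 hm).2) hA hα hα' ?_ hGf ?_ hu hu' hAV
    · intro f
      rw [hcu f, hcu' f]
      have : ∑ r ∈ A, (α * c r + α' * c' r) * (1 - f r) =
          α * ∑ r ∈ A, c r * (1 - f r) + α' * ∑ r ∈ A, c' r * (1 - f r) := by
        rw [Finset.mul_sum, Finset.mul_sum, ← Finset.sum_add_distrib]
        apply Finset.sum_congr rfl
        intro r hr; ring
      rw [this]
      linear_combination e3 * (1 - f x1)
    · intro r hr hrm
      apply hτG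
      by_contra hh
      exact hrm (Finset.mem_sdiff.2 ⟨hr, hh⟩)
  have hsep1 : ∀ G, Fct V d G → τ ⊆ G → ∀ u ∈ G, ∀ u' ∈ G, 0 < D u → D u' < 0 → False := by
    intro G hGf hτG u hu u' hu' h1 h2
    have := hDA u (hsep G hGf hτG u hu u' hu' (- D u') (D u) (by linarith) h1 (by ring))
    linarith
  have hsep0 : ∀ G, Fct V d G → τ ⊆ G → ∀ u ∈ G, D u = 0 → u ∈ A := by
    intro G hGf hτG u hu h1
    exact hsep G hGf hτG u hu u hu 1 1 one_pos one_pos (by rw [h1]; ring)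
  -- the motion
  obtain ⟨m, hmev, hmA, hm0⟩ := surjA hS (by omega) hG.E (fun u v => u = w ∨ v = w)
    (fun u v h => h.symm) (by
      intro u v huv h1 h2
      have hwV := hAV hwA
      rcases h1 with rfl | rfl <;> rcases h2 with h2 | h2
      · exact neg_ne hS hwV h2
      · exact huv.not_anti hS (v := u) (by simp) (by simp [← h2])
      · exact huv.not_anti hS (v := v) (by simp) (by simp [← h2])
      · exact neg_ne hS hwV h2)
    (fun u v => if u = w then max 0 (- D v) else if v = w then max 0 (- D u) else 0) (by
      intro u v
      split_ifs with h1 h2 h2 <;> simp_all)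
  set θ := τ.erase w with hθ
  have hθκ : θ ⊆ κ := by
    intro r hr
    simp only [hκ, Finset.mem_erase]
    rw [hθ, Finset.mem_erase] at hr
    exact ⟨fun h => hzτ (h ▸ hr.2), hr.1, hτA hr.2⟩
  have hyκ : y ∈ κ := by simp only [hκ, Finset.mem_erase]; exact ⟨hyz, hyw, hyA⟩
  have hyθ : y ∉ θ := fun h => hyτ (Finset.mem_of_mem_erase h)
  have hθc : θ.card + 5 = d := by rw [hθ, Finset.card_erase_of_mem hwτ]; have := Finset.card_pos.2 ⟨w, hwτ⟩; omega
  have hτw : insert w θ = τ := by rw [hθ, Finset.insert_erase hwτ]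
  have hyθκ : insert y θ ⊆ κ := Finset.insert_subset hyκ hθκ
  have hnw : ¬ Fc V d (insert (-w) (insert y θ)) := by
    intro h
    have h1 : Fc V d (insert w (insert y θ)) := hRf.mono (Finset.insert_subset_insert w hyθκ)
    have h2 := mem_Wt_of hS h1 h
    obtain ⟨t, ht⟩ := lemN hG (h1.mono (Finset.subset_insert _ _))
      (by rw [Finset.card_insert_of_notMem hyθ]; omega) (by rw [Finset.card_insert_of_notMem hyθ]; omega) h2
    have : t ∈ Wt V d τ := Wt_anti hS (by rw [← hτw]; exact Finset.insert_subset_insert w (Finset.subset_insert y θ)) ht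
    rw [hW] at this; simp at this
  -- fields
  set M : E → E → Module.Dual ℝ E := fun x v => if v = w ∧ D x < 0 then m w - δ else m v with hM
  have hMot : ∀ x ∈ Nb V d κ, x ≠ w → Mot V d (insert x (insert y θ)) (M x) := by
    intro x hx hxw
    have key : ∀ v, v ≠ w → Fc V d (insert w (insert v (insert x (insert y θ)))) →
        rho (M x) w v = 0 := by
      intro v hvw hv
      obtain ⟨G, hGf, hGs⟩ := hv
      have hwG : w ∈ G := hGs (by simp)
      have hvG : v ∈ G := hGs (by simp)
      have hxG : x ∈ G := hGs (by simp)
      have hτG : τ ⊆ G := by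
        rw [← hτw]
        intro r hr
        apply hGs
        simp only [Finset.mem_insert] at hr ⊢
        tauto
      have hmw := hmA w v hvw.symm (hGf.fc.mono (by
        intro r hr; simp only [Finset.mem_insert, Finset.mem_singleton] at hr
        rcases hr with rfl | rfl <;> assumption)) (Or.inl rfl)
      rw [if_pos rfl] at hmw
      rcases lt_trichotomy (D x) 0 with h | h | h
      · have hDv : D v ≤ 0 := by
          by_contra hh; exact hsep1 G hGf hτG v hvG x hxG (not_le.1 hh) h
        rw [max_eq_right (by linarith)] at hmw
        have e1 : M x w = m w - δ := by simp [hM, h]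
        have e2 : M x v = m v := by simp [hM, hvw]
        have e3 : δ w - δ v = - D v := by
          have : D w - D v = δ w - δ v := by simp only [hD]; ring
          rw [← this, hDw]; ring
        unfold rho at hmw ⊢
        rw [e1, e2]
        simp only [LinearMap.sub_apply, map_sub] at hmw ⊢
        linarith
      · exfalso
        have := hsep0 G hGf hτG x hxG h
        have hxκ := (mem_Nb.1 hx).1
        apply hxκ
        simp only [hκ, Finset.mem_erase]
        exact ⟨hzN x hx, hxw, this⟩
      · have hDv : 0 ≤ D v := by
          by_contra hh; exact hsep1 G hGf hτG x hxG v hvG h (not_le.1 hh)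
        rw [max_eq_left (by linarith)] at hmw
        have e1 : M x w = m w := by simp only [hM]; rw [if_neg]; rintro ⟨_, h'⟩; linarith
        have e2 : M x v = m v := by simp [hM, hvw]
        rw [rho_congr e1 e2, hmw]
    apply mot_of_rho
    intro u v huv hf'
    by_cases huw : u = w
    · rw [huw] at hf' huv ⊢
      exact key v huv.symm hf'
    by_cases hvw : v = w
    · rw [hvw] at hf' ⊢
      rw [rho_symm]
      exact key u huw hf'.swap2
    have e1 : M x u = m u := by simp [hM, huw]
    have e2 : M x v = m v := by simp [hM, hvw]
    rw [rho_congr e1 e2]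
    apply hm0 u v huv hf'.pair
    · rintro (h | h)
      · exact huw h
      · exact hvw h
    · rintro (h | h)
      · have : u = -w := by rw [← h, neg_neg]
        apply hnw
        rw [← this]
        apply hf'.mono
        intro r hr; simp only [Finset.mem_insert] at hr ⊢; tauto
      · have : v = -w := by rw [← h, neg_neg]
        apply hnw
        rw [← this]
        apply hf'.mono
        intro r hr; simp only [Finset.mem_insert] at hr ⊢; tauto
  have hfld : ∀ x, ∃ T : (E →ₗ[ℝ] E →ₗ[ℝ] ℝ) × Module.Dual ℝ E, x ∈ Nb V d κ → x ≠ w →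
      (∀ t, T.1 t t = 0) ∧ ∀ v, Fc V d (insert v (insert x (insert y θ))) → M x v = T.1 v + T.2 := by
    intro x
    by_cases hx : x ∈ Nb V d κ ∧ x ≠ w
    · have hxκ := (mem_Nb.1 hx.1).1
      have hxy : x ∉ insert y θ := fun h => hxκ (hyθκ h)
      obtain ⟨B, b, h1, h2⟩ := rigid hS ((mem_Nb.1 hx.1).2.mono (Finset.insert_subset_insert x hyθκ))
        (by rw [Finset.card_insert_of_notMem hxy, Finset.card_insert_of_notMem hyθ]; omega) (hMot x hx.1 hx.2)
      exact ⟨(B, b), fun _ _ => ⟨h1, h2⟩⟩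
    · exact ⟨0, fun h1 h2 => absurd ⟨h1, h2⟩ hx⟩
  choose T hT using hfld
  obtain ⟨x', hx', hb1, hb2, hTe⟩ := walk hS hκc hω hwN T (fun x => x = w) rfl (fun x _ h _ => h) hx1w (by
    intro x hx hxw hnw'
    obtain ⟨h1, h2⟩ := hT x hx hxw
    obtain ⟨h1', h2'⟩ := hT _ (nxt_mem hS hκc hω hx) hnw'
    have hF := nxt_fct hS hκc hω hx
    have := field_uniq hS hF h1 h1' (by
      intro v hv
      rw [← h2 v, ← h2' v]
      · have hvw : v ≠ w := by
          rintro rfl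
          simp only [Finset.mem_insert] at hv
          rcases hv with h | h | h
          · exact hnw' h.symm
          · exact hxw h.symm
          · exact hwκ h
        simp [hM, hvw]
      · apply hF.fc.mono
        intro r hr
        have : r ∈ insert y θ → r ∈ κ := fun h => hyθκ h
        simp only [Finset.mem_insert] at hr hv this ⊢
        rcases hr with rfl | rfl | hr
        · exact hv
        · exact Or.inl rfl
        · exact Or.inr (Or.inr (this hr))
      · apply hF.fc.mono
        intro r hr
        have : r ∈ insert y θ → r ∈ κ := fun h => hyθκ h
        simp only [Finset.mem_insert] at hr hv this ⊢
        rcases hr with rfl | rfl | hr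
        · exact hv
        · exact Or.inr (Or.inl rfl)
        · exact Or.inr (Or.inr (this hr)))
    exact Prod.ext this.1 this.2)
  have hx'r : x' = xr := by
    have := prv_nxt hS hκc hω hx'
    rw [hb2] at this
    rw [hxr, this]
  subst hx'r
  have hsub : ∀ x, insert w (insert x (insert y θ)) ⊆ insert x (insert w κ) := by
    intro x r hr
    have : r ∈ insert y θ → r ∈ κ := fun h => hyθκ h
    simp only [Finset.mem_insert] at hr this ⊢
    tauto
  have e1 := (hT xr hxrN hxrw).2 w (hFr.fc.mono (hsub xr))
  have e2 := (hT x1 hx1N hx1w).2 w (hF1.fc.mono (hsub x1))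
  rw [← hx1] at hTe
  rw [hTe, ← e2] at e1
  have e3 : M x1 w = m w - δ := by simp [hM, hDx1]
  have e4 : M xr w = m w := by simp only [hM]; rw [if_neg]; rintro ⟨_, h'⟩; linarith
  rw [e3, e4] at e1
  have e5 : δ = 0 := by
    have : m w - δ = m w - 0 := by rw [sub_zero]; exact e1.symm
    exact sub_right_injective this
  have e6 : D x1 = D w := by simp only [hD, e5, LinearMap.zero_apply]
  rw [e6, hDw] at hDx1
  exact lt_irrefl _ hDx1

end CSP

namespace CSP
variable {E : Type} [AddCommGroup E] [Module ℝ E] [FiniteDimensional ℝ E]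
variable {V : Finset E} {d : ℕ}

set_option maxHeartbeats 1600000 in
/-- auxiliary for claim B: common neighbours of a ridge -/
theorem claimB0 (hG : Good V d) (hpr : Prm V d) {τ : Finset E} (hc : τ.card + 4 = d)
    (hW : Wt V d τ = ∅) {a b c e g y : E} (ha : a ∉ τ) (hb : b ∉ τ) (hct : c ∉ τ) (hab : a ≠ b)
    (hac : a ≠ c) (hbc : b ≠ c)
    (hF : Fct V d (insert e (insert c (insert a (insert b τ)))))
    (hg : g ∉ insert e (insert c (insert a (insert b τ))))
    (hF1 : Fct V d (insert g (insert c (insert a (insert b τ)))))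
    (hyc : y ≠ c) (hye : y ≠ e)
    (h1 : Fc V d (insert c (insert y (insert a τ)))) (h2 : Fc V d (insert c (insert y (insert b τ)))) :
    y ∈ insert g (insert c (insert a (insert b τ))) := by
  have hS := hG.S
  by_contra hy
  have hyn : y ∉ insert c (insert a (insert b τ)) := fun h => hy (Finset.mem_insert_of_mem h)
  have hyτ : y ∉ τ := fun h => hyn (by simp [h])
  have hya : y ≠ a := by rintro rfl; exact hyn (by simp)
  have hyb : y ≠ b := by rintro rfl; exact hyn (by simp)
  have hsubs : ∀ {s t : Finset E}, (∀ r ∈ s, r ∈ t) → Fc V d t → Fc V d s := fun h h' => h'.mono h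
  have habF : Fc V d {a, b} := hsubs (by intro r; simp only [Finset.mem_insert, Finset.mem_singleton]; tauto) hF.fc
  have k1 : Fc V d (insert a (insert y τ)) := hsubs (by intro r; simp only [Finset.mem_insert]; tauto) h1
  have k2 : Fc V d (insert b (insert y τ)) := hsubs (by intro r; simp only [Finset.mem_insert]; tauto) h2
  have k3 : Fc V d (insert a (insert b (insert y τ))) := by
    rcases lemM hG (k1.mono (Finset.subset_insert _ _)) (by rw [Finset.card_insert_of_notMem hyτ]; omega)
      habF k1 k2 with h | h
    · exact h
    · exfalso
      have : a ∈ Wt V d τ := mem_Wt_of hS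
        (hsubs (by intro r; simp only [Finset.mem_insert]; tauto) k1)
        (hsubs (by intro r; simp only [Finset.mem_insert]; tauto) h)
      rw [hW] at this; simp at this
  have hA : Fc V d (insert y (insert c (insert a (insert b τ)))) := by
    apply claimA hG hpr (τ := τ) (by intro r; simp only [Finset.mem_insert]; tauto) hc _ hW
    · intro m hm hmτ
      simp only [Finset.mem_insert] at hm
      rcases hm with rfl | rfl | rfl | rfl | hm
      · apply hsubs _ hF.fc; intro r; simp only [Finset.mem_insert, Finset.mem_erase]; tauto
      · apply hsubs _ k3; intro r; simp only [Finset.mem_insert, Finset.mem_erase]; tauto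
      · apply hsubs _ h2; intro r; simp only [Finset.mem_insert, Finset.mem_erase]; tauto
      · apply hsubs _ h1; intro r; simp only [Finset.mem_insert, Finset.mem_erase]; tauto
      · exact absurd hm hmτ
    · rw [Finset.card_insert_of_notMem hyn, Finset.card_insert_of_notMem, Finset.card_insert_of_notMem,
        Finset.card_insert_of_notMem hb]
      · omega
      · simp only [Finset.mem_insert, not_or]; exact ⟨hab, ha⟩
      · simp only [Finset.mem_insert, not_or]; exact ⟨hac.symm, hbc.symm, hct⟩
  have hA' : Fct V d (insert y (insert c (insert a (insert b τ)))) := by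
    apply hA.fct
    rw [← hF1.card]
    rw [Finset.card_insert_of_notMem hyn,
      Finset.card_insert_of_notMem (fun h => hg (Finset.mem_insert_of_mem h))]
  have hen : e ∉ insert c (insert a (insert b τ)) := by
    intro h
    have h1 := hF.card
    have h2 := hF1.card
    rw [Finset.insert_eq_of_mem h] at h1
    rw [Finset.card_insert_of_notMem (fun h => hg (Finset.mem_insert_of_mem h))] at h2
    omega
  have her : (insert e (insert c (insert a (insert b τ)))).erase e = insert c (insert a (insert b τ)) :=
    Finset.erase_insert hen
  have := adj_unique hS hF (w := e) (Finset.mem_insert_self _ _) hg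
    (y := y) (by rw [Finset.mem_insert, not_or]; exact ⟨hye, hyn⟩) (by rw [her]; exact hF1) (by rw [her]; exact hA')
  rw [this] at hy
  exact hy (Finset.mem_insert_self _ _)

set_option maxHeartbeats 1600000 in
theorem claimB (hG : Good V d) (hpr : Prm V d) {τ : Finset E} (hc : τ.card + 4 = d)
    (hW : Wt V d τ = ∅) {F : Finset E} (hF : Fct V d F) (hτF : τ ⊆ F) {c e g g' : E}
    (hcF : c ∈ F) (hct : c ∉ τ) (heF : e ∈ F) (het : e ∉ τ) (hce : c ≠ e) (hg : g ∉ F) (hg' : g' ∉ F)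
    (hF1 : Fct V d (insert g (F.erase e))) (hF2 : Fct V d (insert g' (F.erase c))) : g = g' := by
  by_contra hgg
  have hS := hG.S
  have hcard : (((F \ τ).erase c).erase e).card = 2 := by
    have h1 : (F \ τ).card = 4 := by
      have := hF.card
      rw [Finset.card_sdiff_of_subset hτF]; omega
    rw [Finset.card_erase_of_mem, Finset.card_erase_of_mem]
    · omega
    · simp [hcF, hct]
    · simp [heF, het, hce.symm]
  obtain ⟨a, b, hab, hs⟩ := Finset.card_eq_two.1 hcard
  have hmem : ∀ r, (r ≠ e ∧ r ≠ c ∧ r ∈ F ∧ r ∉ τ) ↔ (r = a ∨ r = b) := by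
    intro r
    have : r ∈ ((F \ τ).erase c).erase e ↔ r ∈ ({a, b} : Finset E) := by rw [hs]
    simpa using this
  obtain ⟨hae, hac, haF, haτ⟩ := (hmem a).2 (Or.inl rfl)
  obtain ⟨hbe, hbc, hbF, hbτ⟩ := (hmem b).2 (Or.inr rfl)
  have hFe : F.erase e = insert c (insert a (insert b τ)) := by
    ext r; simp only [Finset.mem_erase, Finset.mem_insert]
    constructor
    · rintro ⟨h1, h2⟩
      by_cases h3 : r = c
      · exact Or.inl h3
      by_cases h4 : r ∈ τ
      · tauto
      · have := (hmem r).1 ⟨h1, h3, h2, h4⟩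
        tauto
    · rintro (rfl | rfl | rfl | h)
      · exact ⟨hce, hcF⟩
      · exact ⟨hae, haF⟩
      · exact ⟨hbe, hbF⟩
      · exact ⟨fun h' => het (h' ▸ h), hτF h⟩
  have hFc : F.erase c = insert e (insert a (insert b τ)) := by
    ext r; simp only [Finset.mem_erase, Finset.mem_insert]
    constructor
    · rintro ⟨h1, h2⟩
      by_cases h3 : r = e
      · exact Or.inl h3
      by_cases h4 : r ∈ τ
      · tauto
      · have := (hmem r).1 ⟨h3, h1, h2, h4⟩
        tauto
    · rintro (rfl | rfl | rfl | h)
      · exact ⟨hce.symm, heF⟩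
      · exact ⟨hac, haF⟩
      · exact ⟨hbc, hbF⟩
      · exact ⟨fun h' => hct (h' ▸ h), hτF h⟩
  have hFeq : F = insert e (insert c (insert a (insert b τ))) := by rw [← hFe, Finset.insert_erase heF]
  have hFeq2 : F = insert c (insert e (insert a (insert b τ))) := by rw [← hFc, Finset.insert_erase hcF]
  rw [hFe] at hF1
  rw [hFc] at hF2
  set F1 := insert g (insert c (insert a (insert b τ))) with hF1d
  set F2 := insert g' (insert e (insert a (insert b τ))) with hF2d
  have hF' := hF
  have hg0 := hg
  have hg0' := hg'
  have hF'' := hF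
  rw [hFeq] at hF' hg0
  rw [hFeq2] at hF'' hg0'
  set s1 := 1 - nrm F2 c with hs1
  set s2 := - (1 - nrm F1 e) with hs2
  set f : E → Module.Dual ℝ E := fun v => if v = c then s1 • nrm F1 else if v = e then s2 • nrm F2 else 0 with hf
  have fc : f c = s1 • nrm F1 := by simp [hf]
  have fe : f e = s2 • nrm F2 := by simp [hf, hce.symm]
  have f0 : ∀ v, v ≠ c → v ≠ e → f v = 0 := by intro v h1 h2; simp [hf, h1, h2]
  have hcF1 : c ∈ F1 := by simp [hF1d]
  have heF2 : e ∈ F2 := by simp [hF2d]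
  have kce : rho f c e = 0 := by
    unfold rho
    rw [fc, fe]
    simp only [LinearMap.sub_apply, LinearMap.smul_apply, map_sub, smul_eq_mul]
    rw [hF1.nrm_mem hS hcF1, hF2.nrm_mem hS heF2, hs1, hs2]; ring
  have kc : ∀ y, y ≠ c → y ≠ e → Fc V d (insert c (insert y (insert a τ))) →
      Fc V d (insert c (insert y (insert b τ))) → rho f c y = 0 := by
    intro y hyc hye h1 h2
    have hy := claimB0 hG hpr hc hW haτ hbτ hct hab hac hbc hF' hg0 hF1 hyc hye h1 h2
    unfold rho
    rw [fc, f0 y hyc hye]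
    simp only [LinearMap.sub_apply, LinearMap.smul_apply, map_sub, smul_eq_mul]
    rw [hF1.nrm_mem hS hcF1, hF1.nrm_mem hS hy]; simp
  have ke : ∀ y, y ≠ c → y ≠ e → Fc V d (insert e (insert y (insert a τ))) →
      Fc V d (insert e (insert y (insert b τ))) → rho f e y = 0 := by
    intro y hyc hye h1 h2
    have hy := claimB0 hG hpr hc hW haτ hbτ het hab hae hbe hF'' hg0' hF2 hye hyc h1 h2
    unfold rho
    rw [fe, f0 y hyc hye]
    simp only [LinearMap.sub_apply, LinearMap.smul_apply, map_sub, smul_eq_mul]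
    rw [hF2.nrm_mem hS heF2, hF2.nrm_mem hS hy]; simp
  have hsubs : ∀ {s t : Finset E}, (∀ r ∈ s, r ∈ t) → Fc V d t → Fc V d s := fun h h' => h'.mono h
  obtain ⟨B, bb, hB, hfB⟩ := lemG hG hW (θ1 := insert a τ) (θ2 := insert b τ) (Finset.subset_insert _ _)
    (Finset.subset_insert _ _)
    (hsubs (by intro r; simp only [Finset.mem_insert]; tauto) hF'.fc)
    (hsubs (by intro r; simp only [Finset.mem_insert]; tauto) hF'.fc)
    (by rw [Finset.card_insert_of_notMem haτ]; omega) (by rw [Finset.card_insert_of_notMem hbτ]; omega) f (by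
      intro u v huv h1 h2
      by_cases hu : u = c
      · rw [hu] at h1 h2 huv ⊢
        by_cases hv : v = e
        · rw [hv]; exact kce
        · exact kc v huv.symm hv h1 h2
      by_cases hu2 : u = e
      · rw [hu2] at h1 h2 huv ⊢
        by_cases hv : v = c
        · rw [hv, rho_symm]; exact kce
        · exact ke v hv huv.symm h1 h2
      by_cases hv : v = c
      · rw [hv] at h1 h2 ⊢
        rw [rho_symm]
        exact kc u hu hu2 h1.swap2 h2.swap2
      by_cases hv2 : v = e
      · rw [hv2] at h1 h2 ⊢
        rw [rho_symm]
        exact ke u hu hu2 h1.swap2 h2.swap2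
      unfold rho
      rw [f0 u hu hu2, f0 v hv hv2]; simp)
  have e1 := hfB c (hsubs (by intro r; simp only [Finset.mem_insert]; tauto) hF'.fc)
    (hsubs (by intro r; simp only [Finset.mem_insert]; tauto) hF'.fc)
  have e2 := hfB g' (hsubs (by intro r; simp only [hF2d, Finset.mem_insert]; tauto) hF2.fc)
    (hsubs (by intro r; simp only [hF2d, Finset.mem_insert]; tauto) hF2.fc)
  have e3 := rho_field hB e1 e2
  have hg'c : g' ≠ c := by rintro rfl; exact hg' hcF
  have hg'e : g' ≠ e := by rintro rfl; exact hg' heF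
  unfold rho at e3
  rw [fc, f0 g' hg'c hg'e] at e3
  simp only [LinearMap.sub_apply, LinearMap.smul_apply, map_sub, smul_eq_mul] at e3
  rw [hF1.nrm_mem hS hcF1] at e3
  have hg'F1 : g' ∉ F1 := by
    simp only [hF1d, Finset.mem_insert, not_or]
    refine ⟨fun h => hgg h.symm, hg'c, ?_, ?_, fun h => hg' (hτF h)⟩
    · rintro rfl; exact hg' haF
    · rintro rfl; exact hg' hbF
  have hcF2 : c ∉ F2 := by
    simp only [hF2d, Finset.mem_insert, not_or]
    exact ⟨hg'c.symm, hce, hac.symm, hbc.symm, hct⟩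
  have p1 := hF1.nrm_lt hS (hF2.sub (Finset.mem_insert_self g' _)) hg'F1
  have p2 := hF2.nrm_lt hS (hF.sub hcF) hcF2
  have := mul_pos (show 0 < s1 by rw [hs1]; linarith) (sub_pos.2 p1)
  simp at e3
  nlinarith

theorem claimC (hG : Good V d) (hpr : Prm V d) {τ : Finset E} (hc : τ.card + 4 = d)
    (hτ : Fc V d τ) (hW : Wt V d τ = ∅) : ∃ Sg : Finset E, Sg.card = d + 1 ∧ τ ⊆ Sg ∧
      (∀ x ∈ Sg, x ∉ τ → Fct V d (Sg.erase x)) ∧ ∀ G, Fct V d G → τ ⊆ G → G ⊆ Sg := by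
  have hS := hG.S
  obtain ⟨F, hF, hτF⟩ := hτ
  obtain ⟨c0, hc0⟩ : (F \ τ).Nonempty := by
    rw [← Finset.card_pos, Finset.card_sdiff_of_subset hτF, hF.card]; omega
  obtain ⟨hc0F, hc0τ⟩ := Finset.mem_sdiff.1 hc0
  obtain ⟨g, hg, hgF, -⟩ := pivot hS hF hc0F
  have hcard : (insert g F).card = d + 1 := by rw [Finset.card_insert_of_notMem hg, hF.card]
  have hsub : τ ⊆ insert g F := hτF.trans (Finset.subset_insert g F)
  have hall : ∀ x ∈ insert g F, x ∉ τ → Fct V d ((insert g F).erase x) := by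
    intro x hx hxτ
    rcases Finset.mem_insert.1 hx with rfl | hxF
    · rw [Finset.erase_insert hg]; exact hF
    · have hxg : g ≠ x := by rintro rfl; exact hg hxF
      rw [Finset.erase_insert_of_ne hxg]
      by_cases hxc : x = c0
      · rw [hxc]; exact hgF
      · obtain ⟨g', hg', hgF', -⟩ := pivot hS hF hxF
        rw [claimB hG hpr hc hW hF hτF hxF hxτ hc0F hc0τ hxc hg hg' hgF hgF']
        exact hgF'
  exact ⟨insert g F, hcard, hsub, hall, fun G h1 h2 => lemmaSigma hS hcard hsub
    ⟨c0, Finset.mem_insert_of_mem hc0F, hc0τ⟩ hall h1 h2⟩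

end CSP

namespace CSP
variable {E : Type} [AddCommGroup E] [Module ℝ E] [FiniteDimensional ℝ E]
variable {V : Finset E} {d : ℕ}

/-- The situation of the last case of layer 4. -/
structure Dd (V : Finset E) (d : ℕ) (τ Sg ζ : Finset E) (u w : E) : Prop where
  c : τ.card + 4 = d
  W : Wt V d τ = ∅
  Sc : Sg.card = d + 1
  sub : τ ⊆ Sg
  f : ∀ x ∈ Sg, x ∉ τ → Fct V d (Sg.erase x)
  g : ∀ G, Fct V d G → τ ⊆ G → G ⊆ Sg
  mu : u ∈ τ
  mw : w ∈ τ
  uw : u ≠ w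
  K : ¬ Fc V d ((Sg.erase w).erase u)
  ζs : ζ ⊆ Sg
  ζc : ζ.card + 4 = d
  uζ : u ∉ ζ
  wζ : w ∉ ζ
  τζ : τ ⊆ insert w (insert u ζ)

theorem Dd.symm {τ Sg ζ : Finset E} {u w : E} (h : Dd V d τ Sg ζ u w) : Dd V d τ Sg ζ w u where
  c := h.c
  W := h.W
  Sc := h.Sc
  sub := h.sub
  f := h.f
  g := h.g
  mu := h.mw
  mw := h.mu
  uw := h.uw.symm
  K := by rw [Finset.erase_right_comm]; exact h.K
  ζs := h.ζs
  ζc := h.ζc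
  uζ := h.wζ
  wζ := h.uζ
  τζ := by rw [Finset.insert_comm]; exact h.τζ

def QQ (Sg ζ : Finset E) (u w : E) : Finset E := Sg \ insert w (insert u ζ)

theorem Dd.subI {τ Sg ζ : Finset E} {u w : E} (h : Dd V d τ Sg ζ u w) : insert w (insert u ζ) ⊆ Sg :=
  Finset.insert_subset (h.sub h.mw) (Finset.insert_subset (h.sub h.mu) h.ζs)

theorem Dd.cardI {τ Sg ζ : Finset E} {u w : E} (h : Dd V d τ Sg ζ u w) :
    (insert w (insert u ζ)).card + 2 = d := by
  rw [Finset.card_insert_of_notMem, Finset.card_insert_of_notMem h.uζ]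
  · have := h.ζc; omega
  · simp only [Finset.mem_insert, not_or]; exact ⟨h.uw.symm, h.wζ⟩

theorem Dd.cardQ {τ Sg ζ : Finset E} {u w : E} (h : Dd V d τ Sg ζ u w) : (QQ Sg ζ u w).card = 3 := by
  unfold QQ
  rw [Finset.card_sdiff_of_subset h.subI]
  have := h.cardI
  have := h.Sc
  omega

theorem Dd.fz {τ Sg ζ : Finset E} {u w z : E} (h : Dd V d τ Sg ζ u w) (hz : z ∈ QQ Sg ζ u w) :
    Fct V d (Sg.erase z) := by
  obtain ⟨h1, h2⟩ := Finset.mem_sdiff.1 hz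
  exact h.f z h1 (fun h3 => h2 (h.τζ h3))

theorem Dd.exQ {τ Sg ζ : Finset E} {u w : E} (h : Dd V d τ Sg ζ u w) : ∃ z, z ∈ QQ Sg ζ u w := by
  have : (QQ Sg ζ u w).Nonempty := by rw [← Finset.card_pos, h.cardQ]; omega
  exact this

theorem Dd.exQ2 {τ Sg ζ : Finset E} {u w : E} (h : Dd V d τ Sg ζ u w) (q : E) :
    ∃ z, z ∈ QQ Sg ζ u w ∧ z ≠ q := by
  have : ((QQ Sg ζ u w).erase q).Nonempty := by
    rw [← Finset.card_pos]
    have := h.cardQ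
    have := Finset.pred_card_le_card_erase (s := QQ Sg ζ u w) (a := q)
    omega
  obtain ⟨z, hz⟩ := this
  exact ⟨z, Finset.mem_of_mem_erase hz, Finset.ne_of_mem_erase hz⟩

theorem Dd.fI {τ Sg ζ : Finset E} {u w : E} (h : Dd V d τ Sg ζ u w) :
    Fc V d (insert w (insert u ζ)) := by
  obtain ⟨z, hz⟩ := h.exQ
  apply (h.fz hz).fc.mono
  intro r hr
  refine Finset.mem_erase.2 ⟨?_, h.subI hr⟩
  rintro rfl
  exact (Finset.mem_sdiff.1 hz).2 hr

theorem Dd.inS {τ Sg ζ : Finset E} {u w x : E} (h : Dd V d τ Sg ζ u w)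
    (hx : Fc V d (insert x (insert w (insert u ζ)))) : x ∈ Sg := by
  obtain ⟨G, hG, hs⟩ := hx
  exact h.g G hG (h.τζ.trans ((Finset.subset_insert x _).trans hs)) (hs (Finset.mem_insert_self _ _))

theorem Dd.flip0 (hG : Good V d) {τ Sg ζ : Finset E} {u w : E} (h : Dd V d τ Sg ζ u w)
    (hn : ¬ Fc V d (insert (-u) (insert (-w) ζ))) {z : E} (hz : z ∈ QQ Sg ζ u w)
    {κ : Finset E} (hκ : κ = ((Sg.erase w).erase u).erase z) (hκc : κ.card + 2 = d)
    (huw : Sg.erase z = insert w (insert u κ)) (hζκ : ζ ⊆ κ)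
    {ω : E →ₗ[ℝ] E →ₗ[ℝ] ℝ} (hω : Area κ ω) (hpos : 0 < ω u w) : False := by
  have hS := hG.S
  obtain ⟨hzS, hzI⟩ := Finset.mem_sdiff.1 hz
  have hzw : z ≠ w := by rintro rfl; exact hzI (by simp)
  have hzu : z ≠ u := by rintro rfl; exact hzI (by simp)
  have hFz := h.fz hz
  rw [huw] at hFz
  obtain ⟨hwN, huN⟩ := Nb_of_fct hκc hFz
  have huV := mem_V_of_Nb huN
  have hnx : nxt V d κ ω u = w := nxt_eq hS hκc hω hFz hpos
  have hzN : ∀ x ∈ Nb V d κ, x ≠ z := by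
    rintro x hx rfl
    apply h.K
    have := (mem_Nb.1 hx).2
    rwa [hκ, Finset.insert_erase] at this
    simp only [Finset.mem_erase]; exact ⟨hzu, hzw, hzS⟩
  obtain ⟨m, hmev, hmA, hm0⟩ := surjA hS (by have := hG.hd; omega) hG.E
    (fun p q => (p = u ∧ q = w) ∨ (p = w ∧ q = u)) (fun p q h => by tauto) (by
      intro p q hpq h1 h2
      have hwV := mem_V_of_Nb hwN
      rcases h1 with ⟨rfl, rfl⟩ | ⟨rfl, rfl⟩ <;> rcases h2 with ⟨h2, h3⟩ | ⟨h2, h3⟩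
      · exact neg_ne hS huV h2
      · exact hpq.not_anti hS (v := p) (by simp) (by simp [h2])
      · exact hpq.not_anti hS (v := p) (by simp) (by simp [h2])
      · exact neg_ne hS hwV h2)
    (fun p q => 1) (fun p q => rfl)
  have hMot : ∀ x ∈ Nb V d κ, ¬ (x = u ∨ x = w) → Mot V d (insert x ζ) m := by
    intro x hx hb
    apply mot_of_rho
    intro p q hpq hf
    apply hm0 p q hpq hf.pair
    · intro hh
      have : Fc V d (insert x (insert w (insert u ζ))) := by
        apply hf.mono
        intro r
        simp only [Finset.mem_insert]
        rcases hh with ⟨rfl, rfl⟩ | ⟨rfl, rfl⟩ <;> tauto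
      have hxS := h.inS this
      apply (mem_Nb.1 hx).1
      rw [hκ]
      simp only [Finset.mem_erase]
      exact ⟨hzN x hx, fun h => hb (Or.inl h), fun h => hb (Or.inr h), hxS⟩
    · intro hh
      apply hn
      apply hf.mono
      intro r
      simp only [Finset.mem_insert]
      rcases hh with ⟨h1, h2⟩ | ⟨h1, h2⟩
      · have e1 : p = -u := by rw [← h1, neg_neg]
        have e2 : q = -w := by rw [← h2, neg_neg]
        rw [e1, e2]; tauto
      · have e1 : p = -w := by rw [← h1, neg_neg]
        have e2 : q = -u := by rw [← h2, neg_neg]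
        rw [e1, e2]; tauto
  have hfld : ∀ x, ∃ T : (E →ₗ[ℝ] E →ₗ[ℝ] ℝ) × Module.Dual ℝ E, x ∈ Nb V d κ → ¬ (x = u ∨ x = w) →
      (∀ t, T.1 t t = 0) ∧ ∀ v, Fc V d (insert v (insert x ζ)) → m v = T.1 v + T.2 := by
    intro x
    by_cases hx : x ∈ Nb V d κ ∧ ¬ (x = u ∨ x = w)
    · have hxκ := (mem_Nb.1 hx.1).1
      have hxζ : x ∉ ζ := fun h => hxκ (hζκ h)
      obtain ⟨B, b, h1, h2⟩ := rigid hS ((mem_Nb.1 hx.1).2.mono (Finset.insert_subset_insert x hζκ))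
        (by rw [Finset.card_insert_of_notMem hxζ]; have := h.ζc; omega) (hMot x hx.1 hx.2)
      exact ⟨(B, b), fun _ _ => ⟨h1, h2⟩⟩
    · exact ⟨0, fun h1 h2 => absurd ⟨h1, h2⟩ hx⟩
  choose T hT using hfld
  have hsub : ∀ a b v, v ∈ insert a (insert b κ) → insert v (insert b ζ) ⊆ insert a (insert b κ) := by
    intro a b v hv r hr
    have : r ∈ ζ → r ∈ κ := fun h => hζκ h
    simp only [Finset.mem_insert] at hr hv this ⊢
    rcases hr with rfl | rfl | hr
    · exact hv
    · exact Or.inr (Or.inl rfl)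
    · exact Or.inr (Or.inr (this hr))
  have hsub' : ∀ a b v, v ∈ insert a (insert b κ) → insert v (insert a ζ) ⊆ insert a (insert b κ) := by
    intro a b v hv
    rw [Finset.insert_comm a b] at hv ⊢
    exact hsub b a v hv
  have hnw : ¬ (nxt V d κ ω w = u ∨ nxt V d κ ω w = w) := by
    have hp := nxt_pos hS hκc hω hwN
    rintro (hh | hh)
    · rw [hh, hω.swap] at hp; linarith
    · rw [hh, hω.alt] at hp; linarith
  obtain ⟨y, hy, hb1, hb2, hTe⟩ := walk hS hκc hω hwN T (fun x => x = u ∨ x = w) (Or.inr rfl) (by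
      intro x hx hb hnb
      rcases hb with rfl | rfl
      · exact absurd (Or.inr hnx) hnb
      · rfl) hnw (by
    intro x hx hxb hnb
    obtain ⟨h1, h2⟩ := hT x hx hxb
    obtain ⟨h1', h2'⟩ := hT _ (nxt_mem hS hκc hω hx) hnb
    have hF := nxt_fct hS hκc hω hx
    have := field_uniq hS hF h1 h1' (by
      intro v hv
      rw [← h2 v (hF.fc.mono (hsub _ _ v hv)), ← h2' v (hF.fc.mono (hsub' _ _ v hv))])
    exact Prod.ext this.1 this.2)
  have hyu : nxt V d κ ω y = u := by
    rcases hb2 with h1 | h1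
    · exact h1
    · exfalso
      have e1 := prv_nxt hS hκc hω hy
      have e2 := prv_nxt hS hκc hω huN
      rw [h1] at e1
      rw [hnx] at e2
      exact hb1 (Or.inl (by rw [← e1, ← e2]))
  obtain ⟨h1, h2⟩ := hT y hy hb1
  obtain ⟨h1', h2'⟩ := hT _ (nxt_mem hS hκc hω hwN) hnw
  have hFy := nxt_fct hS hκc hω hy
  rw [hyu] at hFy
  have hFw := nxt_fct hS hκc hω hwN
  have e1 := h2 u (hFy.fc.mono (hsub _ _ u (by simp)))
  have e2 := h2' w (hFw.fc.mono (hsub' _ _ w (by simp)))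
  rw [hTe] at e1
  have e3 := rho_field h1' e1 e2
  have e4 := hmA u w h.uw (hFz.fc.mono (by
    intro r; simp only [Finset.mem_insert, Finset.mem_singleton]; tauto)) (Or.inl ⟨rfl, rfl⟩)
  rw [e3] at e4
  exact zero_ne_one e4

theorem Dd.flip (hG : Good V d) {τ Sg ζ : Finset E} {u w : E} (h : Dd V d τ Sg ζ u w) :
    Fc V d (insert (-u) (insert (-w) ζ)) := by
  by_contra hn
  have hS := hG.S
  obtain ⟨z, hz⟩ := h.exQ
  obtain ⟨hzS, hzI⟩ := Finset.mem_sdiff.1 hz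
  have hzw : z ≠ w := by rintro rfl; exact hzI (by simp)
  have hzu : z ≠ u := by rintro rfl; exact hzI (by simp)
  have hzζ : z ∉ ζ := fun hh => hzI (by simp [hh])
  have hwS := h.sub h.mw
  have huS := h.sub h.mu
  have hζκ : ζ ⊆ ((Sg.erase w).erase u).erase z := by
    intro r hr
    simp only [Finset.mem_erase]
    exact ⟨fun hh => hzζ (hh ▸ hr), fun hh => h.uζ (hh ▸ hr), fun hh => h.wζ (hh ▸ hr), h.ζs hr⟩
  have hκc : (((Sg.erase w).erase u).erase z).card + 2 = d := by
    rw [Finset.card_erase_of_mem, Finset.card_erase_of_mem, Finset.card_erase_of_mem hwS]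
    · have := h.Sc
      have := hG.hd
      omega
    · exact Finset.mem_erase.2 ⟨h.uw, huS⟩
    · simp only [Finset.mem_erase]; exact ⟨hzu, hzw, hzS⟩
  have huw : Sg.erase z = insert w (insert u (((Sg.erase w).erase u).erase z)) := by
    ext r
    simp only [Finset.mem_insert, Finset.mem_erase]
    constructor
    · rintro ⟨h1, h2⟩; tauto
    · rintro (rfl | rfl | hh)
      · exact ⟨hzw.symm, hwS⟩
      · exact ⟨hzu.symm, huS⟩
      · exact ⟨hh.1, hh.2.2.2⟩
  have hFz := h.fz hz
  rw [huw] at hFz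
  obtain ⟨ω, hω⟩ := area_exists hS (κ := ((Sg.erase w).erase u).erase z) (hFz.fc.mono (by
    intro r hr; exact Finset.mem_insert_of_mem (Finset.mem_insert_of_mem hr))) hκc (by have := hG.hd; omega)
  rcases lt_or_gt_of_ne (hω.ne hS hFz) with hlt | hgt
  · exact h.flip0 hG hn hz rfl hκc huw hζκ hω.neg (by simpa using hlt)
  · exact h.flip0 hG hn hz rfl hκc huw hζκ hω hgt

theorem Dd.mem (hG : Good V d) {τ Sg ζ : Finset E} {u w : E} (h : Dd V d τ Sg ζ u w) :
    u ∈ Wt V d ζ ∧ w ∈ Wt V d ζ :=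
  Wt_both hG.S h.symm.fI (h.flip hG)

theorem Dd.nw (hG : Good V d) {τ Sg ζ : Finset E} {u w : E} (h : Dd V d τ Sg ζ u w) :
    ¬ Fc V d (insert (-w) (insert u ζ)) := by
  intro hh
  have hS := hG.S
  have hc := h.ζc
  have hw := mem_Wt_of hS h.fI hh
  have hcc := Finset.card_insert_of_notMem h.uζ
  obtain ⟨t, ht⟩ := lemN hG (h.fI.mono (Finset.subset_insert _ _)) (by omega) (by omega) hw
  have := Wt_anti hS h.τζ ht
  rw [h.W] at this; simp at this

theorem Dd.fζ {τ Sg ζ : Finset E} {u w : E} (h : Dd V d τ Sg ζ u w) : Fc V d ζ :=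
  h.fI.mono (fun r hr => Finset.mem_insert_of_mem (Finset.mem_insert_of_mem hr))

theorem Dd.span (hG : Good V d) (hd : 6 ≤ d) {τ Sg ζ : Finset E} {u w : E} (h : Dd V d τ Sg ζ u w) :
    Submodule.span ℝ (Wt V d ζ : Set E) ≠ ⊤ := by
  have hS := hG.S
  have hc := h.ζc
  have hcount := count hG h.fζ (by omega) (by rw [← Finset.card_pos]; omega)
  have hlt : (Wt V d ζ).card < 2 * d := by
    by_contra hh
    push Not at hh
    obtain ⟨t, ht⟩ : ∃ t, ζ.card = t := ⟨_, rfl⟩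
    obtain ⟨N, hN⟩ : ∃ N, (Wt V d ζ).card = N := ⟨_, rfl⟩
    rw [ht, hN] at hcount
    rw [hN] at hh
    rw [ht] at hc
    obtain ⟨e, rfl⟩ : ∃ e, d = e + 1 := ⟨d - 1, by omega⟩
    simp only [Nat.add_sub_cancel] at hcount
    have : t * (2 * (e + 1)) ≤ t * N := Nat.mul_le_mul_left t hh
    nlinarith
  intro htop
  obtain ⟨φ, hφ⟩ := exists_gen V
  have h0 : ∀ v ∈ Wt V d ζ, φ v ≠ 0 := by
    intro v hv hv0
    apply hφ v (Wt_V hv) v (Wt_V hv) (ne_neg_self hS (Wt_V hv))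
    rw [map_add, hv0, add_zero]
  have hhalf := card_half φ (fun v hv => Wt_neg hv) h0
  set H := (Wt V d ζ).filter (fun v => 0 < φ v) with hH
  have hle : Submodule.span ℝ (Wt V d ζ : Set E) ≤ Submodule.span ℝ (H : Set E) := by
    rw [Submodule.span_le]
    intro v hv
    rcases lt_or_gt_of_ne (h0 v hv) with hl | hg
    · have : -v ∈ H := by
        rw [hH, Finset.mem_filter]
        exact ⟨Wt_neg hv, by rw [map_neg]; linarith⟩
      have h2 := Submodule.neg_mem _ (Submodule.subset_span (R := ℝ) (s := (H : Set E)) this)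
      rw [neg_neg] at h2
      exact h2
    · exact Submodule.subset_span (by simpa [hH] using ⟨hv, hg⟩)
  rw [htop, top_le_iff] at hle
  have h1 := finrank_span_finset_le_card (R := ℝ) H
  change Module.finrank ℝ (Submodule.span ℝ (H : Set E)) ≤ _ at h1
  rw [hle, finrank_top, hS.fr] at h1
  omega

theorem Dd.xw (hG : Good V d) {τ Sg ζ : Finset E} {u w : E} (h : Dd V d τ Sg ζ u w) {x : E}
    (hx : x ∈ Wt V d (insert u ζ)) : x ≠ w ∧ x ≠ -w := by
  constructor
  · rintro rfl; exact h.nw hG (Wt_face (Wt_neg hx))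
  · rintro rfl; exact h.nw hG (Wt_face hx)

theorem Dd.toQ (hG : Good V d) {τ Sg ζ : Finset E} {u w : E} (h : Dd V d τ Sg ζ u w) {x : E}
    (hx : x ∈ Wt V d (insert u ζ)) (hwx : Fc V d (insert w (insert x ζ))) :
    Fc V d (insert x (insert w (insert u ζ))) := by
  have hc := h.ζc
  have hcc := Finset.card_insert_of_notMem h.uζ
  rcases lemM hG (h.fI.mono (Finset.subset_insert _ _)) (by omega) hwx.pair h.fI (Wt_face hx) with hh | hh
  · exact hh.swap2
  · exact absurd (hh.mono (by intro r; simp only [Finset.mem_insert]; tauto)) (h.nw hG)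

theorem Dd.half (hG : Good V d) (hd : 6 ≤ d) {τ Sg ζ : Finset E} {u w : E} (h : Dd V d τ Sg ζ u w) {x : E}
    (hx : x ∈ Wt V d (insert u ζ)) : x ∈ QQ Sg ζ u w ∨ -x ∈ QQ Sg ζ u w := by
  have hS := hG.S
  have hc := h.ζc
  have hkey : ∀ y, y ∈ Wt V d (insert u ζ) → Fc V d (insert w (insert y ζ)) → y ∈ QQ Sg ζ u w := by
    intro y hy hf
    refine Finset.mem_sdiff.2 ⟨h.inS (h.toQ hG hy hf), ?_⟩
    rw [Finset.mem_insert, not_or]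
    exact ⟨(h.xw hG hy).1, Wt_notMem hy⟩
  by_contra hcon
  rw [not_or] at hcon
  have n1 : ¬ Fc V d (insert w (insert x ζ)) := fun hh => hcon.1 (hkey x hx hh)
  have n2 : ¬ Fc V d (insert w (insert (-x) ζ)) := fun hh => hcon.2 (hkey _ (Wt_neg hx) hh)
  have hxζ : x ∈ Wt V d ζ := Wt_anti hS (Finset.subset_insert u ζ) hx
  obtain ⟨huW, hwW⟩ := h.mem hG
  obtain ⟨hxw, hxw'⟩ := h.xw hG hx
  have hdual : ∀ p ∈ Wt V d ζ, ∃ c : Module.Dual ℝ E, c p = 1 ∧ ∀ y ∈ Wt V d ζ, y ≠ p → y ≠ -p → c y = 0 := by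
    intro p hp
    have hpp := neg_ne hS (Wt_V hp)
    obtain ⟨c, hcc⟩ := nonspan hG h.fζ (by omega) (h.span hG hd)
      (fun y => if y = p then 1 else if y = -p then -1 else 0) (by
        intro y hy
        by_cases h1 : y = p
        · subst h1; simp [hpp]
        by_cases h2 : y = -p
        · subst h2; simp [hpp]
        have h3 : -y ≠ p := fun hh => h2 (by rw [← hh, neg_neg])
        have h4 : -y ≠ -p := fun hh => h1 (neg_injective hh)
        simp [h1, h2, h3])
    refine ⟨c, by rw [hcc p hp]; simp, fun y hy h1 h2 => by rw [hcc y hy]; simp [h1, h2]⟩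
  obtain ⟨cx, hcx1, hcx0⟩ := hdual x hxζ
  obtain ⟨cw, hcw1, hcw0⟩ := hdual w hwW
  have hwx' : w ≠ -x := by rintro rfl; exact hxw' (by rw [neg_neg])
  have z1 : cx w = 0 := hcx0 w hwW hxw.symm hwx'
  have z2 : cw x = 0 := hcw0 x hxζ hxw hxw'
  obtain ⟨B, hB, hBw, hBx, -⟩ := two hG h.fζ (by omega) hwW hxζ hxw hxw' cx cw (by
      intro y hy _ _ h3 h4
      rw [map_sub, z1, hcx0 y hy h3 h4, sub_zero]) (by
      intro y hy h1 h2 _ _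
      rw [map_sub, z2, hcw0 y hy h1 h2, sub_zero]) (fun hh => absurd hh n1) (fun hh => absurd hh n2)
  have := alt_swap hB w x
  rw [hBw, hBx, hcx1, hcw1] at this
  norm_num at this

theorem Dd.full (hG : Good V d) (hd : 6 ≤ d) {τ Sg ζ : Finset E} {u w : E} (h : Dd V d τ Sg ζ u w) {q : E}
    (hq : q ∈ QQ Sg ζ u w) : q ∈ Wt V d (insert u ζ) := by
  have hc := h.ζc
  have hcc := Finset.card_insert_of_notMem h.uζ
  have hne := lemN hG h.fζ (by omega) (by omega) (h.mem hG).1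
  have h6 := three hG (h.fI.mono (Finset.subset_insert _ _)) (by omega) hne
  by_contra hcon
  set Q' := (QQ Sg ζ u w).erase q with hQ'
  have hQc : Q'.card = 2 := by rw [hQ', Finset.card_erase_of_mem hq, h.cardQ]
  have hsub : Wt V d (insert u ζ) ⊆ Q' ∪ Q'.image (fun v => -v) := by
    intro x hx
    rw [Finset.mem_union, Finset.mem_image]
    rcases h.half hG hd hx with h1 | h1
    · left
      exact Finset.mem_erase.2 ⟨fun hh => hcon (hh ▸ hx), h1⟩
    · right
      exact ⟨-x, Finset.mem_erase.2 ⟨fun hh => hcon (hh ▸ Wt_neg hx), h1⟩, neg_neg x⟩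
  have h1 := Finset.card_le_card hsub
  have h2 := Finset.card_union_le Q' (Q'.image (fun v => -v))
  have h3 := Finset.card_image_le (s := Q') (f := fun v => -v)
  omega

theorem Dd.false (hG : Good V d) (hd : 6 ≤ d) {τ Sg ζ : Finset E} {u w : E} (h : Dd V d τ Sg ζ u w) :
    False := by
  have hS := hG.S
  obtain ⟨q, hq⟩ := h.exQ
  have hu := h.full hG hd hq
  have hq' : q ∈ QQ Sg ζ w u := by
    unfold QQ at hq ⊢
    rwa [Finset.insert_comm]
  have hw := h.symm.full hG hd hq'
  have k1 := h.toQ hG (Wt_neg hu) (Wt_face (Wt_neg hw)).swap2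
  obtain ⟨z, hz, hzq⟩ := h.exQ2 q
  have k2 : Fc V d (insert q τ) := by
    apply (h.fz hz).fc.mono
    intro r hr
    rw [Finset.mem_insert] at hr
    rcases hr with rfl | hr
    · exact Finset.mem_erase.2 ⟨hzq.symm, (Finset.mem_sdiff.1 hq).1⟩
    · refine Finset.mem_erase.2 ⟨?_, h.sub hr⟩
      rintro rfl
      exact (Finset.mem_sdiff.1 hz).2 (h.τζ hr)
  have : q ∈ Wt V d τ := mem_Wt_of hS k2 (k1.mono (Finset.insert_subset_insert _ h.τζ))
  rw [h.W] at this; simp at this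

theorem nonempty4 (hG : Good V d) (hpr : Prm V d) {τ : Finset E} (hc : τ.card + 4 = d)
    (hτ : Fc V d τ) : (Wt V d τ).Nonempty := by
  rw [Finset.nonempty_iff_ne_empty]
  intro hW
  have hS := hG.S
  have hd := hG.hd
  obtain ⟨Sg, hSc, hsub, hf, hg⟩ := claimC hG hpr hc hτ hW
  have hσ : (Sg \ τ).card = 5 := by rw [Finset.card_sdiff_of_subset hsub]; omega
  by_cases hall : ∀ w ∈ τ, Fc V d (Sg.erase w)
  · have hall' : ∀ x ∈ Sg, x ∉ (∅ : Finset E) → Fct V d (Sg.erase x) := by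
      intro x hx _
      by_cases hxτ : x ∈ τ
      · exact (hall x hxτ).fct (by rw [Finset.card_erase_of_mem hx]; omega)
      · exact hf x hx hxτ
    have hex : ∀ s : Finset E, s.card ≤ 2 → ∃ x ∈ Sg, x ∉ s := by
      intro s hs
      by_contra hh
      push Not at hh
      have := Finset.card_le_card (show Sg ⊆ s from hh)
      omega
    have hV : ∀ v ∈ V, v ∈ Sg := by
      intro v hv
      obtain ⟨G, hGf, hGs⟩ := fc_single hS hv
      obtain ⟨x, hx, _⟩ := hex ∅ (by simp)
      exact lemmaSigma hS hSc (Finset.empty_subset Sg) ⟨x, hx, by simp⟩ hall' hGf (by simp)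
        (hGs (by simp))
    obtain ⟨v, hv, -⟩ := hex ∅ (by simp)
    obtain ⟨x, hx, hxv⟩ := hex {v} (by simp)
    have hvV : v ∈ V := (hall' x hx (by simp)).sub (Finset.mem_erase.2 ⟨fun h => hxv (by simp [h]), hv⟩)
    obtain ⟨y, hy, hyv⟩ := hex {v, -v} Finset.card_le_two
    simp only [Finset.mem_insert, Finset.mem_singleton, not_or] at hyv
    exact (hall' y hy (by simp)).fc.not_anti hS (v := v) (Finset.mem_erase.2 ⟨Ne.symm hyv.1, hv⟩)
      (Finset.mem_erase.2 ⟨Ne.symm hyv.2, hV _ (hS.neg v hvV)⟩)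
  · push Not at hall
    obtain ⟨w, hwτ, hw⟩ := hall
    have hwS := hsub hwτ
    obtain ⟨u, hu, huK⟩ : ∃ u ∈ Sg.erase w, ¬ Fc V d ((Sg.erase w).erase u) := by
      by_contra hh
      push Not at hh
      exact hw (hpr _ (by rw [Finset.card_erase_of_mem hwS]; omega) hh)
    obtain ⟨huw, huS⟩ := Finset.mem_erase.1 hu
    have huτ : u ∈ τ := by
      by_contra hh
      apply huK
      rw [Finset.erase_right_comm]
      exact (hf u huS hh).fc.mono (Finset.erase_subset _ _)
    obtain ⟨η, hη, hηc⟩ := Finset.exists_subset_card_eq (s := Sg \ τ) (n := 2) (by omega)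
    have hdisj : Disjoint ((τ.erase w).erase u) η := by
      rw [Finset.disjoint_left]
      intro r h1 h2
      exact (Finset.mem_sdiff.1 (hη h2)).2 (Finset.mem_of_mem_erase (Finset.mem_of_mem_erase h1))
    have hc1 : (τ.erase w).card + 1 = τ.card := Finset.card_erase_add_one hwτ
    have hc2 : ((τ.erase w).erase u).card + 1 = (τ.erase w).card :=
      Finset.card_erase_add_one (Finset.mem_erase.2 ⟨huw, huτ⟩)
    have hD : Dd V d τ Sg ((τ.erase w).erase u ∪ η) u w :=
      { c := hc, W := hW, Sc := hSc, sub := hsub, f := hf, g := hg, mu := huτ, mw := hwτ, uw := huw, K := huK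
        ζs := by
          intro r hr
          rcases Finset.mem_union.1 hr with h1 | h1
          · exact hsub (Finset.mem_of_mem_erase (Finset.mem_of_mem_erase h1))
          · exact (Finset.mem_sdiff.1 (hη h1)).1
        ζc := by rw [Finset.card_union_of_disjoint hdisj]; omega
        uζ := by
          rw [Finset.mem_union, not_or]
          exact ⟨by simp, fun hh => (Finset.mem_sdiff.1 (hη hh)).2 huτ⟩
        wζ := by
          rw [Finset.mem_union, not_or]
          exact ⟨by simp, fun hh => (Finset.mem_sdiff.1 (hη hh)).2 hwτ⟩
        τζ := by
          intro r hr
          simp only [Finset.mem_insert, Finset.mem_union, Finset.mem_erase]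
          tauto }
    exact hD.false hG (by omega)

end CSP

namespace CSP
variable {E : Type} [AddCommGroup E] [Module ℝ E] [FiniteDimensional ℝ E]
variable {V : Finset E} {d : ℕ}

theorem main_card (hG : Good V d) (hpr : Prm V d) (k : ℕ) (hk : 4 ≤ k) :
    ∀ τ : Finset E, τ.card + k = d → Fc V d τ → 2 * k ≤ (Wt V d τ).card := by
  induction k, hk using Nat.le_induction with
  | base =>
    intro τ hc hτ
    exact four hG hτ hc (nonempty4 hG hpr hc hτ)
  | succ k hk ih =>
    intro τ hc hτ
    have hτ' := hτ
    obtain ⟨F, hF, hτF⟩ := hτ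
    obtain ⟨τ', h1, h2, h3⟩ := Finset.exists_subsuperset_card_eq (n := d - 4) hτF (by omega)
      (by rw [hF.2.1]; omega)
    have hτ'F : Fc V d τ' := ⟨F, hF, h2⟩
    obtain ⟨u, hu⟩ := nonempty4 hG hpr (by omega) hτ'F
    have hu' := Wt_anti hG.S h1 hu
    have hun : u ∉ τ := Wt_notMem hu'
    have := ih (insert u τ) (by rw [Finset.card_insert_of_notMem hun]; omega) (Wt_face hu')
    have := card_extend hG.S hu' this
    omega

theorem main_abs (hG : Good V d) (hpr : Prm V d) (k : ℕ) (hk : 4 ≤ k)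
    (τ : Finset E) (hc : τ.card + k = d) (hτ : Fc V d τ) :
    ∃ v : Fin k → E, (∀ i j, i ≠ j → v i ≠ v j ∧ v i ≠ -(v j)) ∧ ∀ i, v i ∈ Wt V d τ := by
  have h := main_card hG hpr k hk τ hc hτ
  obtain ⟨φ, hφ⟩ := exists_gen V
  have h0 : ∀ v ∈ Wt V d τ, φ v ≠ 0 := by
    intro v hv h
    have hvV := mem_V_of_Nb (mem_Wt.1 hv).1
    apply hφ v hvV v hvV (ne_neg_self hG.S hvV)
    rw [map_add, h, add_zero]
  have h2 := card_half φ (fun v hv => Wt_neg hv) h0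
  obtain ⟨X, hX, hXc⟩ := Finset.exists_subset_card_eq (s := (Wt V d τ).filter (fun v => 0 < φ v))
    (n := k) (by omega)
  let e := (X.equivFinOfCardEq hXc).symm
  have he : ∀ i, (e i : E) ∈ Wt V d τ ∧ 0 < φ (e i) := fun i => by
    have := hX (e i).2
    rwa [Finset.mem_filter] at this
  refine ⟨fun i => (e i : E), ?_, fun i => (he i).1⟩
  intro i j hij
  constructor
  · intro hh
    exact hij (e.injective (Subtype.ext hh))
  · intro hh
    have h1 := (he i).2
    have h2 := (he j).2
    have hh' : (e i : E) = -(e j : E) := hh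
    rw [hh', map_neg] at h1
    linarith

theorem card_OE (X : Finset (Finset E)) (hX : ∀ e, e ∈ X ↔ e.card = 2 ∧ Fc V d e) :
    (OE V d).card = 2 * X.card := by
  have hm : ∀ p ∈ OE V d, ({p.1, p.2} : Finset E) ∈ X := by
    rintro ⟨u, v⟩ hp
    rw [mem_OE] at hp
    exact (hX _).2 ⟨Finset.card_pair hp.1, hp.2⟩
  rw [Finset.card_eq_sum_card_fiberwise (f := fun p : E × E => ({p.1, p.2} : Finset E)) (t := X) hm]
  rw [Finset.sum_const_nat (m := 2), mul_comm]
  intro e he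
  obtain ⟨h2, hf⟩ := (hX e).1 he
  obtain ⟨a, b, hab, rfl⟩ := Finset.card_eq_two.1 h2
  have : (OE V d).filter (fun p : E × E => ({p.1, p.2} : Finset E) = {a, b}) = {(a, b), (b, a)} := by
    ext ⟨u, v⟩
    rw [Finset.mem_filter, mem_OE, Finset.mem_insert, Finset.mem_singleton, Prod.mk.injEq, Prod.mk.injEq]
    constructor
    · rintro ⟨⟨huv, -⟩, hh⟩
      have k1 : u ∈ ({a, b} : Finset E) := by rw [← hh]; simp
      have k2 : v ∈ ({a, b} : Finset E) := by rw [← hh]; simp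
      simp only [Finset.mem_insert, Finset.mem_singleton] at k1 k2
      rcases k1 with rfl | rfl <;> rcases k2 with rfl | rfl
      · exact absurd rfl huv
      · exact Or.inl ⟨rfl, rfl⟩
      · exact Or.inr ⟨rfl, rfl⟩
      · exact absurd rfl huv
    · rintro (⟨rfl, rfl⟩ | ⟨rfl, rfl⟩)
      · exact ⟨⟨hab, hf⟩, rfl⟩
      · exact ⟨⟨hab.symm, by rwa [Finset.pair_comm]⟩, Finset.pair_comm _ _⟩
  rw [this]
  exact Finset.card_pair (by intro h; exact hab (Prod.mk.inj h).1)

theorem mem_er {s : Finset E} {x y : E} : x ∈ s.erase y ↔ x ≠ y ∧ x ∈ s := Finset.mem_erase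

theorem mem_ins {s : Finset E} {x y : E} : x ∈ insert y s ↔ x = y ∨ x ∈ s := Finset.mem_insert

end CSP

namespace CSP

theorem body_le {d : ℕ} {V : Finset (Fin d → ℝ)} {n : (Fin d → ℝ) →ₗ[ℝ] ℝ} {c : ℝ}
    (h : ∀ v ∈ V, n v ≤ c) : ∀ y ∈ polyBody V, n y ≤ c := by
  intro y hy
  have : polyBody V ⊆ {y | n y ≤ c} :=
    convexHull_min (fun v hv => h v hv) (convex_halfSpace_le n.isLinear c)
  exact this hy

theorem V_ne {d : ℕ} (P : SPolytope d) : P.V.Nonempty := by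
  rw [Finset.nonempty_iff_ne_empty]
  intro h
  have := P.span_top
  rw [h, Finset.coe_empty, AffineSubspace.span_empty] at this
  exact AffineSubspace.bot_ne_top ℝ _ _ this

theorem sub_body {d : ℕ} (V : Finset (Fin d → ℝ)) {v : Fin d → ℝ} (hv : v ∈ V) : v ∈ polyBody V :=
  subset_convexHull ℝ _ hv

theorem zero_body {d : ℕ} (P : SPolytope d) (hcs : IsCS P) : (0 : Fin d → ℝ) ∈ polyBody P.V := by
  obtain ⟨v, hv⟩ := V_ne P
  have h := (convex_convexHull ℝ (P.V : Set (Fin d → ℝ))) (sub_body P.V hv) (sub_body P.V (hcs v hv))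
    (a := 1/2) (b := 1/2) (by norm_num) (by norm_num) (by norm_num)
  have e : (1/2 : ℝ) • v + (1/2 : ℝ) • (-v) = 0 := by rw [smul_neg, add_neg_cancel]
  rw [e] at h
  exact h

theorem proper_of {d : ℕ} (P : SPolytope d) (hcs : IsCS P) {n : (Fin d → ℝ) →ₗ[ℝ] ℝ}
    (hn : ∀ v ∈ P.V, n v ≤ 1) : IsProperFace P.V {y ∈ polyBody P.V | n y = 1} := by
  refine ⟨⟨n, 1, body_le hn, rfl⟩, ?_⟩
  intro h
  have h0 := zero_body P hcs
  rw [← h] at h0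
  have := h0.2
  rw [map_zero] at this
  exact zero_ne_one this

theorem span_V {d : ℕ} (P : SPolytope d) : Submodule.span ℝ (P.V : Set (Fin d → ℝ)) = ⊤ := by
  have h := affineSpan_le_toAffineSubspace_span (k := ℝ) (s := (P.V : Set (Fin d → ℝ)))
  rw [P.span_top] at h
  rw [eq_top_iff]
  intro x _
  exact h (AffineSubspace.mem_top ℝ _ x)

theorem sys_of {d : ℕ} (hd : 5 ≤ d) (P : SPolytope d) (hcs : IsCS P) : Sys P.V d where
  fr := by simp
  neg := hcs
  span := span_V P
  simp := by
    intro n hn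
    have h := (P.simplicial _ (proper_of P hcs hn)).1
    rw [affineIndependent_iff] at h
    have hset : ∀ x, x ∈ P.V ∧ n x = 1 → x ∈ (P.V : Set (Fin d → ℝ)) ∩ {y ∈ polyBody P.V | n y = 1} :=
      fun x hx => ⟨hx.1, sub_body _ hx.1, hx.2⟩
    unfold LinearIndepOn
    rw [linearIndependent_iff']
    intro s g hg i hi
    let em : {x : Fin d → ℝ | x ∈ P.V ∧ n x = 1} ↪
        {y : Fin d → ℝ // y ∈ (P.V : Set (Fin d → ℝ)) ∩ {y ∈ polyBody P.V | n y = 1}} :=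
      ⟨fun x => ⟨x.1, hset x.1 x.2⟩, fun a b hab => Subtype.ext (Subtype.mk.inj hab)⟩
    let w : {y : Fin d → ℝ // y ∈ (P.V : Set (Fin d → ℝ)) ∩ {y ∈ polyBody P.V | n y = 1}} → ℝ :=
      fun y => g ⟨y.1, y.2.1, y.2.2.2⟩
    have hsum : ∑ i ∈ s, g i = 0 := by
      have := congrArg n hg
      rw [map_sum, map_zero] at this
      rw [← this]
      apply Finset.sum_congr rfl
      intro x hx
      have hx1 : n (id (x : Fin d → ℝ)) = 1 := x.2.2
      rw [map_smul, hx1, smul_eq_mul, mul_one]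
    have := h (s.map em) w (by rw [Finset.sum_map]; exact hsum) (by rw [Finset.sum_map]; exact hg)
      (em i) (Finset.mem_map_of_mem em hi)
    exact this
  vtx := by
    intro v hv
    have hcl : IsClosed (convexHull ℝ ((P.V.erase v : Finset (Fin d → ℝ)) : Set (Fin d → ℝ))) :=
      (Finset.finite_toSet _).isClosed_convexHull ℝ
    obtain ⟨f, u, hf1, hf2⟩ := geometric_hahn_banach_point_closed (convex_convexHull ℝ _) hcl
      (P.extreme v hv)
    have hlt : ∀ b ∈ P.V, b ≠ v → f v < f b := fun b hb hbv =>
      hf1.trans (hf2 b (subset_convexHull ℝ _ (by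
        rw [Finset.mem_coe, Finset.mem_erase]; exact ⟨hbv, hb⟩)))
    have hneg : f v < 0 := by
      by_cases h : -v = v
      · exfalso
        have hv0 : v = 0 := by
          have := self_eq_neg.1 h.symm
          exact this
        subst hv0
        have hex : ∃ w ∈ P.V, w ≠ 0 := by
          by_contra hcon
          push Not at hcon
          have hs := span_V P
          have hb : Submodule.span ℝ (P.V : Set (Fin d → ℝ)) = ⊥ := by
            rw [Submodule.span_eq_bot]; exact hcon
          have hfr : Module.finrank ℝ (⊤ : Submodule ℝ (Fin d → ℝ)) = 0 := by
            rw [← hs, hb, finrank_bot]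
          rw [finrank_top] at hfr
          simp at hfr
          omega
        obtain ⟨w, hw, hw0⟩ := hex
        have h1 := hlt w hw hw0
        have h2 := hlt (-w) (hcs w hw) (neg_ne_zero.2 hw0)
        rw [map_zero] at h1 h2
        rw [map_neg] at h2
        linarith
      · have := hlt (-v) (hcs v hv) h
        rw [map_neg] at this
        linarith
    refine ⟨(f v)⁻¹ • (f : (Fin d → ℝ) →ₗ[ℝ] ℝ), ?_, ?_⟩
    · change (f v)⁻¹ * f v = 1
      exact inv_mul_cancel₀ hneg.ne
    · intro b hb
      change (f v)⁻¹ * f b ≤ 1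
      have hle : f v ≤ f b := by
        by_cases h : b = v
        · rw [h]
        · exact (hlt b hb h).le
      rw [← inv_mul_cancel₀ hneg.ne]
      exact mul_le_mul_of_nonpos_left hle (inv_nonpos.2 hneg.le)

theorem bface_iff {d : ℕ} (hd : 5 ≤ d) (P : SPolytope d) (hcs : IsCS P) (s : Finset (Fin d → ℝ)) :
    BFace P s ↔ Fc P.V d s := by
  have hS := sys_of hd P hcs
  constructor
  · rintro ⟨hsV, F, ⟨⟨f, c, hle, hF⟩, hne⟩, hsF⟩
    have h0 := zero_body P hcs
    have hc0 : 0 ≤ c := by have := hle 0 h0; rwa [map_zero] at this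
    have hc : 0 < c := by
      rcases hc0.lt_or_eq with h | h
      · exact h
      · exfalso
        apply hne
        have hz : ∀ v ∈ P.V, f v = 0 := by
          intro v hv
          have h1 := hle v (sub_body _ hv)
          have h2 := hle (-v) (sub_body _ (hcs v hv))
          rw [map_neg] at h2
          linarith
        have hf0 : ∀ y ∈ polyBody P.V, -f y ≤ 0 := by
          intro y hy
          exact body_le (n := -f) (c := 0) (fun v hv => by rw [LinearMap.neg_apply, hz v hv]; simp) y hy
        rw [hF]
        ext y
        constructor
        · exact fun h => h.1
        · intro hy
          refine ⟨hy, ?_⟩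
          have h1 := hle y hy
          have h2 := hf0 y hy
          linarith
    obtain ⟨G, hG, hGm⟩ := extend_sup hS (n := c⁻¹ • f) (by
      intro v hv
      change c⁻¹ * f v ≤ 1
      rw [← inv_mul_cancel₀ hc.ne']
      exact mul_le_mul_of_nonneg_left (hle v (sub_body _ hv)) (inv_nonneg.2 hc.le))
    refine ⟨G, hG, fun v hv => hGm v (hsV hv) ?_⟩
    have hv' := hsF hv
    rw [hF] at hv'
    change c⁻¹ * f v = 1
    rw [hv'.2, inv_mul_cancel₀ hc.ne']
  · rintro ⟨F, ⟨hFV, hFc, n, hn1, hn2⟩, hsF⟩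
    have hn : ∀ v ∈ P.V, n v ≤ 1 := by
      intro v hv
      by_cases h : v ∈ F
      · exact (hn1 v h).le
      · exact (hn2 v hv h).le
    exact ⟨hsF.trans hFV, _, proper_of P hcs hn, fun v hv => ⟨sub_body _ (hFV (hsF hv)), hn1 v (hsF hv)⟩⟩

theorem good_of {d : ℕ} (hd : 5 ≤ d) (P : SPolytope d) (hcs : IsCS P)
    (hg2 : g2 P = (d.choose 2 : ℤ) - (d : ℤ)) : Good P.V d where
  S := sys_of hd P hcs
  hd := hd
  E := by
    have h1 := card_OE (V := P.V) (d := d) (edgeFinset P) (by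
      intro e
      unfold edgeFinset
      rw [Finset.mem_filter, Finset.mem_powerset, bface_iff hd P hcs]
      constructor
      · exact fun h => h.2
      · exact fun h => ⟨((bface_iff hd P hcs e).2 h.2).1, h⟩)
    unfold EC
    rw [h1]
    unfold g2 f1 f0 at hg2
    have h2 : (d + 1).choose 2 = d + d.choose 2 := by
      rw [Nat.choose_succ_succ' d 1, Nat.choose_one_right]
    rw [h2] at hg2
    push_cast at hg2
    zify
    linarith

theorem prm_of {d : ℕ} (hd : 5 ≤ d) (P : SPolytope d) (hcs : IsCS P) (hp : IsPrimePoly P) :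
    Prm P.V d := by
  intro σ hc hσ
  by_contra hcon
  apply hp
  refine ⟨σ, ⟨?_, ?_, ?_⟩, hc⟩
  · intro x hx
    obtain ⟨y, hy, hyx⟩ := Finset.exists_mem_ne (s := σ) (by omega) x
    exact ((bface_iff hd P hcs _).2 (hσ y hy)).1 (mem_er.2 ⟨hyx.symm, hx⟩)
  · rwa [bface_iff hd P hcs]
  · intro τ hτ
    rw [bface_iff hd P hcs]
    obtain ⟨h1, x, hx, hxτ⟩ := Finset.ssubset_iff_exists_subset_erase.1 hτ |> fun ⟨x, hx, h⟩ =>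
      (⟨hτ.1, x, hx, h⟩ : τ ⊆ σ ∧ ∃ x, ∃ _ : x ∈ σ, τ ⊆ σ.erase x)
    obtain ⟨F, hF, hs⟩ := hσ x hx
    refine ⟨F, hF, fun z hz => hs ?_⟩
    exact mem_er.2 (Finset.mem_erase.1 (hxτ hz))

theorem link_of {d : ℕ} (hd : 5 ≤ d) (P : SPolytope d) (hcs : IsCS P) {τ : Finset (Fin d → ℝ)}
    {x : Fin d → ℝ} (hx : x ∈ Wt P.V d τ) : LinkFace P τ {x} := by
  refine ⟨?_, ?_⟩
  · rw [Finset.disjoint_singleton_left]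
    exact Wt_notMem hx
  · rw [bface_iff hd P hcs]
    obtain ⟨F, hF, hs⟩ := Wt_face hx
    refine ⟨F, hF, fun z hz => hs ?_⟩
    rw [Finset.mem_union, Finset.mem_singleton] at hz
    exact mem_ins.2 hz

end CSP

/-- Let `d ≥ 5` and let `P` be a prime cs simplicial `d`-polytope with
`g₂(P) = C(d,2) - d`. For every `k` with `4 ≤ k ≤ d` and every face `τ` of `∂P` of
cardinality `d - k`, the link `lk(τ)` contains at least `k` pairs of antipodal
vertices. -/
theorem stmt17 {d : ℕ} (hd : 5 ≤ d) (P : SPolytope d) (hp : IsPrimePoly P) (hcs : IsCS P)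
    (hg2 : g2 P = (d.choose 2 : ℤ) - (d : ℤ)) (k : ℕ) (hk4 : 4 ≤ k) (hkd : k ≤ d)
    (τ : Finset (Fin d → ℝ)) (hτ : BFace P τ) (hcard : τ.card = d - k) :
    ∃ v : Fin k → (Fin d → ℝ),
      (∀ i j, i ≠ j → v i ≠ v j ∧ v i ≠ -(v j)) ∧
      ∀ i, LinkFace P τ {v i} ∧ LinkFace P τ {-(v i)} := by
  obtain ⟨v, hv1, hv2⟩ := CSP.main_abs (CSP.good_of hd P hcs hg2) (CSP.prm_of hd P hcs hp) k hk4 τ (by omega) ((CSP.bface_iff hd P hcs τ).1 hτ)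
  exact ⟨v, hv1, fun i => ⟨CSP.link_of hd P hcs (hv2 i), CSP.link_of hd P hcs (CSP.Wt_neg (hv2 i))⟩⟩
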